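/- arXiv:1705.09941 — 6 statements merged into one kernel-verified Lean document; each statement's English description precedes it below -/
import Mathlib

section
/- Let E be a locally compact subset of a metric space X with countably many connected components. Then for every δ ∈ (0, +∞], H^1(E) = L_δ(E). -/
open MeasureTheory ENNReal

/-- `Lδ(E)`: supremum of `∑ diam Eᵢ` over finite pairwise disjoint families of
compact connected subsets of `E` with diameters at most `δ`. -/
noncomputable def Ldelta {X : Type*} [MetricSpace X] (E : Set X) (δ : ℝ≥0∞) : ℝ≥0∞ :=
  ⨆ (n : ℕ) (F : Fin n → Set X) (_ : ∀ i, F i ⊆ E) (_ : ∀ i, IsCompact (F i))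
    (_ : ∀ i, IsConnected (F i)) (_ : ∀ i, EMetric.diam (F i) ≤ δ)
    (_ : Pairwise (Function.onFun Disjoint F)),
    ∑ i, EMetric.diam (F i)

open Set Filter Topology Metric

/-- The Hausdorff length of a preconnected set is at least its diameter. -/
theorem IsPreconnected.ediam_le_hausdorffMeasure_one {X : Type*} [MetricSpace X]
    [MeasurableSpace X] [BorelSpace X] {F : Set X} (hF : IsPreconnected F) :
    ediam F ≤ μH[1] F := by
  refine ediam_le fun x hx y hy => ?_
  have hLip : LipschitzWith 1 (fun z => dist z x) := LipschitzWith.dist_left x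
  have hsub : Icc 0 (dist y x) ⊆ (fun z => dist z x) '' F :=
    (hF.image _ hLip.continuous.continuousOn).Icc_subset ⟨x, hx, dist_self x⟩ ⟨y, hy, rfl⟩
  calc edist x y = volume (Icc 0 (dist y x)) := by
        rw [Real.volume_Icc, sub_zero, edist_comm, edist_dist]
    _ ≤ μH[1] ((fun z => dist z x) '' F) := by
        rw [hausdorffMeasure_real]
        exact measure_mono hsub
    _ ≤ μH[1] F := by
        simpa using hLip.hausdorffMeasure_image_le zero_le_one F

theorem Ldelta_le_hausdorffMeasure {X : Type*} [MetricSpace X] [MeasurableSpace X]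
    [BorelSpace X] (E : Set X) (δ : ℝ≥0∞) : Ldelta E δ ≤ μH[1] E := by
  refine iSup_le fun n => iSup_le fun F => iSup_le fun hsub => iSup_le fun hcpt =>
    iSup_le fun hconn => iSup_le fun _ => iSup_le fun hdisj => ?_
  calc ∑ i, ediam (F i) ≤ ∑ i, μH[1] (F i) :=
        Finset.sum_le_sum fun i _ => (hconn i).isPreconnected.ediam_le_hausdorffMeasure_one
    _ = μH[1] (⋃ i, F i) := by
        rw [measure_iUnion hdisj fun i => (hcpt i).measurableSet, tsum_fintype]
    _ ≤ μH[1] E := measure_mono (iUnion_subset hsub)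

theorem sum_ediam_le_Ldelta {X ι : Type*} [MetricSpace X] {E : Set X} {δ : ℝ≥0∞}
    (s : Finset ι) (F : ι → Set X) (hsub : ∀ i ∈ s, F i ⊆ E) (hcpt : ∀ i ∈ s, IsCompact (F i))
    (hconn : ∀ i ∈ s, IsConnected (F i)) (hdiam : ∀ i ∈ s, ediam (F i) ≤ δ)
    (hdisj : (s : Set ι).PairwiseDisjoint F) :
    ∑ i ∈ s, ediam (F i) ≤ Ldelta E δ := by
  let e := s.equivFin.symm
  have hsum : ∑ i ∈ s, ediam (F i) = ∑ j, ediam (F (e j)) := by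
    rw [← Finset.sum_coe_sort, ← e.sum_comp]
  rw [hsum]
  refine le_iSup_of_le s.card <| le_iSup_of_le (fun j => F (e j)) <|
    le_iSup_of_le (fun j => hsub _ (e j).2) <| le_iSup_of_le (fun j => hcpt _ (e j).2) <|
    le_iSup_of_le (fun j => hconn _ (e j).2) <| le_iSup_of_le (fun j => hdiam _ (e j).2) <|
    le_iSup_of_le (fun i j hij => ?_) le_rfl
  exact hdisj (e i).2 (e j).2 fun h => hij (e.injective (Subtype.ext h))

/-- In a compact Hausdorff space, each neighbourhood of a connected component contains a clopen
set around it. -/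
theorem exists_isClopen_connectedComponent_subset {K : Type*} [TopologicalSpace K]
    [CompactSpace K] [T2Space K] {x : K} {U : Set K} (hU : IsOpen U)
    (hxU : connectedComponent x ⊆ U) : ∃ V : Set K, IsClopen V ∧ x ∈ V ∧ V ⊆ U := by
  have : Nonempty {s : Set K // IsClopen s ∧ x ∈ s} := ⟨⟨univ, isClopen_univ, mem_univ x⟩⟩
  obtain ⟨V, hV⟩ := exists_subset_nhds_of_compactSpace
    (V := fun s : {s : Set K // IsClopen s ∧ x ∈ s} => (s : Set K))
    (fun s t => ⟨⟨s ∩ t, s.2.1.inter t.2.1, s.2.2, t.2.2⟩, inter_subset_left, inter_subset_right⟩)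
    (fun s => s.2.1.isClosed) (U := U) fun y hy =>
      hU.mem_nhds (hxU (connectedComponent_eq_iInter_isClopen x ▸ hy))
  exact ⟨V, V.2.1, V.2.2, hV⟩

/-- Boundary bumping: if the component of `x` in `E` leaves the open ball, then so does the
component of `x` in the part of `E` in the closed ball. -/
theorem exists_mem_connectedComponentIn_inter_closedBall {X : Type*} [MetricSpace X]
    {E : Set X} {x : X} {r : ℝ} (hx : x ∈ E) (hr : 0 < r) (hK : IsCompact (E ∩ closedBall x r))
    (hC : ¬ connectedComponentIn E x ⊆ ball x r) :
    ∃ y ∈ connectedComponentIn (E ∩ closedBall x r) x, r ≤ dist y x := by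
  by_contra! hlt
  apply hC
  set K := E ∩ closedBall x r
  have hxK : x ∈ K := ⟨hx, mem_closedBall_self hr.le⟩
  have : CompactSpace K := isCompact_iff_compactSpace.1 hK
  rw [connectedComponentIn_eq_image hxK] at hlt
  obtain ⟨V, hV, hxV, hVball⟩ := exists_isClopen_connectedComponent_subset
    (x := (⟨x, hxK⟩ : K)) (U := Subtype.val ⁻¹' ball x r) (isOpen_ball.preimage
      continuous_subtype_val) fun z hz => hlt z (mem_image_of_mem _ hz)
  obtain ⟨O, hO, hOV⟩ := isOpen_induced_iff.1 hV.isOpen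
  have hclosed : IsClosed ((↑) '' V : Set X) :=
    (hV.isClosed.isCompact.image continuous_subtype_val).isClosed
  have hopen : (Subtype.val ⁻¹' ((↑) '' V : Set X) : Set E) =
      Subtype.val ⁻¹' (O ∩ ball x r) := by
    ext ⟨z, hz⟩
    constructor
    · rintro ⟨w, hw, rfl⟩
      exact ⟨hOV.symm.subset hw, hVball hw⟩
    · rintro ⟨hzO, hzb⟩
      exact ⟨⟨z, hz, ball_subset_closedBall hzb⟩, hOV.subset hzO, rfl⟩
  have hclopen : IsClopen (Subtype.val ⁻¹' ((↑) '' V : Set X) : Set E) :=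
    ⟨hclosed.preimage continuous_subtype_val,
      hopen ▸ (hO.inter isOpen_ball).preimage continuous_subtype_val⟩
  rw [connectedComponentIn_eq_image hx]
  rintro _ ⟨z, hz, rfl⟩
  obtain ⟨w, hw, hwz⟩ := hclopen.connectedComponent_subset
    (x := (⟨x, hx⟩ : E)) ⟨⟨x, hxK⟩, hxV, rfl⟩ hz
  rw [← hwz]
  exact hVball hw

/-- The center-radius pairs of balls in which `E` is compact and which the component of the
center in `E` leaves. -/
def bumpingBalls {X : Type*} [MetricSpace X] (E : Set X) : Set (X × ℝ) :=
  {p | p.1 ∈ E ∧ 0 < p.2 ∧ IsCompact (E ∩ closedBall p.1 p.2) ∧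
    ¬ connectedComponentIn E p.1 ⊆ ball p.1 p.2}

/-- The component of the center in the part of `E` in a closed ball. -/
def ballComponent {X : Type*} [MetricSpace X] (E : Set X) (p : X × ℝ) : Set X :=
  connectedComponentIn (E ∩ closedBall p.1 p.2) p.1

section bumpingBalls

variable {X : Type*} [MetricSpace X] {E : Set X} {p : X × ℝ}

theorem ballComponent_subset : ballComponent E p ⊆ E :=
  (connectedComponentIn_subset _ _).trans inter_subset_left

theorem ballComponent_subset_closedBall : ballComponent E p ⊆ closedBall p.1 p.2 :=
  (connectedComponentIn_subset _ _).trans inter_subset_right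

theorem mem_ballComponent (hp : p ∈ bumpingBalls E) : p.1 ∈ ballComponent E p :=
  mem_connectedComponentIn ⟨hp.1, mem_closedBall_self hp.2.1.le⟩

theorem isConnected_ballComponent (hp : p ∈ bumpingBalls E) :
    IsConnected (ballComponent E p) :=
  isConnected_connectedComponentIn_iff.2 ⟨hp.1, mem_closedBall_self hp.2.1.le⟩

theorem isCompact_ballComponent (hp : p ∈ bumpingBalls E) :
    IsCompact (ballComponent E p) := by
  have hpK : p.1 ∈ E ∩ closedBall p.1 p.2 := ⟨hp.1, mem_closedBall_self hp.2.1.le⟩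
  have := isCompact_iff_compactSpace.1 hp.2.2.1
  rw [ballComponent, connectedComponentIn_eq_image hpK]
  exact isClosed_connectedComponent.isCompact.image continuous_subtype_val

theorem ofReal_le_ediam_ballComponent (hp : p ∈ bumpingBalls E) :
    ENNReal.ofReal p.2 ≤ ediam (ballComponent E p) := by
  obtain ⟨y, hy, hry⟩ :=
    exists_mem_connectedComponentIn_inter_closedBall hp.1 hp.2.1 hp.2.2.1 hp.2.2.2
  calc ENNReal.ofReal p.2 ≤ edist y p.1 := by
        rw [edist_dist]
        exact ENNReal.ofReal_le_ofReal hry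
    _ ≤ _ := edist_le_ediam_of_mem hy (mem_ballComponent hp)

theorem ediam_closedBall_le_ofReal (x : X) {r : ℝ} :
    ediam (closedBall x r) ≤ ENNReal.ofReal (2 * r) := by
  refine ediam_le_of_forall_dist_le fun y hy z hz => ?_
  linarith [dist_triangle_right y z x, mem_closedBall.1 hy, mem_closedBall.1 hz]

/-- All small balls around a point with nontrivial component are bumping balls. -/
theorem exists_forall_mem_bumpingBalls [LocallyCompactSpace E] {x : X} (hx : x ∈ E)
    (hC : connectedComponentIn E x ≠ {x}) :
    ∃ r₀ > 0, ∀ r, 0 < r → r ≤ r₀ → (x, r) ∈ bumpingBalls E := by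
  obtain ⟨r₁, hr₁, hcpt⟩ := exists_isCompact_closedBall (⟨x, hx⟩ : E)
  have hxC := mem_connectedComponentIn hx
  obtain ⟨y, hyC, hyx⟩ : ∃ y ∈ connectedComponentIn E x, y ≠ x := by
    by_contra! h
    exact hC (Subset.antisymm h (singleton_subset_iff.2 hxC))
  refine ⟨min r₁ (dist y x), lt_min hr₁ (dist_pos.2 hyx), fun r hr hle => ⟨hx, hr, ?_, ?_⟩⟩
  · have h := (hcpt.of_isClosed_subset isClosed_closedBall
      (closedBall_subset_closedBall (hle.trans (min_le_left _ _)))).image continuous_subtype_val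
    convert h using 1
    ext z
    simp [and_comm]
  · exact fun h => (mem_ball.1 (h hyC)).not_ge (hle.trans (min_le_right _ _))

/-- The points of `E` with nontrivial component have fine covers of total diameter close to
`Ldelta E δ`. -/
theorem exists_countable_cover_tsum_ediam_le [LocallyCompactSpace E] {δ ε : ℝ≥0∞} (hδ : 0 < δ)
    (hL : Ldelta E δ ≠ ∞) (hε : 0 < ε) :
    ∃ u : Set (X × ℝ), u.Countable ∧ ∃ t : u → Set X,
      {x ∈ E | connectedComponentIn E x ≠ {x}} ⊆ ⋃ p, t p ∧
      (∀ p, ediam (t p) ≤ ε) ∧ ∑' p, ediam (t p) ≤ Ldelta E δ + ε := by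
  classical
  obtain ⟨R, hR, hRδ, hRε⟩ : ∃ R : ℝ, 0 < R ∧ ENNReal.ofReal (6 * R) ≤ δ ∧
      ENNReal.ofReal (6 * R) ≤ ε := by
    have hm : min (min δ ε) 1 ≠ ∞ := ((min_le_right _ _).trans_lt one_lt_top).ne
    have hm0 : 0 < min (min δ ε) 1 := lt_min (lt_min hδ hε) one_pos
    refine ⟨(min (min δ ε) 1).toReal / 6, by have := toReal_pos hm0.ne' hm; positivity, ?_, ?_⟩ <;>
      rw [mul_div_cancel₀ _ (by norm_num), ofReal_toReal hm]
    · exact (min_le_left _ _).trans (min_le_left _ _)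
    · exact (min_le_left _ _).trans (min_le_right _ _)
  obtain ⟨u, hu, hdisj, hVit⟩ := Vitali.exists_disjoint_subfamily_covering_enlargement
    (ballComponent E) {p ∈ bumpingBalls E | p.2 ≤ R} Prod.snd 2 one_lt_two
    (fun p hp => hp.1.2.1.le) R (fun p hp => hp.2) (fun p hp => ⟨_, mem_ballComponent hp.1⟩)
  have hsmall (p : u) : ediam (ballComponent E p) ≤ ENNReal.ofReal (6 * R) := by
    refine (ediam_mono ballComponent_subset_closedBall).trans
      ((ediam_closedBall_le_ofReal _).trans (ENNReal.ofReal_le_ofReal ?_))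
    linarith [(hu p.2).2]
  have hfin (w : Finset u) : ∑ p ∈ w, ediam (ballComponent E p) ≤ Ldelta E δ :=
    sum_ediam_le_Ldelta w (fun p : u => ballComponent E p) (fun _ _ => ballComponent_subset)
      (fun p _ => isCompact_ballComponent (hu p.2).1)
      (fun p _ => isConnected_ballComponent (hu p.2).1)
      (fun p _ => (hsmall p).trans hRδ)
      (fun p _ q _ hpq => hdisj p.2 q.2 (Subtype.coe_injective.ne hpq))
  have htsum : ∑' p : u, ediam (ballComponent E p) ≠ ∞ := by
    rw [ENNReal.tsum_eq_iSup_sum]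
    exact ((iSup_le hfin).trans_lt hL.lt_top).ne
  have hcount : u.Countable := by
    have h := Summable.countable_support_ennreal htsum
    have huniv : (Function.support fun p : u => ediam (ballComponent E p)) = univ :=
      eq_univ_of_forall fun p => ((ENNReal.ofReal_pos.2 (hu p.2).1.2.1).trans_le
        (ofReal_le_ediam_ballComponent (hu p.2).1)).ne'
    rw [huniv, countable_univ_iff] at h
    exact countable_coe_iff.1 h
  have hε6 : 0 < ε / 6 := ENNReal.div_pos hε.ne' (by norm_num)
  obtain ⟨w, hw⟩ := ((tendsto_order.1 (tendsto_tsum_compl_atTop_zero htsum)).2 _ hε6).exists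
  let t : u → Set X := fun p =>
    if p ∈ w then ballComponent E p else closedBall p.1.1 (3 * p.1.2)
  refine ⟨u, hcount, t, ?_, fun p => ?_, ?_⟩
  · rintro x ⟨hxE, hxC⟩
    by_cases hxw : x ∈ ⋃ p ∈ w, ballComponent E p
    · obtain ⟨p, hp, hxp⟩ := mem_iUnion₂.1 hxw
      exact mem_iUnion.2 ⟨p, by simpa only [t, if_pos hp] using hxp⟩
    have hclosed : IsClosed (⋃ p ∈ w, ballComponent E p) :=
      isClosed_biUnion_finset fun p _ => (isCompact_ballComponent (hu p.2).1).isClosed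
    obtain ⟨r₁, hr₁, hball⟩ :=
      nhds_basis_closedBall.mem_iff.1 (hclosed.isOpen_compl.mem_nhds hxw)
    obtain ⟨r₀, hr₀, hbump⟩ := exists_forall_mem_bumpingBalls hxE hxC
    set r := min (min r₀ r₁) R
    have hrpos : 0 < r := lt_min (lt_min hr₀ hr₁) hR
    obtain ⟨q, hq, ⟨z, hzx, hzq⟩, hrq⟩ := hVit (x, r)
      ⟨hbump r hrpos ((min_le_left _ _).trans (min_le_left _ _)), min_le_right _ _⟩
    have hzr := ballComponent_subset_closedBall hzx
    have hqw : (⟨q, hq⟩ : u) ∉ w := fun h =>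
      hball (closedBall_subset_closedBall ((min_le_left _ _).trans (min_le_right _ _)) hzr)
        (mem_iUnion₂.2 ⟨_, h, hzq⟩)
    refine mem_iUnion.2 ⟨⟨q, hq⟩, ?_⟩
    simp only [t, if_neg hqw, mem_closedBall]
    have hzq' := mem_closedBall.1 (ballComponent_subset_closedBall hzq)
    have hzr' := mem_closedBall'.1 hzr
    dsimp only at hzr' hrq
    linarith [dist_triangle x z q.1]
  · by_cases hp : p ∈ w
    · simpa only [t, if_pos hp] using (hsmall p).trans hRε
    · simp only [t, if_neg hp]
      refine (ediam_closedBall_le_ofReal _).trans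
        ((ENNReal.ofReal_le_ofReal ?_).trans hRε)
      linarith [(hu p.2).2]
  · have hlarge (p : {p : u // p ∉ w}) : ediam (t p) ≤ 6 * ediam (ballComponent E p) := by
      simp only [t, if_neg p.2]
      calc _ ≤ ENNReal.ofReal (2 * (3 * p.1.1.2)) := ediam_closedBall_le_ofReal _
        _ = 6 * ENNReal.ofReal p.1.1.2 := by
          rw [← mul_assoc, ENNReal.ofReal_mul (by norm_num)]
          norm_num
        _ ≤ _ := by
          gcongr
          exact ofReal_le_ediam_ballComponent (hu p.1.2).1
    have hsplit : ∑' p, ediam (t p) =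
        ∑ p ∈ w, ediam (t p) + ∑' p : {p : u // p ∉ w}, ediam (t p) :=
      (ENNReal.sum_add_tsum_compl w fun p => ediam (t p)).symm
    refine hsplit.trans_le (add_le_add ?_ ?_)
    · refine (Finset.sum_congr rfl fun p hp => ?_).trans_le (hfin w)
      simp only [t, if_pos hp]
    · calc ∑' p : {p : u // p ∉ w}, ediam (t p)
          ≤ ∑' p : {p : u // p ∉ w}, 6 * ediam (ballComponent E p) :=
            ENNReal.tsum_le_tsum hlarge
        _ ≤ 6 * (ε / 6) := by
            rw [ENNReal.tsum_mul_left]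
            exact mul_le_mul_right hw.le 6
        _ = ε := ENNReal.mul_div_cancel (by norm_num) (by norm_num)

theorem hausdorffMeasure_le_Ldelta [MeasurableSpace X] [BorelSpace X] [LocallyCompactSpace E]
    (hcount : {C : Set X | ∃ x ∈ E, C = connectedComponentIn E x}.Countable)
    {δ : ℝ≥0∞} (hδ : 0 < δ) : μH[1] E ≤ Ldelta E δ := by
  by_cases hL : Ldelta E δ = ∞
  · simp [hL]
  have htriv : {x ∈ E | connectedComponentIn E x = {x}}.Countable :=
    (hcount.preimage (singleton_injective (α := X))).mono fun x hx =>
      show ({x} : Set X) ∈ {C | ∃ x ∈ E, C = connectedComponentIn E x} from ⟨x, hx.1, hx.2.symm⟩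
  have hnull : μH[1] {x ∈ E | connectedComponentIn E x = {x}} = 0 :=
    have := Measure.nullSingletonClass_hausdorff X one_pos
    htriv.measure_zero _
  have hmain : μH[1] {x ∈ E | connectedComponentIn E x ≠ {x}} ≤ Ldelta E δ := by
    have hε : Tendsto (fun n : ℕ => ((n : ℝ≥0∞) + 1)⁻¹) atTop (𝓝 0) := by
      have := (tendsto_add_atTop_iff_nat 1).2 ENNReal.tendsto_inv_nat_nhds_zero
      simpa using this
    choose u hu t hcov hdiam hsum using fun n : ℕ =>
      exists_countable_cover_tsum_ediam_le (E := E) (ε := ((n : ℝ≥0∞) + 1)⁻¹) hδ hL (by simp)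
    have (n : ℕ) : Countable (u n) := (hu n).to_subtype
    calc _ ≤ liminf (fun n => ∑' p, ediam (t n p) ^ (1 : ℝ)) atTop :=
          Measure.hausdorffMeasure_le_liminf_tsum 1 _ _ hε t (.of_forall hdiam) (.of_forall hcov)
      _ ≤ liminf (fun n : ℕ => Ldelta E δ + ((n : ℝ≥0∞) + 1)⁻¹) atTop :=
          liminf_le_liminf (.of_forall fun n => by simpa using hsum n)
      _ = Ldelta E δ := by simpa using (tendsto_const_nhds.add hε).liminf_eq
  calc μH[1] E ≤ μH[1] ({x ∈ E | connectedComponentIn E x = {x}} ∪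
          {x ∈ E | connectedComponentIn E x ≠ {x}}) :=
        measure_mono fun x hx => (em _).imp (⟨hx, ·⟩) (⟨hx, ·⟩)
    _ ≤ _ := measure_union_le _ _
    _ ≤ Ldelta E δ := by rwa [hnull, zero_add]

end bumpingBalls

theorem stmt5 {X : Type*} [MetricSpace X] [MeasurableSpace X] [BorelSpace X]
    (E : Set X) (hloc : LocallyCompactSpace E)
    (hcount : {C : Set X | ∃ x ∈ E, C = connectedComponentIn E x}.Countable)
    (δ : ℝ≥0∞) (hδ : 0 < δ) :
    μH[1] E = Ldelta E δ :=
  le_antisymm (hausdorffMeasure_le_Ldelta hcount hδ) (Ldelta_le_hausdorffMeasure E δ)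
end

section
/- For every positive integer m, the function K ↦ H^1(K) is lower semicontinuous on the class of nonempty compact subsets of a metric space X with at most m connected components, endowed with the Hausdorff distance. In particular, if continua K_n converge to a continuum K in the Hausdorff distance, then liminf H^1(K_n) ≥ H^1(K). -/
open MeasureTheory ENNReal Filter

section

open Set Topology

/-- Boundary bumping: a component of `K ∩ F` contained in the interior of `F` is a component
of `K`. -/
theorem connectedComponentIn_inter_eq_of_subset_interior {X : Type*} [TopologicalSpace X]
    [T2Space X] {K F : Set X} (hK : IsCompact K) (hF : IsClosed F) {x : X} (hx : x ∈ K ∩ F)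
    (h : connectedComponentIn (K ∩ F) x ⊆ interior F) :
    connectedComponentIn (K ∩ F) x = connectedComponentIn K x := by
  have hA : IsCompact (K ∩ F) := hK.inter_right hF
  have : CompactSpace ↥(K ∩ F) := isCompact_iff_compactSpace.mp hA
  refine (connectedComponentIn_mono x inter_subset_left).antisymm ?_
  obtain ⟨V, hVclopen, hxV, hVF⟩ : ∃ V : Set ↥(K ∩ F), IsClopen V ∧ ⟨x, hx⟩ ∈ V ∧
      V ⊆ Subtype.val ⁻¹' interior F := by
    have : Nonempty { s : Set ↥(K ∩ F) // IsClopen s ∧ ⟨x, hx⟩ ∈ s } :=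
      ⟨⟨univ, isClopen_univ, mem_univ _⟩⟩
    obtain ⟨s, hs⟩ := exists_subset_nhds_of_compactSpace
      (V := fun s : { s : Set ↥(K ∩ F) // IsClopen s ∧ ⟨x, hx⟩ ∈ s } ↦ (s : Set ↥(K ∩ F)))
      (fun s t ↦ ⟨⟨s ∩ t, s.2.1.inter t.2.1, s.2.2, t.2.2⟩, inter_subset_left,
        inter_subset_right⟩) (fun s ↦ s.2.1.isClosed) (U := Subtype.val ⁻¹' interior F)
      (fun y hy ↦ by
        rw [← connectedComponent_eq_iInter_isClopen] at hy
        refine (isOpen_interior.preimage continuous_subtype_val).mem_nhds (h ?_)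
        rw [connectedComponentIn_eq_image hx]
        exact mem_image_of_mem _ hy)
    exact ⟨s, s.2.1, s.2.2, hs⟩
  obtain ⟨O, hO, rfl⟩ := isOpen_induced_iff.mp hVclopen.isOpen
  have hclosed : IsClosed (K ∩ F ∩ O) := by
    have := (hVclopen.isClosed.isCompact.image continuous_subtype_val).isClosed
    rwa [Subtype.image_preimage_coe] at this
  have hsub : K ∩ F ∩ O ⊆ interior F := fun y hy ↦ @hVF ⟨y, hy.1⟩ hy.2
  refine isPreconnected_connectedComponentIn.subset_connectedComponentIn
    (mem_connectedComponentIn hx.1) fun y hy ↦ ?_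
  have hyK := connectedComponentIn_subset _ _ hy
  refine ⟨hyK, ?_⟩
  by_contra hyF
  obtain ⟨z, hzP, hz1, hz2⟩ := isPreconnected_connectedComponentIn (F := K) (x := x)
    (O ∩ interior F) (K ∩ F ∩ O)ᶜ (hO.inter isOpen_interior) hclosed.isOpen_compl
    (fun z hz ↦ by
      by_cases hzV : z ∈ K ∩ F ∩ O
      · exact Or.inl ⟨hzV.2, hsub hzV⟩
      · exact Or.inr hzV)
    ⟨x, mem_connectedComponentIn hx.1, hxV, hsub ⟨hx, hxV⟩⟩
    ⟨y, hy, fun hyV ↦ hyF hyV.1.2⟩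
  exact hz2 ⟨⟨connectedComponentIn_subset _ _ hzP, interior_subset hz1.2⟩, hz1.1⟩

theorem isCompact_connectedComponentIn {X : Type*} [TopologicalSpace X] {K : Set X}
    (hK : IsCompact K) (x : X) : IsCompact (connectedComponentIn K x) := by
  by_cases hx : x ∈ K
  · have : CompactSpace ↥K := isCompact_iff_compactSpace.mp hK
    rw [connectedComponentIn_eq_image hx]
    exact isClosed_connectedComponent.isCompact.image continuous_subtype_val
  · simp [connectedComponentIn_eq_empty hx]

theorem IsPreconnected.edist_le_volume_image_dist {X : Type*} [PseudoMetricSpace X] {E : Set X}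
    (hE : IsPreconnected E) {a b : X} (ha : a ∈ E) (hb : b ∈ E) :
    edist a b ≤ volume (dist a '' E) := by
  have hcont : Continuous (dist a) := by fun_prop
  have hsub : Icc 0 (dist a b) ⊆ dist a '' E :=
    (hE.image _ hcont.continuousOn).Icc_subset ⟨a, ha, dist_self a⟩ ⟨b, hb, rfl⟩
  calc edist a b = volume (Icc 0 (dist a b)) := by simp [edist_dist]
    _ ≤ _ := measure_mono hsub

theorem IsPreconnected.ediam_le_hausdorffMeasure {X : Type*} [MetricSpace X] [MeasurableSpace X]
    [BorelSpace X] {E : Set X} (hE : IsPreconnected E) : Metric.ediam E ≤ μH[1] E := by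
  refine Metric.ediam_le fun a ha b hb ↦ (hE.edist_le_volume_image_dist ha hb).trans ?_
  have := (LipschitzWith.dist_right a).hausdorffMeasure_image_le zero_le_one E
  simpa [hausdorffMeasure_real] using this

theorem IsPreconnected.ediam_le_tsum {X : Type*} [PseudoMetricSpace X] {ι : Type*} [Countable ι]
    {E : Set X} (hE : IsPreconnected E) {V : ι → Set X} (hV : E ⊆ ⋃ i, V i) :
    Metric.ediam E ≤ ∑' i, Metric.ediam (V i) := by
  refine Metric.ediam_le fun a ha b hb ↦ (hE.edist_le_volume_image_dist ha hb).trans ?_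
  calc volume (dist a '' E) ≤ volume (⋃ i, dist a '' V i) := by
        rw [← image_iUnion]; exact measure_mono (image_mono hV)
    _ ≤ ∑' i, volume (dist a '' V i) := measure_iUnion_le _
    _ ≤ ∑' i, Metric.ediam (V i) := by
        refine ENNReal.tsum_le_tsum fun i ↦ (Real.volume_le_diam _).trans ?_
        simpa using (LipschitzWith.dist_right a).ediam_image_le (V i)

theorem eq_of_not_disjoint_connectedComponentIn {X : Type*} [TopologicalSpace X] {A : Set X}
    {x y : X} (h : ¬Disjoint (connectedComponentIn A x) (connectedComponentIn A y)) :
    connectedComponentIn A x = connectedComponentIn A y := by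
  obtain ⟨z, hzx, hzy⟩ := not_disjoint_iff.mp h
  rw [connectedComponentIn_eq hzx, connectedComponentIn_eq hzy]

open scoped NNReal in
/-- A lower bound for the length, near a connected set `E`, of a compact set with finitely many
components which approximates `E`. -/
theorem ediam_le_hausdorffMeasure_inter_cthickening {X : Type*} [MetricSpace X]
    [MeasurableSpace X] [BorelSpace X] {K E : Set X} (hE : IsPreconnected E) (hK : IsCompact K)
    (hfin : μH[1] K ≠ ∞) {I : Finset (Set X)} (hI : ∀ x ∈ K, connectedComponentIn K x ∈ I)
    {δ η : ℝ≥0} (hη : 0 < η) (hηδ : 2 * η ≤ δ) (hEK : ∀ x ∈ E, ∃ y ∈ K, edist x y < η) :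
    Metric.ediam E ≤ (1 + 4 * (η / δ) : ℝ≥0) * μH[1] (K ∩ Metric.cthickening δ E)
      + I.card * (2 * η) := by
  have hδ : 0 < δ := lt_of_lt_of_le (by positivity) hηδ
  set F := Metric.cthickening (δ : ℝ) E with hF
  have hFc : IsClosed F := Metric.isClosed_cthickening
  have hηδ' : η ≤ δ := le_trans (le_mul_of_one_le_left zero_le one_le_two) hηδ
  set 𝒞 : Set (Set X) := {C | ∃ x ∈ K, Metric.infEDist x E < η ∧
    C = connectedComponentIn (K ∩ F) x}
  have hxF : ∀ x, Metric.infEDist x E < η → x ∈ F := fun x hx ↦ by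
    rw [hF, Metric.mem_cthickening_iff, ENNReal.ofReal_coe_nnreal]
    exact hx.le.trans (by exact_mod_cast hηδ')
  have hcomp : ∀ C ∈ 𝒞, IsCompact C := by
    rintro _ ⟨x, -, -, rfl⟩
    exact isCompact_connectedComponentIn (hK.inter_right hFc) x
  have hconn : ∀ C ∈ 𝒞, IsPreconnected C := by
    rintro _ ⟨x, -, -, rfl⟩
    exact isPreconnected_connectedComponentIn
  have hsub : ∀ C ∈ 𝒞, C ⊆ K ∩ F := by
    rintro _ ⟨x, -, -, rfl⟩
    exact connectedComponentIn_subset _ _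
  have hdisj : Pairwise (Function.onFun Disjoint fun C : 𝒞 ↦ (C : Set X)) := by
    rintro ⟨C, hC⟩ ⟨D, hD⟩ hne
    obtain ⟨x, -, -, hx⟩ := id hC
    obtain ⟨y, -, -, hy⟩ := id hD
    refine not_not.mp fun h ↦ hne (Subtype.ext ?_)
    change ¬Disjoint C D at h
    change C = D
    rw [hx, hy] at h ⊢
    exact eq_of_not_disjoint_connectedComponentIn h
  have hlarge : ∀ C ∈ 𝒞, C ∉ I → ((δ / 2 : ℝ≥0) : ℝ≥0∞) ≤ Metric.ediam C := by
    rintro _ ⟨x, hxK, hxE, rfl⟩ hCI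
    have hx : x ∈ K ∩ F := ⟨hxK, hxF x hxE⟩
    have hnot : ¬ connectedComponentIn (K ∩ F) x ⊆ Metric.thickening δ E := fun h ↦ hCI <| by
      rw [connectedComponentIn_inter_eq_of_subset_interior hK hFc hx
        (h.trans (Metric.thickening_subset_interior_cthickening _ _))]
      exact hI x hxK
    obtain ⟨y, hyC, hy⟩ := not_subset.mp hnot
    rw [Metric.mem_thickening_iff_infEDist_lt, not_lt, ENNReal.ofReal_coe_nnreal] at hy
    have h1 : ((δ / 2 : ℝ≥0) : ℝ≥0∞) + η ≤ edist y x + η := by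
      calc ((δ / 2 : ℝ≥0) : ℝ≥0∞) + η ≤ δ := by
            norm_cast
            rw [← NNReal.coe_le_coe] at hηδ ⊢
            push_cast at hηδ ⊢
            linarith
        _ ≤ Metric.infEDist y E := hy
        _ ≤ Metric.infEDist x E + edist y x := Metric.infEDist_le_infEDist_add_edist
        _ ≤ η + edist y x := by gcongr
        _ = _ := add_comm _ _
    exact ((ENNReal.add_le_add_iff_right coe_ne_top).mp h1).trans
      (Metric.edist_le_ediam_of_mem hyC (mem_connectedComponentIn hx))
  have : Countable 𝒞 := by
    have : Fact (μH[1] K < ∞) := ⟨hfin.lt_top⟩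
    have hpos := Measure.countable_meas_pos_of_disjoint_iUnion (μ := (μH[1]).restrict K)
      (fun C : 𝒞 ↦ (hcomp C C.2).isClosed.measurableSet) hdisj
    refine Set.Countable.to_subtype (((hpos.image Subtype.val).union
      I.finite_toSet.countable).mono fun C hC ↦ ?_)
    by_cases hCI : C ∈ I
    · exact Or.inr hCI
    · refine Or.inl ⟨⟨C, hC⟩, ?_, rfl⟩
      rw [mem_ofPred_eq, Measure.restrict_eq_self _ ((hsub C hC).trans inter_subset_left)]
      refine lt_of_lt_of_le ?_ ((hlarge C hC hCI).trans (hconn C hC).ediam_le_hausdorffMeasure)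
      exact_mod_cast half_pos hδ
  have hcover : E ⊆ ⋃ C : 𝒞, Metric.thickening η (C : Set X) := fun x hx ↦ by
    obtain ⟨y, hyK, hxy⟩ := hEK x hx
    have hyE : Metric.infEDist y E < η :=
      (Metric.infEDist_le_edist_of_mem hx).trans_lt (by rwa [edist_comm])
    refine mem_iUnion.mpr ⟨⟨_, y, hyK, hyE, rfl⟩, ?_⟩
    rw [Metric.mem_thickening_iff_exists_edist_lt, ENNReal.ofReal_coe_nnreal]
    exact ⟨y, mem_connectedComponentIn ⟨hyK, hxF y hyE⟩, hxy⟩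
  have hpiece : ∀ C : 𝒞, Metric.ediam (Metric.thickening η (C : Set X)) ≤
      (1 + 4 * (η / δ) : ℝ≥0) * μH[1] (C : Set X) +
        (I : Set (Set X)).indicator (fun _ ↦ 2 * (η : ℝ≥0∞)) C := by
    rintro ⟨C, hC⟩
    have hle := (hconn C hC).ediam_le_hausdorffMeasure
    refine (Metric.ediam_thickening_le η).trans ?_
    by_cases hCI : C ∈ I
    · rw [indicator_of_mem (by simpa using hCI)]
      gcongr
      refine hle.trans (le_mul_of_one_le_left zero_le ?_)
      exact_mod_cast le_self_add
    · rw [indicator_of_notMem (by simpa using hCI), add_zero, ENNReal.coe_add, add_mul,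
        ENNReal.coe_one, one_mul]
      refine add_le_add hle ?_
      calc 2 * (η : ℝ≥0∞) = ((4 * (η / δ) * (δ / 2) : ℝ≥0) : ℝ≥0∞) := by
            norm_cast
            field_simp
            norm_num
        _ = (4 * (η / δ) : ℝ≥0) * ((δ / 2 : ℝ≥0) : ℝ≥0∞) := ENNReal.coe_mul _ _
        _ ≤ _ := by gcongr; exact (hlarge C hC hCI).trans hle
  calc Metric.ediam E ≤ ∑' C : 𝒞, Metric.ediam (Metric.thickening η (C : Set X)) :=
        hE.ediam_le_tsum hcover
    _ ≤ ∑' C : 𝒞, ((1 + 4 * (η / δ) : ℝ≥0) * μH[1] (C : Set X) +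
        (I : Set (Set X)).indicator (fun _ ↦ 2 * (η : ℝ≥0∞)) C) := ENNReal.tsum_le_tsum hpiece
    _ = (1 + 4 * (η / δ) : ℝ≥0) * ∑' C : 𝒞, μH[1] (C : Set X) +
        ∑' C : 𝒞, (I : Set (Set X)).indicator (fun _ ↦ 2 * (η : ℝ≥0∞)) C := by
      rw [ENNReal.tsum_add, ENNReal.tsum_mul_left]
    _ ≤ _ := by
      gcongr
      · refine (tsum_meas_le_meas_iUnion_of_disjoint _
          (fun C : 𝒞 ↦ (hcomp C C.2).isClosed.measurableSet) hdisj).trans ?_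
        exact measure_mono (iUnion_subset fun C ↦ hsub C C.2)
      · calc ∑' C : 𝒞, (I : Set (Set X)).indicator (fun _ ↦ 2 * (η : ℝ≥0∞)) C
            ≤ ∑' C, (I : Set (Set X)).indicator (fun _ ↦ 2 * (η : ℝ≥0∞)) C :=
              ENNReal.tsum_comp_le_tsum_of_injective Subtype.val_injective _
          _ = I.card * (2 * η) := by
            rw [← tsum_subtype, Finset.tsum_subtype' I (fun _ ↦ 2 * (η : ℝ≥0∞))]
            simp

open scoped NNReal in
/-- Liminf of lengths dominates the sum of the diameters of disjoint subcontinua of the limit. -/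
theorem sum_ediam_le_liminf_hausdorffMeasure {X : Type*} [MetricSpace X]
    [MeasurableSpace X] [BorelSpace X] {m : ℕ} {K : ℕ → Set X} {K₀ : Set X}
    (hKc : ∀ n, IsCompact (K n))
    (hKcomp : ∀ n, ∃ I : Finset (Set X), I.card ≤ m ∧
      ∀ x ∈ K n, connectedComponentIn (K n) x ∈ I)
    (hconv : Tendsto (fun n => Metric.hausdorffEDist (K n) K₀) atTop (𝓝 0))
    {𝒢 : Finset (Set X)} (hdisj : (𝒢 : Set (Set X)).PairwiseDisjoint id)
    (hcomp : ∀ E ∈ 𝒢, IsCompact E) (hconn : ∀ E ∈ 𝒢, IsPreconnected E)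
    (hsub : ∀ E ∈ 𝒢, E ⊆ K₀) :
    ∑ E ∈ 𝒢, Metric.ediam E ≤ liminf (fun n => μH[1] (K n)) atTop := by
  obtain ⟨δ, hδ, hthick⟩ : ∃ δ : ℝ≥0, 0 < δ ∧
      (𝒢 : Set (Set X)).PairwiseDisjoint (Metric.cthickening (δ : ℝ)) := by
    have : ∀ E ∈ 𝒢, ∀ E' ∈ 𝒢, ∀ᶠ δ : ℝ in 𝓝[>] 0, E ≠ E' →
        Disjoint (Metric.cthickening δ E) (Metric.cthickening δ E') := fun E hE E' hE' ↦ by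
      by_cases hne : E = E'
      · simp [hne]
      obtain ⟨δ, hδ, h⟩ := (hdisj hE hE' hne).exists_cthickenings (hcomp E hE)
        (hcomp E' hE').isClosed
      filter_upwards [Ioo_mem_nhdsGT hδ] with r hr _
      exact h.mono (Metric.cthickening_mono hr.2.le _) (Metric.cthickening_mono hr.2.le _)
    simp_rw [← Finset.eventually_all] at this
    obtain ⟨δ, hδ', hδ⟩ := (this.and self_mem_nhdsWithin).exists
    exact ⟨⟨δ, (mem_Ioi.mp hδ).le⟩, hδ, fun E hE E' hE' hne ↦ hδ' E hE E' hE' hne⟩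
  have key : ∀ η : ℝ≥0, 0 < η → 2 * η ≤ δ → ∀ᶠ n in atTop, ∑ E ∈ 𝒢, Metric.ediam E ≤
      (1 + 4 * (η / δ) : ℝ≥0) * μH[1] (K n) + 𝒢.card * (m * (2 * η)) := by
    intro η hη hηδ
    filter_upwards [hconv.eventually_lt_const (ENNReal.coe_pos.mpr hη)] with n hn
    by_cases hfin : μH[1] (K n) = ∞
    · rw [hfin, ENNReal.mul_top (by simp)]
      simp
    obtain ⟨I, hIm, hI⟩ := hKcomp n
    calc ∑ E ∈ 𝒢, Metric.ediam E
        ≤ ∑ E ∈ 𝒢, ((1 + 4 * (η / δ) : ℝ≥0) * μH[1] (K n ∩ Metric.cthickening δ E)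
          + m * (2 * η)) := by
          refine Finset.sum_le_sum fun E hE ↦ ?_
          refine (ediam_le_hausdorffMeasure_inter_cthickening (hconn E hE) (hKc n) hfin hI hη hηδ
            fun x hx ↦ Metric.exists_edist_lt_of_hausdorffEDist_lt (hsub E hE hx)
              (by rwa [Metric.hausdorffEDist_comm])).trans ?_
          gcongr
      _ = (1 + 4 * (η / δ) : ℝ≥0) * μH[1] (⋃ E ∈ 𝒢, K n ∩ Metric.cthickening δ E)
          + 𝒢.card * (m * (2 * η)) := by
          rw [Finset.sum_add_distrib, ← Finset.mul_sum, measure_biUnion_finset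
            (hthick.mono_on fun E _ ↦ inter_subset_right)
            fun E _ ↦ ((hKc n).inter_right Metric.isClosed_cthickening).isClosed.measurableSet]
          simp
      _ ≤ _ := by
          gcongr
          exact iUnion₂_subset fun E _ ↦ inter_subset_left
  refine le_of_forall_gt_imp_ge_of_dense fun L hL ↦ ?_
  rcases eq_or_ne L ∞ with rfl | hLtop
  · exact le_top
  have hlim : Tendsto (fun η : ℝ≥0 ↦ (1 + 4 * (η / δ) : ℝ≥0) * L + 𝒢.card * (m * (2 * η)))
      (𝓝[>] 0) (𝓝 L) := by
    have h1 : Tendsto (fun η : ℝ≥0 ↦ ((1 + 4 * (η / δ) : ℝ≥0) : ℝ≥0∞)) (𝓝 0) (𝓝 1) := by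
      refine ENNReal.tendsto_coe.mpr (Continuous.tendsto' ?_ _ _ (by simp))
      fun_prop
    have h2 : Tendsto (fun η : ℝ≥0 ↦ ((𝒢.card * (m * (2 * η)) : ℝ≥0) : ℝ≥0∞)) (𝓝 0) (𝓝 0) := by
      refine ENNReal.tendsto_coe.mpr (Continuous.tendsto' ?_ _ _ (by simp))
      fun_prop
    have h3 := (ENNReal.Tendsto.mul_const (b := L) h1 (Or.inr hLtop)).add h2
    rw [one_mul, add_zero] at h3
    refine (h3.mono_left nhdsWithin_le_nhds).congr fun η ↦ ?_
    push_cast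
    rfl
  refine ge_of_tendsto hlim ?_
  filter_upwards [Ioo_mem_nhdsGT (half_pos hδ)] with η hη
  have hηδ : 2 * η ≤ δ := by
    have := hη.2.le
    rw [le_div_iff₀ two_pos] at this
    rwa [mul_comm]
  obtain ⟨n, hn, hnL⟩ := ((frequently_lt_of_liminf_lt (by isBoundedDefault) hL).and_eventually
    (key η hη.1 hηδ)).exists
  refine hnL.trans ?_
  gcongr

/-- In a compact set `K`, the component of `K ∩ closedBall x r` at `x` has diameter at least `r`, as
soon as the component of `x` in `K` leaves the ball. -/
theorem le_ediam_connectedComponentIn_inter_closedBall {X : Type*} [MetricSpace X] {K : Set X}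
    (hK : IsCompact K) {x y : X} (hx : x ∈ K) (hy : y ∈ connectedComponentIn K x) {r : ℝ}
    (hr : 0 ≤ r) (hxy : r < dist y x) :
    ENNReal.ofReal r ≤ Metric.ediam (connectedComponentIn (K ∩ Metric.closedBall x r) x) := by
  have hx' : x ∈ K ∩ Metric.closedBall x r := ⟨hx, Metric.mem_closedBall_self hr⟩
  have hnot : ¬ connectedComponentIn (K ∩ Metric.closedBall x r) x ⊆ Metric.ball x r := fun h ↦ by
    have := connectedComponentIn_inter_eq_of_subset_interior hK Metric.isClosed_closedBall hx'
      (h.trans Metric.ball_subset_interior_closedBall)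
    rw [← this] at hy
    exact (connectedComponentIn_subset _ _ hy).2.not_gt hxy
  obtain ⟨z, hz, hzr⟩ := not_subset.mp hnot
  rw [Metric.mem_ball, not_lt] at hzr
  refine le_trans ?_ (Metric.edist_le_ediam_of_mem hz (mem_connectedComponentIn hx'))
  rw [edist_dist]
  exact ENNReal.ofReal_le_ofReal hzr

theorem ediam_closedBall_le_ofReal_s10 {X : Type*} [PseudoMetricSpace X] (x : X) {r : ℝ}
    (hr : 0 ≤ r) : Metric.ediam (Metric.closedBall x r) ≤ ENNReal.ofReal (2 * r) := by
  rw [← Metric.closedEBall_ofReal hr, ENNReal.ofReal_mul zero_le_two, ENNReal.ofReal_ofNat]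
  exact Metric.ediam_closedEBall_le

/-- If the sums of diameters of disjoint subcontinua of `K` are bounded by `L`, then the nontrivial
components of `K` have fine covers whose sum of diameters is almost at most `L`. -/
theorem exists_countable_cover_of_sum_ediam_le {X : Type*} [MetricSpace X] {K : Set X}
    (hK : IsCompact K) {L : ℝ≥0∞} (hL : L ≠ ∞)
    (hsum : ∀ 𝒢 : Finset (Set X), (𝒢 : Set (Set X)).PairwiseDisjoint id →
      (∀ E ∈ 𝒢, IsCompact E ∧ IsPreconnected E ∧ E ⊆ K) → ∑ E ∈ 𝒢, Metric.ediam E ≤ L)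
    {δ : ℝ} (hδ : 0 < δ) :
    ∃ 𝒱 : Set (Set X), 𝒱.Countable ∧ (∀ V ∈ 𝒱, Metric.ediam V ≤ ENNReal.ofReal δ) ∧
      {x ∈ K | ¬(connectedComponentIn K x).Subsingleton} ⊆ ⋃₀ 𝒱 ∧
      ∑' V : 𝒱, Metric.ediam (V : Set X) ≤ L + ENNReal.ofReal δ := by
  set P : Finset (Set X) → Prop := fun 𝒢 ↦ (𝒢 : Set (Set X)).PairwiseDisjoint id ∧
    ∀ E ∈ 𝒢, (IsCompact E ∧ IsPreconnected E ∧ E ⊆ K) ∧ Metric.ediam E ≤ ENNReal.ofReal δ with hP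
  set s : ℝ≥0∞ := ⨆ 𝒢 : {𝒢 // P 𝒢}, ∑ E ∈ 𝒢.1, Metric.ediam E
  have hsL : s ≤ L := iSup_le fun 𝒢 ↦ hsum _ 𝒢.2.1 fun E hE ↦ (𝒢.2.2 E hE).1
  have hle : ∀ 𝒢, P 𝒢 → ∑ E ∈ 𝒢, Metric.ediam E ≤ s := fun 𝒢 h ↦
    le_iSup (fun 𝒢 : {𝒢 // P 𝒢} ↦ ∑ E ∈ 𝒢.1, Metric.ediam E) ⟨𝒢, h⟩
  have hε : ENNReal.ofReal (δ / 10) ≠ 0 := by simpa using hδ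
  obtain ⟨𝒢, h𝒢, hmax⟩ : ∃ 𝒢, P 𝒢 ∧ s ≤ ∑ E ∈ 𝒢, Metric.ediam E + ENNReal.ofReal (δ / 10) := by
    rcases eq_or_ne s 0 with h0 | h0
    · exact ⟨∅, by simp [hP], by simp [h0]⟩
    · obtain ⟨𝒢, h⟩ := lt_iSup_iff.mp (ENNReal.sub_lt_self (ne_top_of_le_ne_top hL hsL) h0 hε)
      exact ⟨𝒢.1, 𝒢.2, tsub_le_iff_right.mp h.le⟩
  have hZ : IsClosed (⋃₀ (𝒢 : Set (Set X))) :=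
    sUnion_eq_biUnion ▸ 𝒢.finite_toSet.isClosed_biUnion fun E hE ↦ (h𝒢.2 E hE).1.1.isClosed
  set t : Set X := {x ∈ K | ¬(connectedComponentIn K x).Subsingleton} \ ⋃₀ (𝒢 : Set (Set X))
  have hrad : ∀ x, ∃ r : ℝ, x ∈ t → 0 < r ∧ r ≤ δ / 10 ∧
      Disjoint (Metric.closedBall x r) (⋃₀ (𝒢 : Set (Set X))) ∧
      ENNReal.ofReal r ≤ Metric.ediam (connectedComponentIn (K ∩ Metric.closedBall x r) x) := by
    intro x
    by_cases hx : x ∈ t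
    swap
    · exact ⟨0, fun h ↦ absurd h hx⟩
    obtain ⟨y, hy, hyx⟩ := (not_subsingleton_iff.mp hx.1.2).exists_ne x
    obtain ⟨ρ, hρ, hball⟩ := Metric.nhds_basis_closedBall.mem_iff.mp
      (hZ.isOpen_compl.mem_nhds hx.2)
    have hd := dist_pos.mpr hyx
    have hr : 0 < min (min ρ (δ / 10)) (dist y x / 2) := by positivity
    refine ⟨_, fun _ ↦ ⟨hr, (min_le_left _ _).trans (min_le_right _ _), ?_,
      le_ediam_connectedComponentIn_inter_closedBall hK hx.1.1 hy hr.le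
        ((min_le_right _ _).trans_lt (half_lt_self hd))⟩⟩
    exact disjoint_left.mpr fun z hz ↦ hball (Metric.closedBall_subset_closedBall
      ((min_le_left _ _).trans (min_le_left _ _)) hz)
  choose r hr using hrad
  set D : X → Set X := fun x ↦ connectedComponentIn (K ∩ Metric.closedBall x (r x)) x
  have hDmem : ∀ x ∈ t, x ∈ D x := fun x hx ↦ mem_connectedComponentIn
    ⟨hx.1.1, Metric.mem_closedBall_self (hr x hx).1.le⟩
  have hDball : ∀ x, D x ⊆ Metric.closedBall x (r x) := fun x ↦
    (connectedComponentIn_subset _ _).trans inter_subset_right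
  obtain ⟨u, hut, hudisj, hucover⟩ :=
    Vitali.exists_disjoint_subfamily_covering_enlargement_closedBall t id r (δ / 10) (fun x hx ↦ (hr x hx).2.1) 5 (by norm_num)
  have hDdisj : u.PairwiseDisjoint D := hudisj.mono fun x ↦ hDball x
  have hDinj : u.InjOn D := fun x hx y hy hxy ↦ by
    by_contra hne
    have := hDdisj hx hy hne
    rw [Function.onFun, ← hxy, disjoint_self] at this
    exact (this ▸ hDmem x (hut hx) : x ∈ (⊥ : Set X))
  have hfin : ∀ w : Finset X, (w : Set X) ⊆ u →
      ∑ x ∈ w, ENNReal.ofReal (r x) ≤ ENNReal.ofReal (δ / 10) := by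
    classical
    intro w hw
    have hsep : ∀ E ∈ 𝒢, ∀ x ∈ w, Disjoint E (D x) := fun E hE x hx ↦
      ((hr x (hut (hw hx))).2.2.1.mono (hDball x) (subset_sUnion_of_mem hE)).symm
    have hdis : Disjoint 𝒢 (w.image D) := by
      refine Finset.disjoint_left.mpr fun E hE hE' ↦ ?_
      obtain ⟨x, hx, rfl⟩ := Finset.mem_image.mp hE'
      have := hsep _ hE x hx
      rw [disjoint_self] at this
      exact (this ▸ hDmem x (hut (hw hx)) : x ∈ (⊥ : Set X))
    have hPw : P (𝒢 ∪ w.image D) := by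
      refine ⟨?_, fun E hE ↦ ?_⟩
      · rw [Finset.coe_union, pairwiseDisjoint_union]
        refine ⟨h𝒢.1, ?_, fun E hE E' hE' _ ↦ ?_⟩
        · rw [Finset.coe_image]
          exact (hDdisj.subset hw).image
        · obtain ⟨x, hx, rfl⟩ := Finset.mem_image.mp hE'
          exact hsep E hE x hx
      · rcases Finset.mem_union.mp hE with hE | hE
        · exact h𝒢.2 E hE
        obtain ⟨x, hx, rfl⟩ := Finset.mem_image.mp hE
        have hrx := hr x (hut (hw hx))
        refine ⟨⟨isCompact_connectedComponentIn (hK.inter_right Metric.isClosed_closedBall) x,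
          isPreconnected_connectedComponentIn,
          (connectedComponentIn_subset _ _).trans inter_subset_left⟩, ?_⟩
        refine (Metric.ediam_mono (hDball x)).trans ((ediam_closedBall_le_ofReal_s10 x hrx.1.le).trans
          (ENNReal.ofReal_le_ofReal ?_))
        linarith [hrx.2.1]
    have h1 := (hle _ hPw).trans hmax
    rw [Finset.sum_union hdis, Finset.sum_image (hDinj.mono hw),
      ENNReal.add_le_add_iff_left] at h1
    · exact (Finset.sum_le_sum fun x hx ↦ (hr x (hut (hw hx))).2.2.2).trans h1
    · exact ne_top_of_le_ne_top hL ((hle _ h𝒢).trans hsL)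
  have htsum : ∑' x : u, ENNReal.ofReal (r x) ≤ ENNReal.ofReal (δ / 10) := by
    rw [ENNReal.tsum_eq_iSup_sum]
    refine iSup_le fun w ↦ ?_
    have := hfin (w.map (Function.Embedding.subtype _)) (by simp)
    simpa using this
  have hucount : u.Countable := by
    have := Summable.countable_support_ennreal (ne_top_of_le_ne_top ofReal_ne_top htsum)
    refine countable_coe_iff.mp (countable_univ_iff.mp (this.mono fun x _ ↦ ?_))
    simpa using (hr x (hut x.2)).1
  have hball : ∀ x ∈ u, Metric.ediam (Metric.closedBall x (5 * r x)) ≤ 10 * ENNReal.ofReal (r x) := by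
    intro x hx
    have hrx := (hr x (hut hx)).1.le
    refine (ediam_closedBall_le_ofReal_s10 x (by positivity)).trans_eq ?_
    rw [← ENNReal.ofReal_ofNat, ← ENNReal.ofReal_mul (by norm_num)]
    ring_nf
  have h10 : 10 * ENNReal.ofReal (δ / 10) = ENNReal.ofReal δ := by
    rw [← ENNReal.ofReal_ofNat, ← ENNReal.ofReal_mul (by norm_num)]
    ring_nf
  refine ⟨𝒢 ∪ (fun x ↦ Metric.closedBall x (5 * r x)) '' u,
    𝒢.finite_toSet.countable.union (hucount.image _), ?_, ?_, ?_⟩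
  · rintro V (hV | ⟨x, hx, rfl⟩)
    · exact (h𝒢.2 V hV).2
    · refine (hball x hx).trans (h10 ▸ ?_)
      gcongr
      exact (hr x (hut hx)).2.1
  · intro x hx
    by_cases hxZ : x ∈ ⋃₀ (𝒢 : Set (Set X))
    · exact sUnion_subset_sUnion subset_union_left hxZ
    · obtain ⟨y, hy, hxy⟩ := hucover x ⟨hx, hxZ⟩
      exact ⟨_, Or.inr ⟨y, hy, rfl⟩, hxy (Metric.mem_closedBall_self (hr x ⟨hx, hxZ⟩).1.le)⟩
  · refine (ENNReal.tsum_union_le _ _ _).trans (add_le_add ?_ ?_)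
    · rw [Finset.tsum_subtype' 𝒢 (fun V ↦ Metric.ediam V)]
      exact (hle _ h𝒢).trans hsL
    · calc _ ≤ ∑' x : u, Metric.ediam (Metric.closedBall (x : X) (5 * r x)) :=
            ENNReal.tsum_le_tsum_comp_of_surjective (imageFactorization_surjective (f := fun x ↦ Metric.closedBall x (5 * r x)) (s := u))
              (fun V ↦ Metric.ediam (V : Set X))
        _ ≤ ∑' x : u, 10 * ENNReal.ofReal (r x) := ENNReal.tsum_le_tsum fun x ↦ hball x x.2
        _ ≤ 10 * ENNReal.ofReal (δ / 10) := by rw [ENNReal.tsum_mul_left]; gcongr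
        _ = _ := h10

/-- The length of a compact set with finitely many components is at most the supremum of the sums
of diameters of its finite families of disjoint subcontinua. -/
theorem hausdorffMeasure_le_of_sum_ediam_le {X : Type*} [MetricSpace X] [MeasurableSpace X]
    [BorelSpace X] {K : Set X} (hK : IsCompact K) {I : Finset (Set X)}
    (hI : ∀ x ∈ K, connectedComponentIn K x ∈ I) {L : ℝ≥0∞}
    (hsum : ∀ 𝒢 : Finset (Set X), (𝒢 : Set (Set X)).PairwiseDisjoint id →
      (∀ E ∈ 𝒢, IsCompact E ∧ IsPreconnected E ∧ E ⊆ K) → ∑ E ∈ 𝒢, Metric.ediam E ≤ L) :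
    μH[1] K ≤ L := by
  rcases eq_or_ne L ∞ with rfl | hL
  · exact le_top
  have hpoints : {x ∈ K | (connectedComponentIn K x).Subsingleton}.Finite := by
    refine Set.Finite.of_finite_image (f := connectedComponentIn K)
      (I.finite_toSet.subset (image_subset_iff.mpr fun x hx ↦ hI x hx.1)) fun x hx y hy hxy ↦ ?_
    exact hx.2 (mem_connectedComponentIn hx.1) (hxy ▸ mem_connectedComponentIn hy.1)
  have hnontrivial : μH[1] {x ∈ K | ¬(connectedComponentIn K x).Subsingleton} ≤ L := by
    set δ : ℕ → ℝ := fun n ↦ 1 / ((n : ℝ) + 1)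
    choose 𝒱 hcount hdiam hcover htsum using fun n ↦
      exists_countable_cover_of_sum_ediam_le hK hL hsum (δ := δ n) Nat.one_div_pos_of_nat
    have hδ : Tendsto (fun n ↦ ENNReal.ofReal (δ n)) atTop (𝓝 0) := by
      simpa only [ENNReal.ofReal_zero] using ENNReal.tendsto_ofReal
        (tendsto_one_div_add_atTop_nhds_zero_nat (𝕜 := ℝ))
    have (n : ℕ) : Countable (𝒱 n) := (hcount n).to_subtype
    refine (Measure.hausdorffMeasure_le_liminf_tsum 1 _ _ hδ (fun n (V : 𝒱 n) ↦ (V : Set X))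
      (.of_forall fun n V ↦ hdiam n V V.2)
      (.of_forall fun n ↦ sUnion_eq_iUnion ▸ hcover n)).trans ?_
    have hlim : Tendsto (fun n ↦ L + ENNReal.ofReal (δ n)) atTop (𝓝 L) := by
      simpa using hδ.const_add L
    rw [← hlim.liminf_eq]
    refine liminf_le_liminf (.of_forall fun n ↦ ?_)
    simpa using htsum n
  have := Measure.nullSingletonClass_hausdorff X one_pos
  calc μH[1] K ≤ μH[1] {x ∈ K | (connectedComponentIn K x).Subsingleton}
        + μH[1] {x ∈ K | ¬(connectedComponentIn K x).Subsingleton} := by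
        refine (measure_mono fun x hx ↦ ?_).trans (measure_union_le _ _)
        exact (em _).imp (⟨hx, ·⟩) (⟨hx, ·⟩)
    _ ≤ L := by rwa [hpoints.measure_zero, zero_add]

end

theorem stmt10 {X : Type*} [MetricSpace X] [MeasurableSpace X] [BorelSpace X]
    (m : ℕ) (hm : 0 < m) (K : ℕ → Set X) (K₀ : Set X)
    (hKc : ∀ n, IsCompact (K n)) (hKne : ∀ n, (K n).Nonempty)
    (hKcomp : ∀ n, ∃ I : Finset (Set X), I.card ≤ m ∧
      ∀ x ∈ K n, connectedComponentIn (K n) x ∈ I)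
    (hK₀c : IsCompact K₀) (hK₀ne : K₀.Nonempty)
    (hK₀comp : ∃ I : Finset (Set X), I.card ≤ m ∧
      ∀ x ∈ K₀, connectedComponentIn K₀ x ∈ I)
    (hconv : Tendsto (fun n => EMetric.hausdorffEdist (K n) K₀) atTop (nhds 0)) :
    μH[1] K₀ ≤ liminf (fun n => μH[1] (K n)) atTop := by
  obtain ⟨I, -, hI⟩ := hK₀comp
  exact hausdorffMeasure_le_of_sum_ediam_le hK₀c hI fun 𝒢 hdisj h𝒢 ↦
    sum_ediam_le_liminf_hausdorffMeasure hKc hKcomp hconv hdisj (fun E hE ↦ (h𝒢 E hE).1)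
      (fun E hE ↦ (h𝒢 E hE).2.1) fun E hE ↦ (h𝒢 E hE).2.2
end

section
/- Let X be a continuum (compact connected metric space) with H^1(X) < +∞, and let x ≠ x' be points of X. Then there exists an injective path γ : [0,1] → X connecting x to x', with constant speed, which minimizes length among all paths in X from x to x', and whose length is at most H^1(X). -/
open MeasureTheory ENNReal Set

/-- `x` and `y` are joined by a path on `[0, 1]` that is Lipschitz with constant `K`. -/
def LipschitzJoined {X : Type*} [MetricSpace X] (K : ℝ) (x y : X) : Prop :=
  ∃ f : ℝ → X, f 0 = x ∧ f 1 = y ∧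
    ∀ s ∈ Icc (0 : ℝ) 1, ∀ t ∈ Icc (0 : ℝ) 1, dist (f s) (f t) ≤ K * |s - t|

/-- Pointwise limits along an ultrafilter turn approximately Lipschitz maps into Lipschitz ones. -/
theorem LipschitzJoined.of_approx {X : Type*} [MetricSpace X] [CompactSpace X] {K : ℝ} {x y : X}
    (h : ∀ ε : ℝ, 0 < ε → ∃ f : ℝ → X, f 0 = x ∧ f 1 = y ∧
      ∀ s ∈ Icc (0 : ℝ) 1, ∀ t ∈ Icc (0 : ℝ) 1, dist (f s) (f t) ≤ K * |s - t| + ε) :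
    LipschitzJoined K x y := by
  choose f hf0 hf1 hf using fun n : ℕ => h (1 / ((n : ℝ) + 1)) Nat.one_div_pos_of_nat
  let U : Ultrafilter ℕ := Filter.hyperfilter ℕ
  have hU : (U : Filter ℕ) ≤ Filter.atTop := by
    rw [← Nat.cofinite_eq_atTop]; exact Filter.hyperfilter_le_cofinite
  have hlim : ∀ t : ℝ, ∃ z : X, Filter.Tendsto (fun n => f n t) U (nhds z) := fun t => by
    obtain ⟨z, -, hz⟩ := isCompact_univ.ultrafilter_le_nhds (U.map fun n => f n t) (by simp)
    exact ⟨z, hz⟩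
  choose g hg using hlim
  refine ⟨g, ?_, ?_, fun s hs t ht => ?_⟩
  · refine tendsto_nhds_unique (hg 0) ?_
    simp only [hf0]
    exact tendsto_const_nhds
  · refine tendsto_nhds_unique (hg 1) ?_
    simp only [hf1]
    exact tendsto_const_nhds
  · have hε : Filter.Tendsto (fun n : ℕ => K * |s - t| + 1 / ((n : ℝ) + 1)) U
        (nhds (K * |s - t| + 0)) :=
      tendsto_const_nhds.add (tendsto_one_div_add_atTop_nhds_zero_nat.mono_left hU)
    rw [add_zero] at hε
    exact le_of_tendsto_of_tendsto' ((hg s).dist (hg t)) hε fun n => hf n s hs t ht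

/-- There is a smallest Lipschitz constant among Lipschitz paths joining two points. -/
theorem exists_isLeast_lipschitzJoined {X : Type*} [MetricSpace X] [CompactSpace X] {x y : X}
    (h : ∃ K, LipschitzJoined K x y) : ∃ K, IsLeast {K | LipschitzJoined K x y} K := by
  have hbdd : BddBelow {K | LipschitzJoined K x y} := by
    refine ⟨0, ?_⟩
    rintro K ⟨f, -, -, hf⟩
    simpa using dist_nonneg.trans (hf 0 (by simp) 1 (by simp))
  refine ⟨sInf {K | LipschitzJoined K x y}, LipschitzJoined.of_approx fun ε hε => ?_,
    fun K hK => csInf_le hbdd hK⟩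
  obtain ⟨K, hK, hKε⟩ := Real.lt_sInf_add_pos (s := {K | LipschitzJoined K x y}) h hε
  obtain ⟨f, hf0, hf1, hf⟩ := hK
  refine ⟨f, hf0, hf1, fun s hs t ht => (hf s hs t ht).trans ?_⟩
  have h1 : |s - t| ≤ 1 := abs_le.2 ⟨by linarith [hs.1, ht.2], by linarith [hs.2, ht.1]⟩
  nlinarith [abs_nonneg (s - t)]

/-- In a connected space any two points are joined by an `ε`-chain. -/
theorem reachable_of_dist_lt {X : Type*} [MetricSpace X] [ConnectedSpace X] {ε : ℝ} (hε : 0 < ε)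
    (G : SimpleGraph X) (hG : ∀ u v, G.Adj u v ↔ u ≠ v ∧ dist u v < ε) (x y : X) :
    G.Reachable x y := by
  have step : ∀ u v : X, dist u v < ε → G.Reachable u v := fun u v h => by
    rcases eq_or_ne u v with rfl | huv
    · exact SimpleGraph.Reachable.refl _
    · exact ((hG u v).2 ⟨huv, h⟩).reachable
  have hclopen : IsClopen {z | G.Reachable x z} := by
    refine ⟨⟨Metric.isOpen_iff.2 fun z hz => ⟨ε, hε, fun w hw hxw => hz ?_⟩⟩,
      Metric.isOpen_iff.2 fun z hz => ⟨ε, hε, fun w hw => ?_⟩⟩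
    · exact SimpleGraph.Reachable.trans hxw (step w z hw)
    · exact SimpleGraph.Reachable.trans hz (step z w (by rwa [dist_comm]))
  exact eq_univ_iff_forall.1 (hclopen.eq_univ ⟨x, SimpleGraph.Reachable.refl _⟩) y

/-- A shortest `ε`-chain: consecutive points are `ε`-close, other pairs are `ε`-separated. -/
theorem exists_minimal_chain {X : Type*} [MetricSpace X] [ConnectedSpace X] {ε : ℝ} (hε : 0 < ε)
    (x y : X) : ∃ (n : ℕ) (p : ℕ → X), p 0 = x ∧ p n = y ∧
      (∀ i, dist (p i) (p (i + 1)) ≤ ε) ∧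
      ∀ i j, i + 2 ≤ j → j ≤ n → ε ≤ dist (p i) (p j) := by
  let G : SimpleGraph X :=
    { Adj := fun u v => u ≠ v ∧ dist u v < ε
      symm := ⟨fun u v h => ⟨h.1.symm, by rw [dist_comm]; exact h.2⟩⟩
      loopless := ⟨fun u h => h.1 rfl⟩ }
  obtain ⟨w, hw⟩ := (reachable_of_dist_lt hε G (fun _ _ => Iff.rfl) x y).exists_walk_length_eq_dist
  refine ⟨w.length, w.getVert, w.getVert_zero, w.getVert_length, fun i => ?_, fun i j hij hj => ?_⟩
  · rcases lt_or_ge i w.length with hi | hi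
    · exact (w.adj_getVert_succ hi).2.le
    · rw [w.getVert_of_length_le hi, w.getVert_of_length_le (hi.trans (Nat.le_succ i)), dist_self]
      exact hε.le
  · by_contra! hlt
    have hshort : ∃ q : G.Walk (w.getVert i) (w.getVert j), q.length ≤ 1 := by
      by_cases heq : w.getVert i = w.getVert j
      · rw [heq]; exact ⟨SimpleGraph.Walk.nil, by simp⟩
      · exact ⟨SimpleGraph.Adj.toWalk (G := G) ⟨heq, hlt⟩, by simp⟩
    obtain ⟨q, hq⟩ := hshort
    have := SimpleGraph.dist_le (((w.take i).append q).append (w.drop j))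
    simp only [SimpleGraph.Walk.length_append, SimpleGraph.Walk.take_length,
      SimpleGraph.Walk.drop_length] at this
    omega

/-- In a connected space, small balls have one-dimensional measure at least their radius. -/
theorem le_hausdorffMeasure_ball {X : Type*} [MetricSpace X] [MeasurableSpace X] [BorelSpace X]
    [ConnectedSpace X] {r : ℝ} {z w : X} (h : r ≤ dist z w) :
    ENNReal.ofReal r ≤ μH[1] (Metric.ball z r) := by
  have hL : LipschitzWith 1 (dist z) := LipschitzWith.dist_right z
  have hsub : Ico 0 r ⊆ dist z '' Metric.ball z r := by
    intro s hs
    obtain ⟨u, hu⟩ := mem_range_of_exists_le_of_exists_ge hL.continuous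
      ⟨z, by simpa using hs.1⟩ ⟨w, hs.2.le.trans h⟩
    exact ⟨u, by rw [Metric.mem_ball, dist_comm, hu]; exact hs.2, hu⟩
  calc ENNReal.ofReal r = μH[1] (Ico 0 r) := by rw [hausdorffMeasure_real]; simp
    _ ≤ μH[1] (dist z '' Metric.ball z r) := measure_mono hsub
    _ ≤ μH[1] (Metric.ball z r) := by
      simpa using hL.hausdorffMeasure_image_le zero_le_one (Metric.ball z r)

/-- A minimal chain has total length controlled by the Hausdorff measure. -/
theorem chain_length_le {X : Type*} [MetricSpace X] [MeasurableSpace X] [BorelSpace X]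
    [ConnectedSpace X] (hfin : μH[1] (univ : Set X) < ⊤) {x y : X} {ε : ℝ} (hε : 0 < ε)
    (hxy : ε ≤ dist x y) {n : ℕ} {p : ℕ → X}
    (hp : ∀ i j, i + 2 ≤ j → j ≤ n → ε ≤ dist (p i) (p j)) :
    n * ε ≤ 4 * (μH[1] (univ : Set X)).toReal := by
  have hdisj : (Finset.range (n / 2 + 1) : Set ℕ).PairwiseDisjoint
      fun k => Metric.ball (p (2 * k)) (ε / 2) := by
    intro k hk l hl hkl
    simp only [Finset.coe_range, mem_Iio] at hk hl
    refine Metric.ball_disjoint_ball ?_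
    rw [add_halves]
    rcases lt_or_gt_of_ne hkl with h | h
    · exact hp _ _ (by omega) (by omega)
    · rw [dist_comm]; exact hp _ _ (by omega) (by omega)
  have hball : ∀ z : X, ENNReal.ofReal (ε / 2) ≤ μH[1] (Metric.ball z (ε / 2)) := fun z => by
    rcases le_or_gt (ε / 2) (dist z x) with h | h
    · exact le_hausdorffMeasure_ball h
    · refine le_hausdorffMeasure_ball (w := y) ?_
      linarith [dist_triangle_left x y z]
  have hsum : ((n / 2 + 1 : ℕ) : ℝ≥0∞) * ENNReal.ofReal (ε / 2) ≤ μH[1] (univ : Set X) :=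
    calc ((n / 2 + 1 : ℕ) : ℝ≥0∞) * ENNReal.ofReal (ε / 2)
        = ∑ _k ∈ Finset.range (n / 2 + 1), ENNReal.ofReal (ε / 2) := by simp
      _ ≤ ∑ k ∈ Finset.range (n / 2 + 1), μH[1] (Metric.ball (p (2 * k)) (ε / 2)) :=
        Finset.sum_le_sum fun k _ => hball _
      _ = μH[1] (⋃ k ∈ Finset.range (n / 2 + 1), Metric.ball (p (2 * k)) (ε / 2)) :=
        (measure_biUnion_finset hdisj fun k _ => Metric.isOpen_ball.measurableSet).symm
      _ ≤ μH[1] (univ : Set X) := measure_mono (subset_univ _)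
  have hreal := ENNReal.toReal_mono hfin.ne hsum
  rw [ENNReal.toReal_mul, ENNReal.toReal_natCast, ENNReal.toReal_ofReal (by positivity)] at hreal
  have hn : (n : ℝ) ≤ 2 * ((n / 2 + 1 : ℕ) : ℝ) := by
    exact_mod_cast (by omega : n ≤ 2 * (n / 2 + 1))
  nlinarith

theorem dist_le_mul_sub_of_chain {X : Type*} [MetricSpace X] {ε : ℝ} {p : ℕ → X}
    (hp : ∀ i, dist (p i) (p (i + 1)) ≤ ε) (i j : ℕ) :
    dist (p i) (p j) ≤ ε * |(i : ℝ) - j| := by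
  wlog hij : i ≤ j generalizing i j
  · rw [dist_comm, abs_sub_comm]
    exact this j i (le_of_not_ge hij)
  have := dist_le_Ico_sum_of_dist_le hij (d := fun _ => ε) fun {k} _ _ => hp k
  rw [abs_sub_comm, abs_of_nonneg (by rw [sub_nonneg]; exact_mod_cast hij)]
  simpa [Nat.cast_sub hij, mul_comm] using this

theorem abs_natFloor_sub_natFloor_le {a b : ℝ} (ha : 0 ≤ a) (hb : 0 ≤ b) :
    |(⌊a⌋₊ : ℝ) - ⌊b⌋₊| ≤ |a - b| + 1 := by
  have h1 := Nat.floor_le ha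
  have h2 := Nat.floor_le hb
  have h3 := Nat.lt_floor_add_one a
  have h4 := Nat.lt_floor_add_one b
  rw [abs_le]
  constructor <;> linarith [le_abs_self (a - b), neg_abs_le (a - b)]

/-- Points of a continuum of finite one-dimensional measure are joined by Lipschitz paths. -/
theorem lipschitzJoined_of_hausdorffMeasure_lt_top {X : Type*} [MetricSpace X] [MeasurableSpace X]
    [BorelSpace X] [CompactSpace X] [ConnectedSpace X] (hfin : μH[1] (univ : Set X) < ⊤)
    {x y : X} (hxy : x ≠ y) :
    LipschitzJoined (4 * (μH[1] (univ : Set X)).toReal) x y := by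
  refine LipschitzJoined.of_approx fun δ hδ => ?_
  have hε : 0 < min δ (dist x y) := lt_min hδ (dist_pos.2 hxy)
  obtain ⟨n, p, hp0, hpn, hstep, hsep⟩ := exists_minimal_chain hε x y
  have hlen := chain_length_le hfin hε (min_le_right _ _) hsep
  refine ⟨fun t => p ⌊n * t⌋₊, by simpa using hp0, by simpa using hpn, fun s hs t ht => ?_⟩
  have hfl := abs_natFloor_sub_natFloor_le (mul_nonneg n.cast_nonneg hs.1)
    (mul_nonneg (Nat.cast_nonneg (α := ℝ) n) ht.1)
  rw [← mul_sub, abs_mul, Nat.abs_cast] at hfl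
  calc dist (p ⌊n * s⌋₊) (p ⌊n * t⌋₊)
      ≤ min δ (dist x y) * |(⌊n * s⌋₊ : ℝ) - ⌊n * t⌋₊| := dist_le_mul_sub_of_chain hstep _ _
    _ ≤ min δ (dist x y) * (n * |s - t| + 1) := by gcongr
    _ = (n * min δ (dist x y)) * |s - t| + min δ (dist x y) := by ring
    _ ≤ 4 * (μH[1] (univ : Set X)).toReal * |s - t| + δ := by
      gcongr
      exact min_le_left _ _

/-- The arc length function of a continuous path of finite length is continuous. -/
theorem continuousOn_variationOnFromTo {X : Type*} [MetricSpace X] {γ : ℝ → X} {a b : ℝ}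
    (hab : a ≤ b) (hγ : ContinuousOn γ (Icc a b)) (hbv : BoundedVariationOn γ (Icc a b)) :
    ContinuousOn (variationOnFromTo γ (Icc a b) a) (Icc a b) := by
  intro z hz
  have ha : a ∈ Icc a b := left_mem_Icc.2 hab
  have hl := (ENNReal.continuousAt_toReal zero_ne_top).tendsto.comp
    (hbv.tendsto_eVariationOn_Icc_zero_left ((hγ z hz).mono inter_subset_left))
  have hr := (ENNReal.continuousAt_toReal zero_ne_top).tendsto.comp
    (hbv.tendsto_eVariationOn_Icc_zero_right z ((hγ z hz).mono inter_subset_left))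
  have hlr := hl.add hr
  rw [toReal_zero, add_zero] at hlr
  refine tendsto_iff_dist_tendsto_zero.2 (squeeze_zero' (.of_forall fun _ => dist_nonneg) ?_ hlr)
  filter_upwards [self_mem_nhdsWithin] with y hy
  rw [Real.dist_eq, variationOnFromTo.sub_right hbv.locallyBoundedVariationOn ha hy hz]
  rcases le_total z y with h | h
  · rw [variationOnFromTo.eq_of_le _ _ h, abs_of_nonneg toReal_nonneg]
    exact le_add_of_nonneg_left toReal_nonneg
  · rw [variationOnFromTo.eq_of_ge _ _ h, abs_neg, abs_of_nonneg toReal_nonneg]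
    exact le_add_of_nonneg_right toReal_nonneg

/-- A path of finite length can be reparametrized to be Lipschitz with constant its length. -/
theorem lipschitzJoined_of_boundedVariationOn {X : Type*} [MetricSpace X] {γ : ℝ → X} {a b : ℝ}
    (hab : a ≤ b) (hγ : ContinuousOn γ (Icc a b)) (hbv : BoundedVariationOn γ (Icc a b)) :
    LipschitzJoined (eVariationOn γ (Icc a b)).toReal (γ a) (γ b) := by
  have ha : a ∈ Icc a b := left_mem_Icc.2 hab
  have hb : b ∈ Icc a b := right_mem_Icc.2 hab
  have hlbv := hbv.locallyBoundedVariationOn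
  set V := variationOnFromTo γ (Icc a b) a with hV
  set L := (eVariationOn γ (Icc a b)).toReal with hL
  have hVa : V a = 0 := variationOnFromTo.self _ _ _
  have hVb : V b = L := by rw [hV, variationOnFromTo.eq_of_le _ _ hab, inter_self]
  have hdist : ∀ u ∈ Icc a b, ∀ v ∈ Icc a b, dist (γ u) (γ v) ≤ |V u - V v| := by
    intro u hu v hv
    wlog huv : u ≤ v generalizing u v
    · rw [dist_comm, abs_sub_comm]
      exact this v hv u hu (le_of_not_ge huv)
    rw [abs_sub_comm, variationOnFromTo.sub_right hlbv ha hv hu,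
      variationOnFromTo.eq_of_le _ _ huv, abs_of_nonneg toReal_nonneg]
    exact (hlbv u v hu hv).dist_le ⟨hu, le_rfl, huv⟩ ⟨hv, huv, le_rfl⟩
  have hφ : ∀ t ∈ Icc (0 : ℝ) 1, ∃ u ∈ Icc a b, V u = L * t := fun t ht => by
    have := intermediate_value_Icc hab (continuousOn_variationOnFromTo hab hγ hbv)
    rw [← hV, hVa, hVb] at this
    have hL0 : 0 ≤ L := toReal_nonneg
    exact this ⟨mul_nonneg hL0 ht.1, mul_le_of_le_one_right hL0 ht.2⟩
  choose! φ hφmem hφV using hφ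
  have hendpoint : ∀ t ∈ Icc (0 : ℝ) 1, ∀ u ∈ Icc a b, V u = L * t → γ (φ t) = γ u := by
    intro t ht u hu hVu
    have := hdist _ (hφmem t ht) u hu
    rw [hφV t ht, hVu, sub_self, abs_zero] at this
    exact dist_le_zero.1 this
  refine ⟨γ ∘ φ, hendpoint 0 (by simp) a ha (by simpa using hVa),
    hendpoint 1 (by simp) b hb (by simpa using hVb), fun s hs t ht => ?_⟩
  refine (hdist _ (hφmem s hs) _ (hφmem t ht)).trans_eq ?_
  rw [hφV s hs, hφV t ht, ← mul_sub, abs_mul, abs_of_nonneg toReal_nonneg]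

theorem edist_le_hausdorffMeasure_image_Ioo {X : Type*} [MetricSpace X] [MeasurableSpace X]
    [BorelSpace X] {γ : ℝ → X} {a b : ℝ} (hab : a ≤ b) (hγ : ContinuousOn γ (Icc a b)) :
    edist (γ a) (γ b) ≤ μH[1] (γ '' Ioo a b) := by
  have hL : LipschitzWith 1 (dist (γ a)) := LipschitzWith.dist_right _
  have hsub : Ioo 0 (dist (γ a) (γ b)) ⊆ dist (γ a) '' (γ '' Ioo a b) := by
    have := intermediate_value_Ioo hab (hL.continuous.comp_continuousOn hγ)
    rw [image_image]
    simpa using this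
  calc edist (γ a) (γ b) = μH[1] (Ioo 0 (dist (γ a) (γ b))) := by
        rw [hausdorffMeasure_real, edist_dist]; simp
    _ ≤ μH[1] (dist (γ a) '' (γ '' Ioo a b)) := measure_mono hsub
    _ ≤ μH[1] (γ '' Ioo a b) := by simpa using hL.hausdorffMeasure_image_le zero_le_one _

/-- The length of an injective path is at most the one-dimensional measure of its image. -/
theorem eVariationOn_le_hausdorffMeasure_image {X : Type*} [MetricSpace X] [MeasurableSpace X]
    [BorelSpace X] {γ : ℝ → X} {a b : ℝ} (hγ : ContinuousOn γ (Icc a b))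
    (hinj : InjOn γ (Icc a b)) : eVariationOn γ (Icc a b) ≤ μH[1] (γ '' Icc a b) := by
  refine iSup_le ?_
  rintro ⟨n, u, hu, hmem⟩
  have hsub : ∀ i, Icc (u i) (u (i + 1)) ⊆ Icc a b := fun i => Icc_subset_Icc (hmem i).1 (hmem _).2
  have hsub' : ∀ i, Ioo (u i) (u (i + 1)) ⊆ Icc a b := fun i => Ioo_subset_Icc_self.trans (hsub i)
  have hdisj : (Finset.range n : Set ℕ).PairwiseDisjoint fun i => γ '' Ioo (u i) (u (i + 1)) := by
    intro i _ j _ hij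
    exact (hu.pairwise_disjoint_on_Ioo_succ hij).image hinj (hsub' i) (hsub' j)
  have hmeas : ∀ i ∈ Finset.range n, MeasurableSet (γ '' Ioo (u i) (u (i + 1))) := fun i _ =>
    measurableSet_Ioo.image_of_continuousOn_injOn (hγ.mono (hsub' i)) (hinj.mono (hsub' i))
  calc ∑ i ∈ Finset.range n, edist (γ (u (i + 1))) (γ (u i))
      ≤ ∑ i ∈ Finset.range n, μH[1] (γ '' Ioo (u i) (u (i + 1))) := by
        refine Finset.sum_le_sum fun i _ => ?_
        rw [edist_comm]
        exact edist_le_hausdorffMeasure_image_Ioo (hu (Nat.le_succ i)) (hγ.mono (hsub i))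
    _ = μH[1] (⋃ i ∈ Finset.range n, γ '' Ioo (u i) (u (i + 1))) :=
        (measure_biUnion_finset hdisj hmeas).symm
    _ ≤ μH[1] (γ '' Icc a b) :=
        measure_mono (iUnion₂_subset fun i _ => image_mono (hsub' i))

/-- Cutting a loop out of a Lipschitz path and rescaling. -/
theorem LipschitzJoined.of_loop {X : Type*} [MetricSpace X] {K : ℝ} {f : ℝ → X}
    (hf : ∀ s ∈ Icc (0 : ℝ) 1, ∀ t ∈ Icc (0 : ℝ) 1, dist (f s) (f t) ≤ K * |s - t|)
    {s t : ℝ} (hs : 0 ≤ s) (hst : s ≤ t) (ht : t ≤ 1) (heq : f s = f t) :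
    LipschitzJoined (K * (1 - (t - s))) (f 0) (f 1) := by
  set c := 1 - (t - s) with hc
  have hc0 : 0 ≤ c := by linarith
  refine ⟨fun u => if u * c ≤ s then f (u * c) else f (u * c + (t - s)), by simp [hs], ?_, ?_⟩
  · simp only [one_mul]
    split_ifs with h
    · have ht1 : t = 1 := by linarith
      rw [show c = s by linarith, heq, ht1]
    · rw [show c + (t - s) = 1 by linarith]
  intro u hu v hv
  wlog huv : u ≤ v generalizing u v
  · rw [dist_comm, abs_sub_comm]
    exact this v hv u hu (le_of_not_ge huv)
  have huv' : u * c ≤ v * c := mul_le_mul_of_nonneg_right huv hc0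
  have hu0 : 0 ≤ u * c := mul_nonneg hu.1 hc0
  have hv1 : v * c ≤ c := mul_le_of_le_one_left hc0 hv.2
  have hrhs : K * c * |u - v| = K * (v * c - u * c) := by
    rw [abs_sub_comm, abs_of_nonneg (sub_nonneg.2 huv)]; ring
  have hle : ∀ p q : ℝ, 0 ≤ p → p ≤ q → q ≤ 1 → dist (f p) (f q) ≤ K * (q - p) := by
    intro p q hp hpq hq
    have := hf p ⟨hp, hpq.trans hq⟩ q ⟨hp.trans hpq, hq⟩
    rwa [abs_sub_comm, abs_of_nonneg (sub_nonneg.2 hpq)] at this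
  rw [hrhs]
  dsimp only
  split_ifs with h1 h2 h2
  · exact hle _ _ hu0 huv' (by linarith)
  · have h3 := hle (u * c) s hu0 h1 (by linarith)
    have h4 := hle t (v * c + (t - s)) (by linarith) (by linarith) (by linarith)
    have h5 := dist_triangle (f (u * c)) (f s) (f (v * c + (t - s)))
    rw [← heq] at h4
    linarith
  · linarith
  · have := hle (u * c + (t - s)) (v * c + (t - s)) (by linarith) (by linarith) (by linarith)
    linarith

/-- A `K`-Lipschitz path on `[0, 1]` of length at least `K` has constant speed `K`. -/
theorem eVariationOn_Icc_eq_of_le {X : Type*} [MetricSpace X] {K : ℝ} (hK : 0 ≤ K) {f : ℝ → X}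
    (hf : ∀ s ∈ Icc (0 : ℝ) 1, ∀ t ∈ Icc (0 : ℝ) 1, dist (f s) (f t) ≤ K * |s - t|)
    (hlen : ENNReal.ofReal K ≤ eVariationOn f (Icc 0 1)) {s t : ℝ} (hs : 0 ≤ s) (hst : s ≤ t)
    (ht : t ≤ 1) : eVariationOn f (Icc s t) = ENNReal.ofReal K * ENNReal.ofReal (t - s) := by
  have hlip : LipschitzOnWith K.toNNReal f (Icc 0 1) :=
    LipschitzOnWith.of_dist_le_mul fun u hu v hv => by
      rw [Real.coe_toNNReal _ hK, Real.dist_eq]; exact hf u hu v hv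
  have hle : ∀ p q : ℝ, 0 ≤ p → q ≤ 1 →
      eVariationOn f (Icc p q) ≤ ENNReal.ofReal (K * (q - p)) := by
    intro p q hp hq
    have := (hlip.mono (Icc_subset_Icc hp hq)).comp_eVariationOn_le (g := id) (mapsTo_id _)
    rwa [eVariationOn_id_Icc, Function.comp_id, ← ENNReal.ofReal, ← ENNReal.ofReal_mul hK] at this
  have hadd : eVariationOn f (Icc 0 s) + eVariationOn f (Icc s t) + eVariationOn f (Icc t 1)
      = eVariationOn f (Icc 0 1) := by
    have h1 := eVariationOn.Icc_add_Icc f hs hst (mem_univ s)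
    have h2 := eVariationOn.Icc_add_Icc f (hs.trans hst) ht (mem_univ t)
    simp only [univ_inter] at h1 h2
    rw [h1, h2]
  rw [← ENNReal.ofReal_mul hK]
  refine le_antisymm (hle s t hs ht) ?_
  have h0 : 0 ≤ K * (s - 0) := by rw [sub_zero]; positivity
  have h1 : 0 ≤ K * (t - s) := mul_nonneg hK (by linarith)
  have h2 : 0 ≤ K * (1 - t) := mul_nonneg hK (by linarith)
  have hsplit : ENNReal.ofReal K = ENNReal.ofReal (K * (t - s)) +
      (ENNReal.ofReal (K * (s - 0)) + ENNReal.ofReal (K * (1 - t))) := by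
    rw [← ENNReal.ofReal_add h0 h2, ← ENNReal.ofReal_add h1 (add_nonneg h0 h2)]
    congr 1; ring
  refine (ENNReal.add_le_add_iff_right (a := ENNReal.ofReal (K * (s - 0)) +
    ENNReal.ofReal (K * (1 - t))) (by finiteness)).1 ?_
  calc _ = ENNReal.ofReal K := hsplit.symm
    _ ≤ eVariationOn f (Icc 0 1) := hlen
    _ = eVariationOn f (Icc s t) + (eVariationOn f (Icc 0 s) + eVariationOn f (Icc t 1)) := by
      rw [← hadd]; ring
    _ ≤ _ := by
      gcongr
      · exact hle 0 s le_rfl (hst.trans ht)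
      · exact hle t 1 (hs.trans hst) le_rfl

theorem stmt14 {X : Type*} [MetricSpace X] [MeasurableSpace X] [BorelSpace X]
    [CompactSpace X] [ConnectedSpace X]
    (hfin : μH[1] (univ : Set X) < ⊤) (x x' : X) (hxx : x ≠ x') :
    ∃ γ : ℝ → X, ContinuousOn γ (Icc 0 1) ∧ InjOn γ (Icc 0 1) ∧
      γ 0 = x ∧ γ 1 = x' ∧
      -- constant speed
      (∃ c : ℝ≥0∞, ∀ s t : ℝ, 0 ≤ s → s ≤ t → t ≤ 1 →
        eVariationOn γ (Icc s t) = c * ENNReal.ofReal (t - s)) ∧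
      -- geodesic: minimizes length among all paths from x to x'
      (∀ (a b : ℝ) (γ' : ℝ → X), a ≤ b → ContinuousOn γ' (Icc a b) →
        γ' a = x → γ' b = x' → eVariationOn γ (Icc 0 1) ≤ eVariationOn γ' (Icc a b)) ∧
      eVariationOn γ (Icc 0 1) ≤ μH[1] (univ : Set X) := by
  obtain ⟨K, ⟨f, hf0, hf1, hf⟩, hmin⟩ :=
    exists_isLeast_lipschitzJoined ⟨_, lipschitzJoined_of_hausdorffMeasure_lt_top hfin hxx⟩
  have hK : 0 < K := by
    have := hf 0 (by simp) 1 (by simp)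
    rw [hf0, hf1] at this
    simpa using (dist_pos.2 hxx).trans_le this
  have hcont : ContinuousOn f (Icc 0 1) :=
    LipschitzOnWith.continuousOn (K := K.toNNReal) <|
      LipschitzOnWith.of_dist_le_mul fun u hu v hv => by
        rw [Real.coe_toNNReal _ hK.le, Real.dist_eq]; exact hf u hu v hv
  have hshortest : ∀ (a b : ℝ) (γ' : ℝ → X), a ≤ b → ContinuousOn γ' (Icc a b) →
      γ' a = x → γ' b = x' → ENNReal.ofReal K ≤ eVariationOn γ' (Icc a b) := by
    intro a b γ' hab hγ' ha hb
    by_cases hbv : eVariationOn γ' (Icc a b) = ⊤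
    · rw [hbv]; exact le_top
    · refine ENNReal.ofReal_le_of_le_toReal (hmin ?_)
      have := lipschitzJoined_of_boundedVariationOn hab hγ' hbv
      rwa [ha, hb] at this
  have hspeed := fun {s t : ℝ} => eVariationOn_Icc_eq_of_le hK.le hf
    (hshortest 0 1 f zero_le_one hcont hf0 hf1) (s := s) (t := t)
  have hinj : InjOn f (Icc 0 1) := by
    intro s hs t ht hst
    wlog hlt : s ≤ t generalizing s t
    · exact (this ht hs hst.symm (le_of_not_ge hlt)).symm
    have hloop := LipschitzJoined.of_loop hf hs.1 hlt ht.2 hst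
    rw [hf0, hf1] at hloop
    have : K ≤ K * (1 - (t - s)) := hmin hloop
    nlinarith
  have hlen : eVariationOn f (Icc 0 1) = ENNReal.ofReal K := by
    simpa using hspeed le_rfl zero_le_one le_rfl
  exact ⟨f, hcont, hinj, hf0, hf1, ⟨ENNReal.ofReal K, fun s t hs hst ht => hspeed hs hst ht⟩,
    fun a b γ' hab hγ' ha hb => hlen.le.trans (hshortest a b γ' hab hγ' ha hb),
    (eVariationOn_le_hausdorffMeasure_image hcont hinj).trans (measure_mono (subset_univ _))⟩
end

section
/- Let γ : I → X be a path of finite length in a metric space and let μ_γ be its length measure on I (the unique positive measure with μ_γ([t_0,t_1]) = length(γ,[t_0,t_1]) for all subintervals). Then for μ_γ-almost every t ∈ I, liminf_{r→0} diam(γ(B(t,r)))/r > 0. -/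
open MeasureTheory ENNReal Set Filter

/-- The total variation on adjacent closed intervals is additive. -/
lemma eVariationOn_Icc_add_Icc {X : Type*} [PseudoEMetricSpace X] (γ : ℝ → X) {x y z : ℝ}
    (hxy : x ≤ y) (hyz : y ≤ z) :
    eVariationOn γ (Icc x y) + eVariationOn γ (Icc y z) = eVariationOn γ (Icc x z) := by
  simpa using eVariationOn.Icc_add_Icc γ hxy hyz (mem_univ y)

/-- If finitely many disjoint subintervals of `[x, y]` have variation at least twice the distance
between the images of their endpoints, then their total variation bounds from below the defect
`2 * (length - distance)` over `[x, y]`. -/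
lemma sum_eVariationOn_add_edist_le {X ι : Type*} [PseudoEMetricSpace X] (γ : ℝ → X)
    (S : Finset ι) (u v : ι → ℝ) (x : ℝ) (huv : ∀ i ∈ S, u i ≤ v i) (hxu : ∀ i ∈ S, x ≤ u i)
    (hdisj : (S : Set ι).PairwiseDisjoint fun i => Icc (u i) (v i))
    (hle : ∀ i ∈ S, 2 * edist (γ (u i)) (γ (v i)) ≤ eVariationOn γ (Icc (u i) (v i)))
    (y : ℝ) (hxy : x ≤ y) (hvy : ∀ i ∈ S, v i ≤ y) :
    ∑ i ∈ S, eVariationOn γ (Icc (u i) (v i)) + 2 * edist (γ x) (γ y) ≤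
      2 * eVariationOn γ (Icc x y) := by
  classical
  induction S using Finset.induction_on_max_value v generalizing y with
  | empty =>
    simpa using mul_le_mul_right
      (eVariationOn.edist_le γ (left_mem_Icc.2 hxy) (right_mem_Icc.2 hxy)) 2
  | insert k S hk hmax ih =>
    simp only [Finset.mem_insert, forall_eq_or_imp] at huv hxu hle hvy
    have hlt : ∀ i ∈ S, v i ≤ u k := by
      intro i hi
      by_contra! h
      have hne : k ≠ i := fun h => hk (h ▸ hi)
      have hd : Disjoint (Icc (u k) (v k)) (Icc (u i) (v i)) :=
        hdisj (by simp) (by simp [hi]) hne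
      exact disjoint_left.1 hd ⟨h.le, hmax i hi⟩ ⟨huv.2 i hi, le_rfl⟩
    have h₁ := ih huv.2 hxu.2 (hdisj.subset (by simp)) hle.2 (u k) hxu.1 hlt
    have h₂ : 2 * edist (γ (v k)) (γ y) ≤ 2 * eVariationOn γ (Icc (v k) y) := mul_le_mul_right
      (eVariationOn.edist_le γ (left_mem_Icc.2 hvy.1) (right_mem_Icc.2 hvy.1)) 2
    rw [Finset.sum_insert hk, ← eVariationOn_Icc_add_Icc γ hxu.1 (huv.1.trans hvy.1),
      ← eVariationOn_Icc_add_Icc γ huv.1 hvy.1]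
    set A := eVariationOn γ (Icc (u k) (v k))
    set T := ∑ i ∈ S, eVariationOn γ (Icc (u i) (v i))
    calc A + T + 2 * edist (γ x) (γ y)
        ≤ A + T + 2 * (edist (γ x) (γ (u k)) + edist (γ (u k)) (γ (v k))
            + edist (γ (v k)) (γ y)) := by
          gcongr
          exact edist_triangle4 _ _ _ _
      _ = (T + 2 * edist (γ x) (γ (u k))) + (A + 2 * edist (γ (u k)) (γ (v k)))
            + 2 * edist (γ (v k)) (γ y) := by ring
      _ ≤ 2 * eVariationOn γ (Icc x (u k)) + (A + A) + 2 * eVariationOn γ (Icc (v k) y) := by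
          gcongr
          exact hle.1
      _ = _ := by ring

/-- The points admitting arbitrarily small radii for which the variation of `γ` on the ball is at
least twice the distance between the images of its endpoints. -/
def detourPoints {X : Type*} [PseudoEMetricSpace X] (γ : ℝ → X) : Set ℝ :=
  {t | ∀ δ > 0, ∃ r ∈ Ioo (0 : ℝ) δ,
    2 * edist (γ (t - r)) (γ (t + r)) ≤ eVariationOn γ (Icc (t - r) (t + r))}

lemma measure_detourPoints_inter_Ioo_add_edist_le {X : Type*} [PseudoEMetricSpace X] {γ : ℝ → X}
    {ν : Measure ℝ} [SFinite ν] {x y : ℝ} (hxy : x ≤ y)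
    (hν : ∀ s t, x ≤ s → s ≤ t → t ≤ y → ν (Icc s t) = eVariationOn γ (Icc s t)) :
    ν (detourPoints γ ∩ Ioo x y) + 2 * edist (γ x) (γ y) ≤ 2 * ν (Icc x y) := by
  obtain ⟨T, r, hTc, hTs, hr, hcov, hdisj⟩ := Besicovitch.exists_disjoint_closedBall_covering_ae ν
    (fun t => {r | 2 * edist (γ (t - r)) (γ (t + r)) ≤ eVariationOn γ (Icc (t - r) (t + r))})
    (detourPoints γ ∩ Ioo x y)
    (fun t ht δ hδ => let ⟨r, hr, h⟩ := ht.1 δ hδ; ⟨r, h, hr⟩)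
    (fun t => min (t - x) (y - t))
    (fun t ht => lt_min (sub_pos.2 ht.2.1) (sub_pos.2 ht.2.2))
  simp only [Real.closedBall_eq_Icc] at hcov hdisj
  have hx : ∀ t ∈ T, x ≤ t - r t := fun t ht => by
    linarith [(hr t ht).2.2.trans_le (min_le_left _ _)]
  have hy : ∀ t ∈ T, t + r t ≤ y := fun t ht => by
    linarith [(hr t ht).2.2.trans_le (min_le_right _ _)]
  have hrle : ∀ t ∈ T, t - r t ≤ t + r t := fun t ht => by linarith [(hr t ht).2.1]
  have hcover : ν (detourPoints γ ∩ Ioo x y) ≤ ∑' t : T, ν (Icc (t - r t) (t + r t)) := by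
    have := hTc.to_subtype
    calc ν (detourPoints γ ∩ Ioo x y)
        ≤ ν (⋃ t ∈ T, Icc (t - r t) (t + r t)) := by
          refine measure_mono_ae ?_
          exact ae_le_set.2 hcov
      _ ≤ _ := by
          rw [biUnion_eq_iUnion]
          exact measure_iUnion_le _
  refine (add_le_add_left hcover _).trans ?_
  rw [ENNReal.tsum_eq_iSup_sum, ENNReal.iSup_add]
  refine iSup_le fun S => ?_
  rw [hν x y le_rfl hxy le_rfl]
  rw [Finset.sum_congr rfl fun (t : T) _ => hν _ _ (hx t t.2) (hrle t t.2) (hy t t.2)]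
  exact sum_eVariationOn_add_edist_le γ S (fun t : T => t - r t) (fun t : T => t + r t) x
    (fun t _ => hrle t t.2) (fun t _ => hx t t.2)
    (fun s _ t _ hst => hdisj s.2 t.2 (Subtype.coe_injective.ne hst))
    (fun t _ => (hr t t.2).1) y hxy (fun t _ => hy t t.2)

lemma measure_detourPoints_inter_Ioo {X : Type*} [PseudoEMetricSpace X] {γ : ℝ → X}
    {ν : Measure ℝ} [IsFiniteMeasure ν] {a b : ℝ}
    (hν : ∀ s t, a ≤ s → s ≤ t → t ≤ b → ν (Icc s t) = eVariationOn γ (Icc s t)) :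
    ν (detourPoints γ ∩ Icc a b) = 0 := by
  obtain hab | hab := lt_or_ge b a
  · simp [Icc_eq_empty_of_lt hab]
  have hpt : ∀ s, a ≤ s → s ≤ b → ν {s} = 0 := fun s has hsb => by
    rw [← Icc_self, hν s s has le_rfl hsb]
    exact eVariationOn.subsingleton γ (by simp)
  have hadd : ∀ {s t w}, a ≤ s → s ≤ t → t ≤ w → w ≤ b →
      ν (Icc s t) + ν (Icc t w) = ν (Icc s w) := fun has hst htw hwb => by
    rw [hν _ _ has hst (htw.trans hwb), hν _ _ (has.trans hst) htw hwb,
      hν _ _ has (hst.trans htw) hwb, eVariationOn_Icc_add_Icc γ hst htw]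
  have hcell : ∀ s t, a ≤ s → s ≤ t → t ≤ b →
      ν (detourPoints γ ∩ Icc s t) + 2 * edist (γ s) (γ t) ≤ 2 * ν (Icc s t) := by
    intro s t has hst htb
    refine le_trans (add_le_add_left ?_ _) (measure_detourPoints_inter_Ioo_add_edist_le hst
      fun u v hu huv hv => hν u v (has.trans hu) huv (hv.trans htb))
    refine measure_mono_ae (ae_le_set.2 (measure_mono_null (t := {s} ∪ {t}) ?_
      (measure_union_null (hpt s has (hst.trans htb)) (hpt t (has.trans hst) htb))))
    rintro z ⟨⟨hz, hsz, hzt⟩, hz'⟩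
    by_contra h
    simp only [mem_union, mem_singleton_iff, not_or] at h
    exact hz' ⟨hz, lt_of_le_of_ne hsz (Ne.symm h.1), lt_of_le_of_ne hzt h.2⟩
  have hsub : ∀ s t w, ν (detourPoints γ ∩ Icc s w) ≤
      ν (detourPoints γ ∩ Icc s t) + ν (detourPoints γ ∩ Icc t w) := fun s t w => by
    refine (measure_mono ?_).trans (measure_union_le _ _)
    rw [← inter_union_distrib_left]
    exact inter_subset_inter_right _ Icc_subset_Icc_union_Icc
  have hsum : ∀ (n : ℕ) (u : ℕ → ℝ), Monotone u → (∀ i, u i ∈ Icc a b) →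
      ν (detourPoints γ ∩ Icc a (u n)) +
        2 * ∑ i ∈ Finset.range n, edist (γ (u (i + 1))) (γ (u i)) ≤ 2 * ν (Icc a (u n)) := by
    intro n u hu hmem
    induction n with
    | zero => simpa using le_self_add.trans (hcell a (u 0) le_rfl (hmem 0).1 (hmem 0).2)
    | succ n ih =>
      have hstep := hcell (u n) (u (n + 1)) (hmem n).1 (hu n.le_succ) (hmem _).2
      rw [Finset.sum_range_succ, ← hadd le_rfl (hmem n).1 (hu n.le_succ) (hmem _).2, mul_add,
        mul_add, edist_comm (γ (u (n + 1)))]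
      refine le_trans ?_ (add_le_add ih hstep)
      refine (add_le_add_left (hsub a (u n) (u (n + 1))) _).trans_eq ?_
      ring
  have htotal : ν (detourPoints γ ∩ Icc a b) + 2 * ν (Icc a b) ≤ 2 * ν (Icc a b) := by
    have := eVariationOn.nonempty_monotone_mem (nonempty_Icc.2 hab)
    conv_lhs => rw [hν a b le_rfl hab le_rfl, eVariationOn, ENNReal.mul_iSup, ENNReal.add_iSup]
    refine iSup_le fun ⟨n, u, hu, hmem⟩ => ?_
    have hlast := le_self_add.trans (hcell (u n) b (hmem n).1 (hmem n).2 le_rfl)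
    rw [← hadd le_rfl (hmem n).1 (hmem n).2 le_rfl, mul_add]
    refine le_trans ?_ (add_le_add (hsum n u hu hmem) hlast)
    refine (add_le_add_left (hsub a (u n) b) _).trans_eq ?_
    ring
  have hne : 2 * ν (Icc a b) ≠ ⊤ := ENNReal.mul_ne_top (by simp) (measure_ne_top _ _)
  simpa using (ENNReal.add_le_add_iff_right hne).1 (htotal.trans_eq (zero_add _).symm)

theorem stmt16 {X : Type*} [MetricSpace X]
    (a b : ℝ) (hab : a ≤ b) (γ : ℝ → X) (hγ : ContinuousOn γ (Icc a b))
    (hfin : eVariationOn γ (Icc a b) < ⊤)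
    (μ : Measure ℝ)
    (hμ : ∀ s t : ℝ, a ≤ s → s ≤ t → t ≤ b → μ (Icc s t) = eVariationOn γ (Icc s t)) :
    ∀ᵐ t ∂μ, t ∈ Icc a b →
      0 < liminf (fun r : ℝ =>
        EMetric.diam (γ '' (Metric.closedBall t r ∩ Icc a b)) / ENNReal.ofReal r)
        (nhdsWithin 0 (Ioi 0)) := by
  rw [← ae_restrict_iff' measurableSet_Icc]
  set ν := μ.restrict (Icc a b) with hνdef
  have hν : ∀ s t, a ≤ s → s ≤ t → t ≤ b → ν (Icc s t) = eVariationOn γ (Icc s t) := by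
    intro s t has hst htb
    rw [hνdef, Measure.restrict_apply measurableSet_Icc,
      inter_eq_left.2 (Icc_subset_Icc has htb), hμ s t has hst htb]
  have : IsFiniteMeasure ν := ⟨by
    rwa [hνdef, Measure.restrict_apply_univ, hμ a b le_rfl hab le_rfl]⟩
  have hpt : ∀ s ∈ Icc a b, ∀ᵐ t ∂ν, t ≠ s := fun s hs => by
    have : ν {s} = 0 := by
      rw [← Icc_self, hν s s hs.1 le_rfl hs.2]
      exact eVariationOn.subsingleton γ (by simp)
    simpa [ae_iff] using this
  have hdet : ∀ᵐ t ∂ν, t ∉ detourPoints γ ∩ Icc a b :=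
    measure_eq_zero_iff_ae_notMem.1 (measure_detourPoints_inter_Ioo hν)
  filter_upwards [ae_restrict_mem measurableSet_Icc, hpt a ⟨le_rfl, hab⟩, hpt b ⟨hab, le_rfl⟩,
    hdet, Besicovitch.ae_tendsto_rnDeriv volume ν, Measure.rnDeriv_lt_top volume ν]
    with t ht hta htb htdet htend hlt
  obtain ⟨M, hM, hMtop⟩ := exists_between hlt
  have hM0 : M ≠ 0 := (bot_lt_of_lt hM).ne'
  obtain ⟨δ, hδ, hdetour⟩ : ∃ δ > 0, ∀ r ∈ Ioo (0 : ℝ) δ,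
      eVariationOn γ (Icc (t - r) (t + r)) < 2 * edist (γ (t - r)) (γ (t + r)) := by
    have : t ∉ detourPoints γ := fun h => htdet ⟨h, ht⟩
    simpa [detourPoints] using this
  have hta' : 0 < t - a := sub_pos.2 (lt_of_le_of_ne ht.1 (Ne.symm hta))
  have htb' : 0 < b - t := sub_pos.2 (lt_of_le_of_ne ht.2 htb)
  refine (ENNReal.inv_pos.2 hMtop.ne).trans_le (le_liminf_of_le (by isBoundedDefault) ?_)
  filter_upwards [htend.eventually_lt_const hM, Ioo_mem_nhdsGT hδ, Ioo_mem_nhdsGT hta',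
    Ioo_mem_nhdsGT htb'] with r hr hrδ hra hrb
  have hr0 : 0 < r := hrδ.1
  have hra' : a ≤ t - r := by linarith [hra.2]
  have hrb' : t + r ≤ b := by linarith [hrb.2]
  have hball : volume (Metric.closedBall t r) ≤ M * ν (Metric.closedBall t r) :=
    (ENNReal.div_le_iff_le_mul (Or.inr hMtop.ne) (Or.inl (measure_ne_top _ _))).1 hr.le
  have hdiam : edist (γ (t - r)) (γ (t + r)) ≤
      Metric.ediam (γ '' (Metric.closedBall t r ∩ Icc a b)) := by
    refine Metric.edist_le_ediam_of_mem (mem_image_of_mem _ ?_) (mem_image_of_mem _ ?_) <;>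
    · rw [Real.closedBall_eq_Icc]
      refine ⟨⟨?_, ?_⟩, ?_, ?_⟩ <;> linarith
  rw [Real.volume_closedBall, Real.closedBall_eq_Icc,
    hν _ _ hra' (by linarith) hrb', ENNReal.ofReal_mul (by simp)] at hball
  rw [ENNReal.le_div_iff_mul_le (Or.inl (by simpa using hr0)) (Or.inl ofReal_ne_top), mul_comm,
    ← div_eq_mul_inv, ENNReal.div_le_iff_le_mul (Or.inl hM0) (Or.inl hMtop.ne), mul_comm]
  have h2 : 2 * ENNReal.ofReal r ≤
      2 * (M * Metric.ediam (γ '' (Metric.closedBall t r ∩ Icc a b))) := by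
    calc 2 * ENNReal.ofReal r ≤ M * eVariationOn γ (Icc (t - r) (t + r)) := by simpa using hball
      _ ≤ M * (2 * Metric.ediam (γ '' (Metric.closedBall t r ∩ Icc a b))) := by
          gcongr
          exact (hdetour r hrδ).le.trans (by gcongr)
      _ = _ := by ring
  exact (ENNReal.mul_le_mul_iff_right (by simp) (by simp)).1 h2
end

section
/- Let γ : I → X be a path with finite length in a metric space X, and let E be a Borel subset of γ(I) with H^1(E) > 0. Then there exists a Lipschitz function g : X → ℝ such that the Lebesgue measure of g(E) is positive. -/
open MeasureTheory ENNReal Set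

open scoped NNReal Topology

/-- If `c` is Lipschitz in terms of `h` on a set, then the image under `h` controls the size of the
image under `c`. -/
theorem hausdorffMeasure_image_le_of_dist_le {S Y Z : Type*}
    [MetricSpace Y] [MeasurableSpace Y] [BorelSpace Y]
    [MetricSpace Z] [MeasurableSpace Z] [BorelSpace Z]
    {c : S → Z} {h : S → Y} {A : Set S} {K : ℝ≥0}
    (H : ∀ s ∈ A, ∀ t ∈ A, dist (c s) (c t) ≤ K * dist (h s) (h t)) {d : ℝ} (hd : 0 ≤ d) :
    μH[d] (c '' A) ≤ (K : ℝ≥0∞) ^ d * μH[d] (h '' A) := by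
  rcases A.eq_empty_or_nonempty with rfl | ⟨s₀, -⟩
  · simp
  have : Nonempty S := ⟨s₀⟩
  have hinv : ∀ s ∈ A, Function.invFunOn h A (h s) ∈ A ∧
      h (Function.invFunOn h A (h s)) = h s := fun s hs ↦
    ⟨Function.invFunOn_mem ⟨s, hs, rfl⟩, Function.invFunOn_eq ⟨s, hs, rfl⟩⟩
  have hφ : LipschitzOnWith K (c ∘ Function.invFunOn h A) (h '' A) := by
    refine LipschitzOnWith.of_dist_le_mul ?_
    rintro _ ⟨s, hs, rfl⟩ _ ⟨t, ht, rfl⟩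
    have := H _ (hinv s hs).1 _ (hinv t ht).1
    rwa [(hinv s hs).2, (hinv t ht).2] at this
  have himg : (c ∘ Function.invFunOn h A) '' (h '' A) = c '' A := by
    rw [image_image]
    refine image_congr fun s hs ↦ ?_
    have := H _ (hinv s hs).1 s hs
    rw [(hinv s hs).2, dist_self, mul_zero] at this
    exact dist_le_zero.1 this
  rw [← himg]
  exact hφ.hausdorffMeasure_image_le hd

/-- If the image of a set under a real function is null, then the function has no nonzero
derivative at almost every point of the set. -/
theorem volume_inter_deriv_ne_zero_of_volume_image_eq_zero {f : ℝ → ℝ} {A : Set ℝ}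
    (hA : volume (f '' A) = 0) : volume (A ∩ {x | deriv f x ≠ 0}) = 0 := by
  let B : ℕ → Set ℝ := fun n ↦
    {x ∈ A | ∀ y, dist y x < 1 / ((n : ℝ) + 1) → dist y x ≤ n * dist (f y) (f x)}
  have hcover : A ∩ {x | deriv f x ≠ 0} ⊆ ⋃ n, B n := by
    rintro x ⟨hxA, hx⟩
    have hdiff : HasDerivAt f (deriv f x) x := (differentiableAt_of_deriv_ne_zero hx).hasDerivAt
    obtain ⟨C, hC⟩ := (hdiff.isTheta_sub hx).isBigO_symm.bound
    rw [Filter.prod_pure, Filter.eventually_map, Metric.eventually_nhds_iff] at hC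
    obtain ⟨ε, hε, hC⟩ := hC
    obtain ⟨m, hm⟩ := exists_nat_one_div_lt hε
    obtain ⟨k, hk⟩ := exists_nat_ge C
    refine mem_iUnion.2 ⟨max m k, hxA, fun y hy ↦ ?_⟩
    have h1 : (1 : ℝ) / ((max m k : ℕ) + 1) ≤ 1 / ((m : ℝ) + 1) := by
      gcongr
      exact le_max_left _ _
    have h2 := hC (hy.trans_le (h1.trans hm.le))
    have h3 : C ≤ ((max m k : ℕ) : ℝ) := hk.trans (by exact_mod_cast le_max_right _ _)
    rw [Real.dist_eq, Real.dist_eq]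
    exact h2.trans (mul_le_mul_of_nonneg_right h3 (abs_nonneg _))
  refine measure_mono_null hcover (measure_iUnion_null fun n ↦ ?_)
  refine measure_null_of_locally_null _ fun x _ ↦ ?_
  have hr : (0 : ℝ) < 1 / ((n : ℝ) + 1) / 2 := by positivity
  refine ⟨B n ∩ Metric.ball x (1 / ((n : ℝ) + 1) / 2),
    inter_mem_nhdsWithin _ (Metric.ball_mem_nhds _ hr), ?_⟩
  have key := hausdorffMeasure_image_le_of_dist_le (c := id) (h := f) (K := n)
    (A := B n ∩ Metric.ball x (1 / ((n : ℝ) + 1) / 2)) (d := 1) (fun s hs t ht ↦ by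
      refine ht.1.2 s ?_
      have h1 := Metric.mem_ball.1 hs.2
      have h2 := Metric.mem_ball'.1 ht.2
      linarith [dist_triangle s x t]) zero_le_one
  have hnull : volume (f '' (B n ∩ Metric.ball x (1 / ((n : ℝ) + 1) / 2))) = 0 :=
    measure_mono_null (image_mono fun y hy ↦ hy.1.1) hA
  rw [image_id, hausdorffMeasure_real, hnull, mul_zero] at key
  exact nonpos_iff_eq_zero.1 key

/-- The integral of the indicator of the complement of a measurable set maps that set to a null
set. -/
theorem volume_image_integral_indicator_compl_eq_zero {B : Set ℝ} (hB : MeasurableSet B) :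
    volume ((fun x ↦ ∫ t in (0 : ℝ)..x, Bᶜ.indicator (fun _ ↦ (1 : ℝ)) t) '' B) = 0 := by
  have hloc : LocallyIntegrable (Bᶜ.indicator (fun _ ↦ (1 : ℝ))) :=
    (locallyIntegrable_const 1).indicator hB.compl
  set h : ℝ → ℝ := fun x ↦ ∫ t in (0 : ℝ)..x, Bᶜ.indicator (fun _ ↦ (1 : ℝ)) t with hh
  have hae := _root_.LocallyIntegrable.ae_hasDerivAt_integral hloc
  have hlip : LipschitzWith 1 h := by
    refine LipschitzWith.of_dist_le_mul fun x y ↦ ?_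
    have hint : ∀ u v : ℝ, IntervalIntegrable (Bᶜ.indicator (fun _ ↦ (1 : ℝ))) volume u v :=
      fun u v ↦
    intervalIntegrable_iff.2
      ((hloc.integrableOn_isCompact isCompact_uIcc).mono_set uIoc_subset_uIcc)
    rw [Real.dist_eq, hh, intervalIntegral.integral_interval_sub_left (hint _ _) (hint _ _)]
    simpa [Real.dist_eq] using
      intervalIntegral.norm_integral_le_of_norm_le_const (a := y) (b := x) (C := 1)
        (f := Bᶜ.indicator (fun _ ↦ (1 : ℝ))) fun t _ ↦ by
          by_cases ht : t ∈ Bᶜ <;> simp [indicator, ht]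
  let N : Set ℝ := {x | ¬ ∀ c, HasDerivAt (fun x => ∫ t in c..x, Bᶜ.indicator (fun _ ↦ (1 : ℝ)) t)
    (Bᶜ.indicator (fun _ ↦ (1 : ℝ)) x) x}
  have hN : volume N = 0 := hae
  have h1 : volume (h '' N) = 0 := by
    have := hlip.hausdorffMeasure_image_le zero_le_one N
    simpa [hausdorffMeasure_real, hN] using this
  have h2 : volume (h '' (B \ N)) = 0 := by
    refine addHaar_image_eq_zero_of_det_fderivWithin_eq_zero volume (f' := fun _ ↦ 0)
      (fun x hx ↦ ?_) (fun x hx ↦ by simp)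
    have hd : HasDerivAt h _ x := not_not.1 hx.2 0
    have hz : Bᶜ.indicator (fun _ ↦ (1 : ℝ)) x = 0 := by simp [hx.1]
    rw [hz] at hd
    simpa using hd.hasFDerivAt.hasFDerivWithinAt (s := B \ N)
  refine measure_mono_null ?_ (measure_union_null h1 h2)
  rw [← image_union]
  exact image_mono fun x hx ↦ by by_cases hxN : x ∈ N <;> simp [hx, hxN]

/-- If a `1`-Lipschitz curve defined on a subset of the line maps `A` to a set all of whose images
under distance functions are null, then the image of `A` has length zero. -/
theorem hausdorffMeasure_image_eq_zero_of_volume_image_dist_eq_zero {X : Type*} [MetricSpace X]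
    [MeasurableSpace X] [BorelSpace X] {c : ℝ → X} {S A : Set ℝ} (hc : LipschitzOnWith 1 c S)
    (hAS : A ⊆ S) (hnull : ∀ p, volume ((fun x ↦ dist x p) '' (c '' A)) = 0) :
    μH[1] (c '' A) = 0 := by
  let B := toMeasurable volume A
  have hB : MeasurableSet B := measurableSet_toMeasurable _ _
  have hloc : LocallyIntegrable (Bᶜ.indicator (fun _ ↦ (1 : ℝ))) :=
    (locallyIntegrable_const 1).indicator hB.compl
  have hint : ∀ u v : ℝ, IntervalIntegrable (Bᶜ.indicator (fun _ ↦ (1 : ℝ))) volume u v :=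
    fun u v ↦
    intervalIntegrable_iff.2
      ((hloc.integrableOn_isCompact isCompact_uIcc).mono_set uIoc_subset_uIcc)
  have hdist : ∀ s ∈ A, ∀ t ∈ A, dist (c s) (c t) ≤ (1 : ℝ≥0) *
      dist (∫ t in (0 : ℝ)..s, Bᶜ.indicator (fun _ ↦ (1 : ℝ)) t)
        (∫ t in (0 : ℝ)..t, Bᶜ.indicator (fun _ ↦ (1 : ℝ)) t) := by
    intro s hs t ht
    have hf₀ : LipschitzOnWith 1 (fun x ↦ dist (c x) (c t)) S := by
      simpa [Function.comp_def] using (LipschitzWith.dist_left (c t)).comp_lipschitzOnWith hc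
    obtain ⟨f, hf, hfeq⟩ := hf₀.extend_real
    have himg : volume (f '' A) = 0 := by
      have := hnull (c t)
      rwa [image_image, image_congr fun x hx ↦ hfeq (hAS hx)] at this
    have hzero : volume (B ∩ {x | deriv f x ≠ 0}) = 0 := by
      have hmeas : MeasurableSet {x | deriv f x ≠ 0} :=
        (measurableSet_eq_fun (measurable_deriv f) measurable_const).compl
      rw [Measure.measure_toMeasurable_inter_of_sFinite hmeas]
      exact volume_inter_deriv_ne_zero_of_volume_image_eq_zero himg
    have hbound : ∀ᵐ x, ‖deriv f x‖ ≤ Bᶜ.indicator (fun _ ↦ (1 : ℝ)) x := by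
      filter_upwards [measure_eq_zero_iff_ae_notMem.1 hzero] with x hx
      by_cases hxB : x ∈ B
      · have : deriv f x = 0 := by
          by_contra h
          exact hx ⟨hxB, h⟩
        simp [this, hxB]
      · simpa [hxB] using norm_deriv_le_of_lipschitz (x₀ := x) hf
    have hftc := (hf.lipschitzOnWith (s := uIcc t s)).absolutelyContinuousOnInterval
      |>.integral_deriv_eq_sub
    have e1 : dist (c s) (c t) = f s - f t := by
      rw [← hfeq (hAS hs), ← hfeq (hAS ht)]
      simp
    rw [e1, ← hftc, NNReal.coe_one, one_mul, Real.dist_eq,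
      intervalIntegral.integral_interval_sub_left (hint _ _) (hint _ _)]
    exact (le_abs_self _).trans
      (intervalIntegral.norm_integral_le_abs_of_norm_le (ae_restrict_of_ae hbound) (hint _ _))
  have key := hausdorffMeasure_image_le_of_dist_le hdist zero_le_one
  have hz := measure_mono_null (image_mono (subset_toMeasurable volume A))
    (volume_image_integral_indicator_compl_eq_zero hB)
  rw [hausdorffMeasure_real, hz] at key
  simpa using key

theorem HasUnitSpeedOn.lipschitzOnWith {X : Type*} [PseudoEMetricSpace X] {c : ℝ → X} {S : Set ℝ}
    (hc : HasUnitSpeedOn c S) : LipschitzOnWith 1 c S := by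
  have aux : ∀ x ∈ S, ∀ y ∈ S, x ≤ y → edist (c x) (c y) ≤ edist x y := by
    intro x hx y hy hxy
    have h := eVariationOn.edist_le c (s := S ∩ Icc x y) ⟨hx, le_rfl, hxy⟩ ⟨hy, hxy, le_rfl⟩
    rwa [hc hx hy, NNReal.coe_one, one_mul, ← abs_of_nonneg (sub_nonneg.2 hxy), ← Real.dist_eq,
      ← edist_dist, edist_comm y] at h
  intro x hx y hy
  rw [ENNReal.coe_one, one_mul]
  rcases le_total x y with h | h
  · exact aux x hx y hy h
  · rw [edist_comm, edist_comm x]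
    exact aux y hy x hx h

theorem stmt17 {X : Type*} [MetricSpace X] [MeasurableSpace X] [BorelSpace X]
    (a b : ℝ) (hab : a ≤ b) (γ : ℝ → X) (hγ : ContinuousOn γ (Icc a b))
    (hfin : eVariationOn γ (Icc a b) < ⊤)
    (E : Set X) (hEsub : E ⊆ γ '' Icc a b) (hEmeas : MeasurableSet E)
    (hEpos : 0 < μH[1] E) :
    ∃ (g : X → ℝ) (L : NNReal), LipschitzWith L g ∧ 0 < volume (g '' E) := by
  by_contra! hcon
  have hnull : ∀ p, volume ((fun x ↦ dist x p) '' E) = 0 := fun p ↦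
    nonpos_iff_eq_zero.1 (hcon _ 1 (LipschitzWith.dist_left p))
  have hbv : BoundedVariationOn γ (Icc a b) := hfin.ne
  have hloc := hbv.locallyBoundedVariationOn
  have ha : a ∈ Icc a b := left_mem_Icc.2 hab
  let c := naturalParameterization γ (Icc a b) a
  let V := variationOnFromTo γ (Icc a b) a
  have hcV : ∀ t ∈ Icc a b, c (V t) = γ t := fun t ht ↦
    edist_eq_zero.1 (edist_naturalParameterization_eq_zero hloc ha ht)
  have hlip := (has_unit_speed_naturalParameterization γ hloc ha).lipschitzOnWith
  have hE : c '' (V '' (Icc a b ∩ γ ⁻¹' E)) = E := by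
    rw [image_image, image_congr fun t ht ↦ hcV t ht.1, image_inter_preimage,
      inter_eq_right.2 hEsub]
  have := hausdorffMeasure_image_eq_zero_of_volume_image_dist_eq_zero hlip
    (image_mono inter_subset_left : V '' (Icc a b ∩ γ ⁻¹' E) ⊆ _)
    (fun p ↦ by rw [hE]; exact hnull p)
  rw [hE] at this
  exact hEpos.ne' this
end

section
/- Let X be a continuum with finite one-dimensional Hausdorff measure. Then there exists a surjective Lipschitz closed path γ : [0,1] → X with constant speed equal to 2·H^1(X), multiplicity m(γ,x) = 2 for H^1-almost every x ∈ X, and length(γ) = 2·H^1(X). -/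
open MeasureTheory ENNReal Set

/-- The multiplicity of the path `γ` (restricted to `I`) at the point `x`:
the number of preimages of `x` in `I`, as an extended nonnegative real. -/
noncomputable def pathMult {X : Type*} (γ : ℝ → X) (I : Set ℝ) (x : X) : ℝ≥0∞ :=
  ∑' _ : (γ ⁻¹' {x} ∩ I : Set ℝ), (1 : ℝ≥0∞)

open Filter Topology

section Chains

variable {X : Type*} [MetricSpace X]

/-- The intersection graph of a family of sets. -/
def overlapGraph {ι : Type*} (U : ι → Set X) : SimpleGraph ι where
  Adj i j := i ≠ j ∧ (U i ∩ U j).Nonempty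
  symm := ⟨fun _ _ h => ⟨h.1.symm, by rw [inter_comm]; exact h.2⟩⟩
  loopless := ⟨fun _ h => h.1 rfl⟩

/-- A walk in the intersection graph yields a discrete `1`-Lipschitz path, encoded as a set of
pairs (position, point), whose total length is the sum of the diameter bounds along the walk. -/
lemma exists_discrete_path_of_walk {ι : Type*} (U : ι → Set X) (D : ι → ℝ) (hD0 : ∀ i, 0 ≤ D i)
    (hD : ∀ i, ∀ p ∈ U i, ∀ q ∈ U i, dist p q ≤ D i) {δ : ℝ} (hδ : ∀ i, D i ≤ δ)
    {i j : ι} (w : (overlapGraph U).Walk i j) {x y : X} (hx : x ∈ U i) (hy : y ∈ U j) :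
    ∃ G : Set (ℝ × X), (0, x) ∈ G ∧ ((w.support.map D).sum, y) ∈ G ∧
      (∀ a ∈ G, 0 ≤ a.1) ∧ (∀ a ∈ G, ∀ b ∈ G, dist a.2 b.2 ≤ |a.1 - b.1|) ∧
      ∀ t ∈ Icc 0 (w.support.map D).sum, ∃ a ∈ G, |a.1 - t| ≤ δ := by
  induction w generalizing x with
  | @nil u =>
    have h1 := hD u x hx y hy
    have h0 := hD0 u
    refine ⟨{(0, x), (D u, y)}, by simp, by simp, ?_, ?_, ?_⟩
    · rintro a (rfl | rfl) <;> simp [h0]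
    · rintro a (rfl | rfl) b (rfl | rfl) <;> simp [abs_of_nonneg h0, h1, dist_comm y x]
    · intro t ht
      simp only [SimpleGraph.Walk.support_nil, List.map_cons, List.map_nil, List.sum_cons,
        List.sum_nil, add_zero] at ht
      refine ⟨(0, x), by simp, ?_⟩
      simp only [zero_sub, abs_neg, abs_of_nonneg ht.1]
      exact ht.2.trans (hδ u)
  | @cons u v k h w ih =>
    obtain ⟨p, hpu, hpv⟩ := h.2
    obtain ⟨G, h0, hS, hpos, hG, hcov⟩ := ih hpv hy
    have hu := hD0 u
    refine ⟨insert (0, x) ((fun a : ℝ × X => (D u + a.1, a.2)) '' G), by simp, ?_, ?_, ?_, ?_⟩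
    · exact Or.inr ⟨_, hS, by simp⟩
    · rintro a (rfl | ⟨a, ha, rfl⟩)
      · simp
      · exact add_nonneg hu (hpos a ha)
    · have key : ∀ a ∈ G, dist x a.2 ≤ D u + a.1 := fun a ha =>
        (dist_triangle x p a.2).trans (add_le_add (hD u x hx p hpu) (by
          simpa [abs_of_nonneg (hpos a ha)] using hG _ h0 a ha))
      have hn : ∀ a ∈ G, 0 ≤ D u + a.1 := fun a ha => add_nonneg hu (hpos a ha)
      rintro a (rfl | ⟨a, ha, rfl⟩) b (rfl | ⟨b, hb, rfl⟩)
      · simp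
      · simpa only [zero_sub, abs_neg, abs_of_nonneg (hn b hb)] using key b hb
      · simpa only [sub_zero, abs_of_nonneg (hn a ha), dist_comm] using key a ha
      · simpa using hG a ha b hb
    · intro t ht
      simp only [SimpleGraph.Walk.support_cons, List.map_cons, List.sum_cons] at ht
      rcases le_total t (D u) with h | h
      · refine ⟨(0, x), by simp, ?_⟩
        simp only [zero_sub, abs_neg, abs_of_nonneg ht.1]
        exact h.trans (hδ u)
      · obtain ⟨a, ha, hat⟩ := hcov (t - D u) ⟨by linarith, by linarith [ht.2]⟩
        refine ⟨_, Or.inr ⟨a, ha, rfl⟩, ?_⟩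
        convert hat using 2
        ring

lemma exists_walk_of_preconnected [PreconnectedSpace X] {ι : Type*} (U : ι → Set X)
    (hU : ∀ i, IsOpen (U i)) (hcov : ∀ x, ∃ i, x ∈ U i) {i j : ι} (hi : (U i).Nonempty)
    (hj : (U j).Nonempty) : (overlapGraph U).Reachable i j := by
  set V : Set X := ⋃ k ∈ {k | (overlapGraph U).Reachable i k}, U k
  have step : ∀ {k l x}, (overlapGraph U).Reachable i k → x ∈ U k → x ∈ U l →
      (overlapGraph U).Reachable i l := by
    intro k l x hk hxk hxl
    by_cases hkl : k = l
    · exact hkl ▸ hk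
    · exact hk.trans (SimpleGraph.Adj.reachable ⟨hkl, x, hxk, hxl⟩)
  have hV : IsOpen V := isOpen_biUnion fun k _ => hU k
  have hVc : IsOpen Vᶜ := by
    have : Vᶜ = ⋃ k ∈ {k | ¬ (overlapGraph U).Reachable i k}, U k := by
      ext x
      simp only [V, mem_compl_iff, mem_iUnion, mem_ofPred_eq, exists_prop, not_exists, not_and]
      constructor
      · intro h
        obtain ⟨k, hk⟩ := hcov x
        exact ⟨k, fun hr => h k hr hk, hk⟩
      · rintro ⟨k, hk, hxk⟩ l hl hxl
        exact hk (step hl hxl hxk)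
    rw [this]
    exact isOpen_biUnion fun k _ => hU k
  have huniv : V = univ := IsClopen.eq_univ ⟨isOpen_compl_iff.1 hVc, hV⟩ (by
    obtain ⟨x, hx⟩ := hi
    exact ⟨x, mem_biUnion (SimpleGraph.Reachable.refl i) hx⟩)
  obtain ⟨y, hy⟩ := hj
  obtain ⟨k, hk, hyk⟩ := mem_iUnion₂.1 (huniv ▸ mem_univ y : y ∈ V)
  exact step hk hyk hy

/-- A finite open cover of a connected space by sets of small diameter yields coarse paths
whose coarse Lipschitz constant is the sum of the diameters. -/
lemma exists_coarse_path_of_cover [PreconnectedSpace X] {ι : Type*} [Fintype ι] (U : ι → Set X)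
    (hU : ∀ i, IsOpen (U i)) (hcov : ∀ x, ∃ i, x ∈ U i) (D : ι → ℝ) (hD0 : ∀ i, 0 ≤ D i)
    (hD : ∀ i, ∀ p ∈ U i, ∀ q ∈ U i, dist p q ≤ D i) {δ : ℝ} (hδ : ∀ i, D i ≤ δ) (x y : X) :
    ∃ f : ℝ → X, dist (f 0) x ≤ δ ∧ dist (f 1) y ≤ δ ∧
      ∀ s ∈ Icc (0 : ℝ) 1, ∀ t ∈ Icc (0 : ℝ) 1,
        dist (f s) (f t) ≤ (∑ i, D i) * |s - t| + 2 * δ := by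
  classical
  obtain ⟨i, hi⟩ := hcov x
  obtain ⟨j, hj⟩ := hcov y
  obtain ⟨w⟩ := exists_walk_of_preconnected U hU hcov ⟨x, hi⟩ ⟨y, hj⟩
  have hp := w.toPath.2
  generalize w.toPath.1 = p at hp
  obtain ⟨G, h0, h1, -, hG, hc⟩ := exists_discrete_path_of_walk U D hD0 hD hδ p hi hj
  set S := (p.support.map D).sum
  have hS0 : 0 ≤ S := List.sum_nonneg (by simpa using fun a _ => hD0 a)
  have hS : S ≤ ∑ i, D i := by
    rw [show S = (p.support.map D).sum from rfl, ← List.sum_toFinset D hp.support_nodup]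
    exact Finset.sum_le_sum_of_subset_of_nonneg (Finset.subset_univ _) fun i _ _ => hD0 i
  have hc' : ∀ t : ℝ, ∃ a : ℝ × X, t ∈ Icc (0 : ℝ) 1 → a ∈ G ∧ |a.1 - S * t| ≤ δ := by
    intro t
    by_cases ht : t ∈ Icc (0 : ℝ) 1
    · obtain ⟨a, ha⟩ := hc (S * t) ⟨mul_nonneg hS0 ht.1, mul_le_of_le_one_right hS0 ht.2⟩
      exact ⟨a, fun _ => ha⟩
    · exact ⟨(0, x), fun h => absurd h ht⟩
  choose g hg using hc'
  refine ⟨fun t => (g t).2, ?_, ?_, ?_⟩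
  · have := hg 0 (by simp)
    exact (hG _ this.1 _ h0).trans (by simpa using this.2)
  · have := hg 1 (by simp)
    exact (hG _ this.1 _ h1).trans (by simpa using this.2)
  · intro s hs t ht
    obtain ⟨hs1, hs2⟩ := hg s hs
    obtain ⟨ht1, ht2⟩ := hg t ht
    calc dist (g s).2 (g t).2 ≤ |(g s).1 - (g t).1| := hG _ hs1 _ ht1
      _ = |((g s).1 - S * s) - ((g t).1 - S * t) + S * (s - t)| := by ring_nf
      _ ≤ |(g s).1 - S * s| + |(g t).1 - S * t| + S * |s - t| := by
        refine (abs_add_le _ _).trans (add_le_add (abs_sub _ _) ?_)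
        rw [abs_mul, abs_of_nonneg hS0]
      _ ≤ (∑ i, D i) * |s - t| + 2 * δ := by
        have := mul_le_mul_of_nonneg_right hS (abs_nonneg (s - t))
        linarith

/-- Coarse paths in a compact space converge to genuine Lipschitz paths along an ultrafilter. -/
lemma exists_limit_path [CompactSpace X] (f : ℕ → ℝ → X) (C ε : ℕ → ℝ) {c : ℝ}
    (hC : Tendsto C atTop (𝓝 c)) (hε : Tendsto ε atTop (𝓝 0))
    (h : ∀ n, ∀ s ∈ Icc (0 : ℝ) 1, ∀ t ∈ Icc (0 : ℝ) 1,
      dist (f n s) (f n t) ≤ C n * |s - t| + ε n) :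
    ∃ g : ℝ → X, (∀ t, Tendsto (fun n => f n t) (hyperfilter ℕ : Filter ℕ) (𝓝 (g t))) ∧
      ∀ s ∈ Icc (0 : ℝ) 1, ∀ t ∈ Icc (0 : ℝ) 1, dist (g s) (g t) ≤ c * |s - t| := by
  have hle : (hyperfilter ℕ : Filter ℕ) ≤ atTop := by
    rw [← Nat.cofinite_eq_atTop]; exact hyperfilter_le_cofinite
  have hlim : ∀ t, ∃ y, Tendsto (fun n => f n t) (hyperfilter ℕ : Filter ℕ) (𝓝 y) := by
    intro t
    obtain ⟨y, -, hy⟩ := isCompact_univ.ultrafilter_le_nhds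
      ((hyperfilter ℕ).map fun n => f n t) (by simp)
    exact ⟨y, hy⟩
  choose g hg using hlim
  refine ⟨g, hg, fun s hs t ht => ?_⟩
  have h1 := (hg s).dist (hg t)
  have h2 : Tendsto (fun n => C n * |s - t| + ε n) (hyperfilter ℕ : Filter ℕ)
      (𝓝 (c * |s - t| + 0)) := ((hC.mul_const _).add hε).mono_left hle
  simpa using le_of_tendsto_of_tendsto' h1 h2 fun n => h n s hs t ht

end Chains

section SharpPath

variable {X : Type*} [MetricSpace X] [MeasurableSpace X] [BorelSpace X] [CompactSpace X]

lemma exists_coarse_path [PreconnectedSpace X] (hfin : μH[1] (univ : Set X) < ⊤) (x y : X)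
    {ε : ℝ} (hε : 0 < ε) :
    ∃ f : ℝ → X, dist (f 0) x ≤ ε ∧ dist (f 1) y ≤ ε ∧
      ∀ s ∈ Icc (0 : ℝ) 1, ∀ t ∈ Icc (0 : ℝ) 1,
        dist (f s) (f t) ≤ ((μH[1] (univ : Set X)).toReal + ε) * |s - t| + 2 * ε := by
  set H := μH[1] (univ : Set X) with hH
  set e : ℝ≥0∞ := ENNReal.ofReal (ε / 4) with he
  have he0 : e ≠ 0 := by simp [he, hε]
  have htop : e ≠ ⊤ := by simp [he]
  obtain ⟨t, hcov, hdiam, hsum⟩ : ∃ t : ℕ → Set X, univ ⊆ ⋃ n, t n ∧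
      (∀ n, Metric.ediam (t n) ≤ e) ∧
      ∑' n, ⨆ _ : (t n).Nonempty, Metric.ediam (t n) ^ (1 : ℝ) < H + e := by
    have h1 : ⨅ (t : ℕ → Set X) (_ : univ ⊆ ⋃ n, t n) (_ : ∀ n, Metric.ediam (t n) ≤ e),
        ∑' n, ⨆ _ : (t n).Nonempty, Metric.ediam (t n) ^ (1 : ℝ) < H + e := by
      refine lt_of_le_of_lt ?_ (ENNReal.lt_add_right hfin.ne he0)
      rw [hH, Measure.hausdorffMeasure_apply]
      exact le_iSup₂_of_le e (pos_iff_ne_zero.2 he0) le_rfl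
    simpa only [iInf_lt_iff, exists_prop] using h1
  have hsum' : ∑' n, Metric.ediam (t n) < H + e := by
    refine lt_of_le_of_lt (ENNReal.tsum_le_tsum fun n => ?_) hsum
    rcases (t n).eq_empty_or_nonempty with h | h
    · simp [h]
    · simp [h]
  obtain ⟨η, hη0, hη⟩ := ENNReal.exists_pos_sum_of_countable he0 ℕ
  set U : ℕ → Set X := fun n => Metric.thickening (η n) (t n)
  have hUd : ∀ n, Metric.ediam (U n) ≤ Metric.ediam (t n) + 2 * η n := fun n =>
    Metric.ediam_thickening_le _
  obtain ⟨F, hF⟩ := isCompact_univ.elim_finite_subcover U (fun n => Metric.isOpen_thickening)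
    (hcov.trans (iUnion_mono fun n => Metric.self_subset_thickening (by exact_mod_cast hη0 n) _))
  have hηe : ∀ n, (η n : ℝ≥0∞) ≤ e := fun n => (ENNReal.le_tsum n).trans hη.le
  have hUe : ∀ n, Metric.ediam (U n) ≤ ENNReal.ofReal ε := fun n => by
    calc _ ≤ e + 2 * e := (hUd n).trans (add_le_add (hdiam n) (by gcongr; exact hηe n))
      _ = ENNReal.ofReal (3 * (ε / 4)) := by
        rw [ENNReal.ofReal_mul (by norm_num)]; simp; ring
      _ ≤ _ := ENNReal.ofReal_le_ofReal (by linarith)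
  have hUtop : ∀ n, Metric.ediam (U n) ≠ ⊤ := fun n => ((hUe n).trans_lt ofReal_lt_top).ne
  have hS : ∑ i : F, Metric.diam (U i) ≤ H.toReal + ε := by
    have h1 : ∑ i : F, Metric.ediam (U i) ≤ H + ENNReal.ofReal ε := by
      calc ∑ i : F, Metric.ediam (U i) = ∑ i ∈ F, Metric.ediam (U i) :=
            Finset.sum_coe_sort F fun i => Metric.ediam (U i)
        _ ≤ ∑' n, Metric.ediam (U n) := ENNReal.sum_le_tsum F
        _ ≤ ∑' n, (Metric.ediam (t n) + 2 * η n) := ENNReal.tsum_le_tsum hUd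
        _ = ∑' n, Metric.ediam (t n) + 2 * ∑' n, (η n : ℝ≥0∞) := by
          rw [ENNReal.tsum_add, ENNReal.tsum_mul_left]
        _ ≤ (H + e) + 2 * e := by gcongr
        _ = H + ENNReal.ofReal (3 * (ε / 4)) := by
          rw [ENNReal.ofReal_mul (by norm_num)]; simp; ring
        _ ≤ _ := by gcongr; linarith
    have h2 := ENNReal.toReal_mono (ENNReal.add_ne_top.2 ⟨hfin.ne, ofReal_ne_top⟩) h1
    rwa [ENNReal.toReal_add hfin.ne ofReal_ne_top, ENNReal.toReal_ofReal hε.le,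
      ENNReal.toReal_sum (s := Finset.univ) (f := fun i : F => Metric.ediam (U i))
        fun i _ => hUtop i] at h2
  obtain ⟨f, hf0, hf1, hf⟩ := exists_coarse_path_of_cover (fun i : F => U i)
    (fun i => Metric.isOpen_thickening)
    (fun x => by simpa using hF (mem_univ x)) (fun i => Metric.diam (U i))
    (fun i => Metric.diam_nonneg)
    (fun i p hp q hq => Metric.dist_le_diam_of_mem' (hUtop i) hp hq) (δ := ε)
    (fun i => ENNReal.toReal_le_of_le_ofReal hε.le (hUe i)) x y
  refine ⟨f, hf0, hf1, fun s hs t ht => (hf s hs t ht).trans ?_⟩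
  gcongr

/-- In a continuum of finite length, any two points are joined by a path whose length is
at most the length of the continuum. -/
lemma exists_path_of_hausdorffMeasure_lt_top [PreconnectedSpace X]
    (hfin : μH[1] (univ : Set X) < ⊤) (x y : X) :
    ∃ f : ℝ → X, f 0 = x ∧ f 1 = y ∧ ∀ s ∈ Icc (0 : ℝ) 1, ∀ t ∈ Icc (0 : ℝ) 1,
      dist (f s) (f t) ≤ (μH[1] (univ : Set X)).toReal * |s - t| := by
  set H := (μH[1] (univ : Set X)).toReal
  have hu := tendsto_one_div_add_atTop_nhds_zero_nat (𝕜 := ℝ)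
  choose f hf0 hf1 hf using fun n : ℕ => exists_coarse_path hfin x y (Nat.one_div_pos_of_nat (n := n))
  obtain ⟨g, hg, hg'⟩ := exists_limit_path f (fun n => H + 1 / ((n : ℝ) + 1))
    (fun n => 2 * (1 / ((n : ℝ) + 1))) (c := H) (by simpa using hu.const_add H)
    (by simpa using hu.const_mul 2) hf
  have hle : (hyperfilter ℕ : Filter ℕ) ≤ atTop := by
    rw [← Nat.cofinite_eq_atTop]; exact hyperfilter_le_cofinite
  have hend : ∀ t z, (∀ n, dist (f n t) z ≤ 1 / ((n : ℝ) + 1)) → g t = z := fun t z h =>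
    tendsto_nhds_unique (hg t) ((tendsto_iff_dist_tendsto_zero.2
      (squeeze_zero (fun _ => dist_nonneg) h hu)).mono_left hle)
  exact ⟨g, hend 0 x hf0, hend 1 y hf1, hg'⟩

end SharpPath

section Arc

lemma continuousOn_of_dist_le_mul {X : Type*} [PseudoMetricSpace X] {f : ℝ → X} {C : ℝ} {S : Set ℝ}
    (hf : ∀ s ∈ S, ∀ t ∈ S, dist (f s) (f t) ≤ C * |s - t|) : ContinuousOn f S := by
  refine (LipschitzOnWith.of_dist_le_mul (K := C.toNNReal) fun s hs t ht => ?_).continuousOn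
  rw [Real.dist_eq]
  exact (hf s hs t ht).trans
    (mul_le_mul_of_nonneg_right (Real.le_coe_toNNReal C) (abs_nonneg _))

variable {X : Type*} [MetricSpace X] [MeasurableSpace X] [BorelSpace X]

lemma hausdorffMeasure_image_Icc_le {f : ℝ → X} {C : ℝ} {a b : ℝ} (hC : 0 ≤ C)
    (hf : ∀ s ∈ Icc a b, ∀ t ∈ Icc a b, dist (f s) (f t) ≤ C * |s - t|) :
    μH[1] (f '' Icc a b) ≤ ENNReal.ofReal (C * (b - a)) := by
  have h : LipschitzOnWith C.toNNReal f (Icc a b) := LipschitzOnWith.of_dist_le_mul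
    fun s hs t ht => by rw [Real.coe_toNNReal C hC, Real.dist_eq]; exact hf s hs t ht
  refine (h.hausdorffMeasure_image_le zero_le_one).trans ?_
  rw [hausdorffMeasure_real, Real.volume_Icc, ENNReal.ofReal_mul hC, ENNReal.rpow_one]
  rfl

/-- A shortest path from a point to a closed set in a continuum of finite length:
its length equals the measure of its image, and it meets the closed set only once. -/
lemma exists_shortest_path [CompactSpace X] [PreconnectedSpace X]
    (hfin : μH[1] (univ : Set X) < ⊤) {T : Set X} (hT : IsClosed T) (hne : T.Nonempty) {y : X}
    (hy : y ∉ T) :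
    ∃ (ℓ : ℝ) (f : ℝ → X), 0 < ℓ ∧ f 0 ∈ T ∧ f 1 = y ∧
      (∀ s ∈ Icc (0 : ℝ) 1, ∀ t ∈ Icc (0 : ℝ) 1, dist (f s) (f t) ≤ ℓ * |s - t|) ∧
      (∀ s ∈ Ioc (0 : ℝ) 1, f s ∉ T) ∧ μH[1] (f '' Icc 0 1) = ENNReal.ofReal ℓ := by
  set S : Set ℝ := {C | 0 ≤ C ∧ ∃ f : ℝ → X, f 0 ∈ T ∧ f 1 = y ∧
    ∀ s ∈ Icc (0 : ℝ) 1, ∀ t ∈ Icc (0 : ℝ) 1, dist (f s) (f t) ≤ C * |s - t|}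
  have hSne : S.Nonempty := by
    obtain ⟨p, hp⟩ := hne
    obtain ⟨f, h0, h1, hf⟩ := exists_path_of_hausdorffMeasure_lt_top hfin p y
    exact ⟨_, ENNReal.toReal_nonneg, f, h0 ▸ hp, h1, hf⟩
  have hSb : BddBelow S := ⟨0, fun C hC => hC.1⟩
  set ℓ := sInf S with hℓ
  have hℓ0 : 0 ≤ ℓ := Real.sInf_nonneg fun C hC => hC.1
  obtain ⟨C, -, hC, hCS⟩ := exists_seq_tendsto_sInf hSne hSb
  choose hC0 F hF0 hF1 hF using hCS
  obtain ⟨f, hlim, hf⟩ := exists_limit_path F C (fun _ => 0) hC tendsto_const_nhds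
    (by simpa using hF)
  have hf0 : f 0 ∈ T := hT.mem_of_tendsto (hlim 0) (Eventually.of_forall hF0)
  have hf1 : f 1 = y := tendsto_nhds_unique (hlim 1) (by simp [hF1])
  have hpos : 0 < ℓ := by
    refine hℓ0.lt_of_ne fun h => hy ?_
    have := hf 0 (by simp) 1 (by simp)
    rw [← hℓ, ← h, zero_mul] at this
    rwa [← hf1, ← dist_le_zero.1 this]
  refine ⟨ℓ, f, hpos, hf0, hf1, hf, fun s hs hsT => ?_, le_antisymm ?_ ?_⟩
  · have hmem : ∀ t ∈ Icc (0 : ℝ) 1, s + (1 - s) * t ∈ Icc (0 : ℝ) 1 := fun t ht =>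
      ⟨add_nonneg hs.1.le (mul_nonneg (by linarith [hs.2]) ht.1), by nlinarith [hs.2, ht.2]⟩
    have : ℓ ≤ ℓ * (1 - s) := csInf_le hSb ⟨mul_nonneg hℓ0 (by linarith [hs.2]),
      fun t => f (s + (1 - s) * t), by simpa using hsT, by simpa using hf1, fun a ha b hb => by
        refine (hf _ (hmem a ha) _ (hmem b hb)).trans_eq ?_
        rw [show s + (1 - s) * a - (s + (1 - s) * b) = (1 - s) * (a - b) by ring, abs_mul,
          abs_of_nonneg (by linarith [hs.2]), mul_assoc]⟩
    nlinarith [hs.1]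
  · simpa using hausdorffMeasure_image_Icc_le hℓ0 hf
  · set K := f '' Icc 0 1
    have hcont := continuousOn_of_dist_le_mul hf
    have : CompactSpace K := isCompact_iff_compactSpace.1 (isCompact_Icc.image_of_continuousOn hcont)
    have : PreconnectedSpace K := Subtype.preconnectedSpace (isPreconnected_Icc.image f hcont)
    have hK : μH[1] (univ : Set K) = μH[1] K := by
      rw [← (isometry_subtype_coe (s := K)).hausdorffMeasure_image (Or.inl zero_le_one), image_univ,
        Subtype.range_coe]
    have hKtop : μH[1] K < ⊤ := (measure_mono (subset_univ _)).trans_lt hfin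
    obtain ⟨g, hg0, hg1, hg⟩ := exists_path_of_hausdorffMeasure_lt_top (hK ▸ hKtop)
      (⟨f 0, mem_image_of_mem f (by simp)⟩ : K) ⟨f 1, mem_image_of_mem f (by simp)⟩
    rw [hK] at hg
    exact ENNReal.ofReal_le_of_le_toReal (csInf_le hSb ⟨ENNReal.toReal_nonneg,
      fun t => (g t : X), by simpa [hg0] using hf0, by simpa [hg1] using hf1, hg⟩)

/-- Unit speed version of `exists_shortest_path`. -/
lemma exists_unit_speed_shortest_path [CompactSpace X] [PreconnectedSpace X]
    (hfin : μH[1] (univ : Set X) < ⊤) {T : Set X} (hT : IsClosed T) (hne : T.Nonempty) {y : X}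
    (hy : y ∉ T) :
    ∃ (ℓ : ℝ) (σ : ℝ → X), 0 < ℓ ∧ LipschitzWith 1 σ ∧ σ 0 ∈ T ∧ σ ℓ = y ∧
      (∀ u ∈ Ioc 0 ℓ, σ u ∉ T) ∧ μH[1] (σ '' Icc 0 ℓ) = ENNReal.ofReal ℓ := by
  obtain ⟨ℓ, f, hℓ, h0, h1, hf, hfT, hμ⟩ := exists_shortest_path hfin hT hne hy
  have hσ : ∀ u ∈ Icc 0 ℓ, (projIcc (0 : ℝ) 1 zero_le_one (u / ℓ) : ℝ) = u / ℓ := fun u hu => by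
    rw [projIcc_of_mem _ ⟨div_nonneg hu.1 hℓ.le, (div_le_one hℓ).2 hu.2⟩]
  refine ⟨ℓ, fun u => f (projIcc (0 : ℝ) 1 zero_le_one (u / ℓ)), hℓ, ?_, ?_, ?_, ?_, ?_⟩
  · refine LipschitzWith.of_dist_le_mul fun u v => ?_
    refine (hf _ (projIcc 0 1 zero_le_one (u / ℓ)).2 _ (projIcc 0 1 zero_le_one (v / ℓ)).2).trans ?_
    have h := (LipschitzWith.projIcc (zero_le_one (α := ℝ))).dist_le_mul (u / ℓ) (v / ℓ)
    rw [Subtype.dist_eq, Real.dist_eq, Real.dist_eq, ← sub_div, abs_div, abs_of_pos hℓ] at h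
    calc _ ≤ ℓ * ((1 : NNReal) * (|u - v| / ℓ)) := mul_le_mul_of_nonneg_left h hℓ.le
      _ = _ := by rw [Real.dist_eq]; field_simp
  · simpa [hσ 0 (by simp [hℓ.le])] using h0
  · change f (projIcc (0 : ℝ) 1 zero_le_one (ℓ / ℓ)) = y
    rw [hσ ℓ (by simp [hℓ.le]), div_self hℓ.ne', h1]
  · intro u hu
    simp only [hσ u ⟨hu.1.le, hu.2⟩]
    exact hfT _ ⟨div_pos hu.1 hℓ, (div_le_one hℓ).2 hu.2⟩
  · rw [← hμ]
    congr 1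
    ext x
    constructor
    · rintro ⟨u, -, rfl⟩
      exact mem_image_of_mem f (Subtype.prop _)
    · rintro ⟨v, hv, rfl⟩
      have hm : v * ℓ ∈ Icc 0 ℓ := ⟨mul_nonneg hv.1 hℓ.le, mul_le_of_le_one_left hℓ.le hv.2⟩
      refine ⟨v * ℓ, hm, ?_⟩
      change f (projIcc (0 : ℝ) 1 zero_le_one (v * ℓ / ℓ)) = f v
      rw [hσ _ hm, mul_div_cancel_right₀ v hℓ.ne']

end Arc

section Tour

lemma LipschitzWith.ite_le {X : Type*} [PseudoMetricSpace X] {K : NNReal} {f g : ℝ → X}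
    (hf : LipschitzWith K f) (hg : LipschitzWith K g) {a : ℝ} (h : f a = g a) :
    LipschitzWith K fun t => if t ≤ a then f t else g t := by
  have key : ∀ s t, s ≤ a → a < t → dist (f s) (g t) ≤ K * |s - t| := by
    intro s t hs ht
    calc dist (f s) (g t) ≤ dist (f s) (f a) + dist (g a) (g t) := by
          rw [← h]; exact dist_triangle _ _ _
      _ ≤ K * |s - a| + K * |a - t| := add_le_add (hf.dist_le_mul _ _) (hg.dist_le_mul _ _)
      _ = K * |s - t| := by
        rw [abs_of_nonpos (by linarith), abs_of_nonpos (by linarith), abs_of_nonpos (by linarith)]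
        ring
  refine LipschitzWith.of_dist_le_mul fun s t => ?_
  rw [Real.dist_eq]
  split_ifs with hs ht ht
  · exact hf.dist_le_mul _ _
  · exact key s t hs (not_le.1 ht)
  · rw [dist_comm, abs_sub_comm]; exact key t s ht (not_le.1 hs)
  · exact hg.dist_le_mul _ _

/-- The path `γ` visits `x` at two times of `[0, L]` which are at least `c` apart. -/
def VisitsTwice {X : Type*} (γ : ℝ → X) (L : ℝ) (x : X) (c : ℝ) : Prop :=
  ∃ t ∈ Icc 0 L, ∃ s ∈ Icc 0 L, γ t = x ∧ γ s = x ∧ c ≤ s - t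

lemma visitsTwice_zero_iff {X : Type*} {γ : ℝ → X} {L : ℝ} {x : X} :
    VisitsTwice γ L x 0 ↔ x ∈ γ '' Icc 0 L := by
  constructor
  · rintro ⟨t, ht, -, -, h, -⟩
    exact ⟨t, ht, h⟩
  · rintro ⟨t, ht, h⟩
    exact ⟨t, ht, t, ht, h, h, by simp⟩

variable {X : Type*} [MetricSpace X] [MeasurableSpace X] [BorelSpace X]

/-- A closed `1`-Lipschitz path of length at most twice the measure of its image,
visiting almost every point of its image at least twice. -/
structure IsTour (γ : ℝ → X) (L : ℝ) : Prop where
  nonneg : 0 ≤ L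
  lipschitz : LipschitzWith 1 γ
  closed : γ 0 = γ L
  le_measure : ENNReal.ofReal L ≤ 2 * μH[1] (γ '' Icc 0 L)
  ae_visitsTwice : ∀ᵐ x ∂(μH[1] : Measure X), x ∈ γ '' Icc 0 L → ∃ c > 0, VisitsTwice γ L x c

/-- The path `γ` with a round trip along `σ`, of length `2 * ℓ`, inserted at time `a`. -/
noncomputable def insertRoundTrip {X : Type*} (γ σ : ℝ → X) (a ℓ : ℝ) (t : ℝ) : X :=
  if t ≤ a then γ t else if t ≤ a + 2 * ℓ then σ (ℓ - |t - a - ℓ|) else γ (t - 2 * ℓ)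

section insertRoundTrip

variable {X : Type*} {γ σ : ℝ → X} {a ℓ : ℝ}

lemma insertRoundTrip_of_le {t : ℝ} (ht : t ≤ a) : insertRoundTrip γ σ a ℓ t = γ t := if_pos ht

lemma insertRoundTrip_of_ge (hℓ : 0 < ℓ) (h : γ a = σ 0) {t : ℝ} (ht : a ≤ t) :
    insertRoundTrip γ σ a ℓ (t + 2 * ℓ) = γ t := by
  rw [insertRoundTrip, if_neg (by linarith)]
  split_ifs with h1
  · obtain rfl : t = a := by linarith
    rw [show t + 2 * ℓ - t - ℓ = ℓ by ring, abs_of_pos hℓ, sub_self, h]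
  · rw [add_sub_cancel_right]

lemma insertRoundTrip_out {u : ℝ} (hu : u ∈ Icc 0 ℓ) (h : γ a = σ 0) :
    insertRoundTrip γ σ a ℓ (a + u) = σ u := by
  have : ℓ - |a + u - a - ℓ| = u := by
    rw [add_sub_cancel_left, abs_of_nonpos (by linarith [hu.2])]; ring
  rw [insertRoundTrip, if_pos (by linarith [hu.1, hu.2] : a + u ≤ a + 2 * ℓ), this]
  split_ifs with h1
  · obtain rfl : u = 0 := le_antisymm (by linarith) hu.1
    rw [add_zero, h]
  · rfl

lemma insertRoundTrip_back (hℓ : 0 < ℓ) {u : ℝ} (hu : u ∈ Icc 0 ℓ) :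
    insertRoundTrip γ σ a ℓ (a + 2 * ℓ - u) = σ u := by
  have : ℓ - |a + 2 * ℓ - u - a - ℓ| = u := by
    rw [abs_of_nonneg (by linarith [hu.2])]; ring
  rw [insertRoundTrip, if_neg (by linarith [hu.1, hu.2]), if_pos (by linarith [hu.1]), this]

lemma lipschitzWith_insertRoundTrip [PseudoMetricSpace X] (hγ : LipschitzWith 1 γ)
    (hσ : LipschitzWith 1 σ) (hℓ : 0 < ℓ) (h : γ a = σ 0) :
    LipschitzWith 1 (insertRoundTrip γ σ a ℓ) := by
  refine hγ.ite_le (LipschitzWith.ite_le ?_ ?_ ?_) ?_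
  · refine LipschitzWith.of_dist_le_mul fun s t => (hσ.dist_le_mul _ _).trans ?_
    rw [NNReal.coe_one, one_mul, one_mul, Real.dist_eq, Real.dist_eq]
    calc |ℓ - |s - a - ℓ| - (ℓ - |t - a - ℓ|)| = abs (|t - a - ℓ| - |s - a - ℓ|) := by ring_nf
      _ ≤ |(t - a - ℓ) - (s - a - ℓ)| := abs_abs_sub_abs_le_abs_sub _ _
      _ = |s - t| := by rw [abs_sub_comm]; ring_nf
  · refine LipschitzWith.of_dist_le_mul fun s t => (hγ.dist_le_mul _ _).trans_eq ?_
    rw [dist_sub_right]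
  · rw [show a + 2 * ℓ - a - ℓ = ℓ by ring, abs_of_pos hℓ, sub_self, ← h]
    congr 1; ring
  · rw [if_pos (by linarith), show a - a - ℓ = -ℓ by ring, abs_neg, abs_of_pos hℓ, sub_self, h]

lemma VisitsTwice.insertRoundTrip (hℓ : 0 < ℓ) (h : γ a = σ 0) {L : ℝ} {x : X} {c : ℝ}
    (hc : 0 ≤ c) (hv : VisitsTwice γ L x c) :
    VisitsTwice (insertRoundTrip γ σ a ℓ) (L + 2 * ℓ) x c := by
  obtain ⟨t, ht, s, hs, htx, hsx, hts⟩ := hv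
  rcases le_total t a with hta | hta <;> rcases le_total s a with hsa | hsa
  · exact ⟨t, ⟨ht.1, by linarith [ht.2]⟩, s, ⟨hs.1, by linarith [hs.2]⟩,
      by rwa [insertRoundTrip_of_le hta], by rwa [insertRoundTrip_of_le hsa], hts⟩
  · exact ⟨t, ⟨ht.1, by linarith [ht.2]⟩, s + 2 * ℓ, ⟨by linarith [hs.1], by linarith [hs.2]⟩,
      by rwa [insertRoundTrip_of_le hta], by rwa [insertRoundTrip_of_ge hℓ h hsa], by linarith⟩
  all_goals
    exact ⟨t + 2 * ℓ, ⟨by linarith [ht.1], by linarith [ht.2]⟩, s + 2 * ℓ,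
      ⟨by linarith [hs.1], by linarith [hs.2]⟩, by rwa [insertRoundTrip_of_ge hℓ h hta],
      by rwa [insertRoundTrip_of_ge hℓ h (by linarith)], by linarith⟩

lemma image_insertRoundTrip_subset {L : ℝ} (ha : a ∈ Icc 0 L) (h : γ a = σ 0) :
    _root_.insertRoundTrip γ σ a ℓ '' Icc 0 (L + 2 * ℓ) ⊆ γ '' Icc 0 L ∪ σ '' Ioc 0 ℓ := by
  rintro _ ⟨t, ht, rfl⟩
  rw [_root_.insertRoundTrip]
  split_ifs with h1 h2
  · exact Or.inl ⟨t, ⟨ht.1, h1.trans ha.2⟩, rfl⟩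
  · have h3 : |t - a - ℓ| ≤ ℓ := abs_le.2 ⟨by linarith, by linarith⟩
    rcases h3.eq_or_lt with h4 | h4
    · exact Or.inl ⟨a, ha, by rw [h4, sub_self, h]⟩
    · exact Or.inr ⟨_, ⟨by linarith, by linarith [abs_nonneg (t - a - ℓ)]⟩, rfl⟩
  · exact Or.inl ⟨_, ⟨by linarith [ha.1], by linarith [ht.2]⟩, rfl⟩

end insertRoundTrip

instance : NullSingletonClass (μH[1] : Measure X) :=
  Measure.nullSingletonClass_hausdorff X one_pos

lemma isTour_const (p : X) : IsTour (fun _ : ℝ => p) 0 where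
  nonneg := le_rfl
  lipschitz := LipschitzWith.const' p
  closed := rfl
  le_measure := by simp
  ae_visitsTwice := by
    filter_upwards [measure_eq_zero_iff_ae_notMem.1 (measure_singleton (μ := μH[1]) p)] with x hx h
    simp_all

/-- A tour can be enlarged so as to visit any given point. -/
lemma IsTour.exists_extension [CompactSpace X] [PreconnectedSpace X]
    (hfin : μH[1] (univ : Set X) < ⊤) {γ : ℝ → X} {L : ℝ} (hγ : IsTour γ L) (y : X) :
    ∃ (γ' : ℝ → X) (L' : ℝ), IsTour γ' L' ∧ L ≤ L' ∧ y ∈ γ' '' Icc 0 L' ∧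
      ∀ x c, 0 ≤ c → VisitsTwice γ L x c → VisitsTwice γ' L' x c := by
  by_cases hy : y ∈ γ '' Icc 0 L
  · exact ⟨γ, L, hγ, le_rfl, hy, fun _ _ _ h => h⟩
  have hT : IsCompact (γ '' Icc 0 L) := isCompact_Icc.image hγ.lipschitz.continuous
  obtain ⟨ℓ, σ, hℓ, hσ, ⟨a, ha, h⟩, hσy, hσT, hμ⟩ := exists_unit_speed_shortest_path hfin
    hT.isClosed ⟨γ 0, mem_image_of_mem γ ⟨le_rfl, hγ.nonneg⟩⟩ hy
  set γ' := insertRoundTrip γ σ a ℓ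
  have hmono : ∀ x c, 0 ≤ c → VisitsTwice γ L x c → VisitsTwice γ' (L + 2 * ℓ) x c :=
    fun x c hc hv => hv.insertRoundTrip hℓ h hc
  have hσ' : ∀ u ∈ Icc 0 ℓ, VisitsTwice γ' (L + 2 * ℓ) (σ u) (2 * (ℓ - u)) := fun u hu =>
    ⟨a + u, ⟨add_nonneg ha.1 hu.1, by linarith [ha.2, hu.2]⟩, a + 2 * ℓ - u,
      ⟨by linarith [ha.1, hu.2], by linarith [ha.2, hu.1]⟩, insertRoundTrip_out hu h,
      insertRoundTrip_back hℓ hu, by linarith⟩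
  have hsub : γ '' Icc 0 L ∪ σ '' Ioc 0 ℓ ⊆ γ' '' Icc 0 (L + 2 * ℓ) := by
    rintro x (hx | ⟨u, hu, rfl⟩)
    · exact visitsTwice_zero_iff.1 (hmono x 0 le_rfl (visitsTwice_zero_iff.2 hx))
    · obtain ⟨t, ht, -, -, htx, -⟩ := hσ' u ⟨hu.1.le, hu.2⟩
      exact ⟨t, ht, htx⟩
  refine ⟨γ', L + 2 * ℓ, ⟨by linarith [hγ.nonneg],
    lipschitzWith_insertRoundTrip hγ.lipschitz hσ hℓ h, ?_, ?_, ?_⟩, by linarith, ?_, hmono⟩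
  · exact (insertRoundTrip_of_le ha.1).trans
      (hγ.closed.trans (insertRoundTrip_of_ge hℓ h ha.2).symm)
  · have hdisj : Disjoint (σ '' Ioc 0 ℓ) (γ '' Icc 0 L) :=
      Set.disjoint_left.2 fun x ⟨u, hu, hx⟩ hxT => hσT u hu (hx ▸ hxT)
    have hIoc : ENNReal.ofReal ℓ ≤ μH[1] (σ '' Ioc 0 ℓ) := by
      rw [← hμ, ← Ioc_insert_left hℓ.le, image_insert_eq]
      exact (measure_congr (insert_ae_eq_self _ _)).le
    calc ENNReal.ofReal (L + 2 * ℓ) = ENNReal.ofReal L + 2 * ENNReal.ofReal ℓ := by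
          rw [ENNReal.ofReal_add hγ.nonneg (by linarith), ENNReal.ofReal_mul (by norm_num)]; simp
      _ ≤ 2 * μH[1] (γ '' Icc 0 L) + 2 * μH[1] (σ '' Ioc 0 ℓ) := by
        gcongr
        exact hγ.le_measure
      _ = 2 * μH[1] (σ '' Ioc 0 ℓ ∪ γ '' Icc 0 L) := by
        rw [measure_union hdisj hT.measurableSet]; ring
      _ ≤ _ := by
        rw [union_comm]
        gcongr
  · filter_upwards [hγ.ae_visitsTwice,
      measure_eq_zero_iff_ae_notMem.1 (measure_singleton (μ := μH[1]) y)] with x hx hxy hx'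
    rcases image_insertRoundTrip_subset ha h hx' with hxT | ⟨u, hu, rfl⟩
    · obtain ⟨c, hc, hv⟩ := hx hxT
      exact ⟨c, hc, hmono x c hc.le hv⟩
    · have : u < ℓ := hu.2.lt_of_ne fun e => hxy (by rw [e, hσy]; rfl)
      exact ⟨_, by linarith, hσ' u ⟨hu.1.le, hu.2⟩⟩
  · exact hsub (Or.inr ⟨ℓ, ⟨hℓ, le_rfl⟩, hσy⟩)

end Tour

section Limit

variable {X : Type*} [MetricSpace X] [MeasurableSpace X] [BorelSpace X]

lemma VisitsTwice.exists_rescaled {X : Type*} {γ : ℝ → X} {L c : ℝ} {x : X}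
    (h : VisitsTwice γ L x c) :
    ∃ t ∈ Icc (0 : ℝ) 1, ∃ s ∈ Icc (0 : ℝ) 1, γ (L * t) = x ∧ γ (L * s) = x ∧
      c ≤ L * (s - t) := by
  obtain ⟨t, ht, s, hs, htx, hsx, hc⟩ := h
  have hmul : ∀ t ∈ Icc 0 L, L * (t / L) = t := fun t ht => by
    rcases eq_or_ne L 0 with rfl | hL
    · simpa using (le_antisymm ht.2 ht.1).symm
    · exact mul_div_cancel₀ t hL
  have hmem : ∀ t ∈ Icc 0 L, t / L ∈ Icc (0 : ℝ) 1 := fun t ht =>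
    ⟨div_nonneg ht.1 (ht.1.trans ht.2), div_le_one_of_le₀ ht.2 (ht.1.trans ht.2)⟩
  exact ⟨t / L, hmem t ht, s / L, hmem s hs, by rwa [hmul t ht], by rwa [hmul s hs],
    by rwa [mul_sub, hmul t ht, hmul s hs]⟩

variable [CompactSpace X] [ConnectedSpace X]

/-- An increasing sequence of tours with dense union. -/
lemma exists_seq_isTour (hfin : μH[1] (univ : Set X) < ⊤) :
    ∃ (γ : ℕ → ℝ → X) (L : ℕ → ℝ), (∀ n, IsTour (γ n) (L n)) ∧ Monotone L ∧
      (∀ n m x c, n ≤ m → 0 ≤ c → VisitsTwice (γ n) (L n) x c → VisitsTwice (γ m) (L m) x c) ∧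
      Dense (⋃ n, γ n '' Icc 0 (L n)) := by
  have step : ∀ (T : {p : (ℝ → X) × ℝ // IsTour p.1 p.2}) (y : X),
      ∃ T' : {p : (ℝ → X) × ℝ // IsTour p.1 p.2}, T.1.2 ≤ T'.1.2 ∧
        y ∈ T'.1.1 '' Icc 0 T'.1.2 ∧
        ∀ x c, 0 ≤ c → VisitsTwice T.1.1 T.1.2 x c → VisitsTwice T'.1.1 T'.1.2 x c := by
    intro T y
    obtain ⟨γ', L', h, h'⟩ := T.2.exists_extension hfin y
    exact ⟨⟨(γ', L'), h⟩, h'⟩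
  choose next hle hmem hvis using step
  let u := TopologicalSpace.denseSeq X
  let T : ℕ → {p : (ℝ → X) × ℝ // IsTour p.1 p.2} :=
    fun n => Nat.rec ⟨(fun _ => u 0, 0), isTour_const (u 0)⟩ (fun n T => next T (u n)) n
  refine ⟨fun n => (T n).1.1, fun n => (T n).1.2, fun n => (T n).2,
    monotone_nat_of_le_succ fun n => hle (T n) (u n), fun n m x c hnm hc h => ?_, ?_⟩
  · induction m, hnm using Nat.le_induction with
    | base => exact h
    | succ m _ ih => exact hvis (T m) (u m) x c hc ih
  · refine (TopologicalSpace.denseRange_denseSeq X).mono ?_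
    rintro _ ⟨n, rfl⟩
    exact mem_iUnion.2 ⟨n + 1, hmem (T n) (u n)⟩

lemma exists_closed_path_visiting_twice (hfin : μH[1] (univ : Set X) < ⊤) :
    ∃ (g : ℝ → X) (c : ℝ) (A : Set X), 0 ≤ c ∧
      (∀ s ∈ Icc (0 : ℝ) 1, ∀ t ∈ Icc (0 : ℝ) 1, dist (g s) (g t) ≤ c * |s - t|) ∧
      g 0 = g 1 ∧ g '' Icc 0 1 = univ ∧ MeasurableSet A ∧ ENNReal.ofReal c ≤ 2 * μH[1] A ∧
      ∀ᵐ x ∂(μH[1] : Measure X), x ∈ A →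
        ∃ t ∈ Icc (0 : ℝ) 1, ∃ s ∈ Icc (0 : ℝ) 1, t ≠ s ∧ g t = x ∧ g s = x := by
  obtain ⟨γ, L, htour, hLmono, hvis, hdense⟩ := exists_seq_isTour hfin
  set A := ⋃ n, γ n '' Icc 0 (L n)
  have hLA : ∀ n, ENNReal.ofReal (L n) ≤ 2 * μH[1] A := fun n =>
    (htour n).le_measure.trans (by gcongr; exact subset_iUnion (fun n => γ n '' Icc 0 (L n)) n)
  have hAtop : 2 * μH[1] A ≠ ⊤ := ENNReal.mul_ne_top (by simp)
    ((measure_mono (subset_univ A)).trans_lt hfin).ne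
  have hLbdd : BddAbove (range L) := ⟨(2 * μH[1] A).toReal, by
    rintro _ ⟨n, rfl⟩
    exact (ENNReal.ofReal_le_iff_le_toReal hAtop).1 (hLA n)⟩
  set c := ⨆ n, L n
  have hLc : Tendsto L atTop (𝓝 c) := tendsto_atTop_ciSup hLmono hLbdd
  have hL0 : ∀ n, 0 ≤ L n := fun n => (htour n).nonneg
  have hlip : ∀ n s t, dist (γ n (L n * s)) (γ n (L n * t)) ≤ L n * |s - t| := fun n s t => by
    refine ((htour n).lipschitz.dist_le_mul _ _).trans_eq ?_
    rw [NNReal.coe_one, one_mul, Real.dist_eq, ← mul_sub, abs_mul, abs_of_nonneg (hL0 n)]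
  obtain ⟨g, hg, hgc⟩ := exists_limit_path (fun n t => γ n (L n * t)) L (fun _ => 0) hLc
    tendsto_const_nhds fun n s _ t _ => by simpa using hlip n s t
  have hle : (hyperfilter ℕ : Filter ℕ) ≤ atTop := by
    rw [← Nat.cofinite_eq_atTop]; exact hyperfilter_le_cofinite
  have hLh : Tendsto L (hyperfilter ℕ : Filter ℕ) (𝓝 c) := hLc.mono_left hle
  have key : ∀ N x d, 0 ≤ d → VisitsTwice (γ N) (L N) x d →
      ∃ t ∈ Icc (0 : ℝ) 1, ∃ s ∈ Icc (0 : ℝ) 1, g t = x ∧ g s = x ∧ d ≤ c * (s - t) := by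
    intro N x d hd hv
    have hex : ∀ n, ∃ p : ℝ × ℝ, p.1 ∈ Icc (0 : ℝ) 1 ∧ p.2 ∈ Icc (0 : ℝ) 1 ∧
        (N ≤ n → γ n (L n * p.1) = x ∧ γ n (L n * p.2) = x ∧ d ≤ L n * (p.2 - p.1)) := by
      intro n
      by_cases hn : N ≤ n
      · obtain ⟨t, ht, s, hs, h⟩ := (hvis N n x d hn hd hv).exists_rescaled
        exact ⟨(t, s), ht, hs, fun _ => h⟩
      · exact ⟨(0, 0), by simp, by simp, fun h => absurd h hn⟩
    choose p hp1 hp2 hp using hex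
    have hev : ∀ᶠ n in (hyperfilter ℕ : Filter ℕ), N ≤ n := hle (eventually_ge_atTop N)
    have hcomp : ∀ q : ℕ → ℝ, (∀ n, q n ∈ Icc (0 : ℝ) 1) → (∀ n, N ≤ n → γ n (L n * q n) = x) →
        ∃ t ∈ Icc (0 : ℝ) 1, Tendsto q (hyperfilter ℕ : Filter ℕ) (𝓝 t) ∧ g t = x := by
      intro q hq hqx
      obtain ⟨t, ht, hqt⟩ := isCompact_Icc.ultrafilter_le_nhds ((hyperfilter ℕ).map q)
        (tendsto_principal.2 (Eventually.of_forall hq))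
      have hqt : Tendsto q (hyperfilter ℕ : Filter ℕ) (𝓝 t) := hqt
      refine ⟨t, ht, hqt, tendsto_nhds_unique (hg t) (tendsto_iff_dist_tendsto_zero.2 ?_)⟩
      have h0 : Tendsto (fun n => L n * |t - q n|) (hyperfilter ℕ : Filter ℕ) (𝓝 0) := by
        simpa using hLh.mul ((tendsto_const_nhds (x := t)).sub hqt).abs
      refine squeeze_zero' (Eventually.of_forall fun _ => dist_nonneg) ?_ h0
      filter_upwards [hev] with n hn
      conv_lhs => rw [← hqx n hn]
      exact hlip n _ _
    obtain ⟨t, ht, htl, htx⟩ := hcomp (fun n => (p n).1) hp1 fun n hn => (hp n hn).1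
    obtain ⟨s, hs, hsl, hsx⟩ := hcomp (fun n => (p n).2) hp2 fun n hn => (hp n hn).2.1
    refine ⟨t, ht, s, hs, htx, hsx, ge_of_tendsto (hLh.mul (hsl.sub htl)) ?_⟩
    filter_upwards [hev] with n hn using (hp n hn).2.2
  have himg : IsCompact (g '' Icc 0 1) :=
    isCompact_Icc.image_of_continuousOn (continuousOn_of_dist_le_mul hgc)
  refine ⟨g, c, A, ge_of_tendsto' hLc hL0, hgc, ?_, ?_, ?_, ?_, ?_⟩
  · refine tendsto_nhds_unique (hg 0) ((hg 1).congr fun n => ?_)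
    rw [mul_zero, mul_one, (htour n).closed]
  · refine eq_univ_of_univ_subset (hdense.closure_eq ▸ himg.isClosed.closure_subset_iff.2 ?_)
    refine iUnion_subset fun N x hx => ?_
    obtain ⟨t, ht, -, -, htx, -⟩ := key N x 0 le_rfl (visitsTwice_zero_iff.2 hx)
    exact ⟨t, ht, htx⟩
  · exact MeasurableSet.iUnion fun n =>
      (isCompact_Icc.image (htour n).lipschitz.continuous).measurableSet
  · exact le_of_tendsto' (ENNReal.tendsto_ofReal hLc) hLA
  · filter_upwards [ae_all_iff.2 fun n => (htour n).ae_visitsTwice] with x hx hxA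
    obtain ⟨N, hN⟩ := mem_iUnion.1 hxA
    obtain ⟨d, hd, hv⟩ := hx N hN
    obtain ⟨t, ht, s, hs, htx, hsx, hts⟩ := key N x d hd.le hv
    refine ⟨t, ht, s, hs, ?_, htx, hsx⟩
    rintro rfl
    simp only [sub_self, mul_zero] at hts
    exact hts.not_gt hd

end Limit

section Area

variable {X : Type*} [MetricSpace X]

/-- The points dividing `[a, b]` into `n + 1` equal parts. -/
noncomputable def partitionPoint (a b : ℝ) (n i : ℕ) : ℝ := a + (b - a) * (i / (n + 1))

section partitionPoint

variable {a b : ℝ}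

lemma partitionPoint_zero (n : ℕ) : partitionPoint a b n 0 = a := by simp [partitionPoint]

lemma partitionPoint_last (n : ℕ) : partitionPoint a b n (n + 1) = b := by
  have : (n : ℝ) + 1 ≠ 0 := by positivity
  simp [partitionPoint, this]

lemma partitionPoint_succ_sub (n i : ℕ) :
    partitionPoint a b n (i + 1) - partitionPoint a b n i = (b - a) * (1 / (n + 1)) := by
  simp only [partitionPoint, Nat.cast_add, Nat.cast_one]
  ring

lemma monotone_partitionPoint (hab : a ≤ b) (n : ℕ) : Monotone (partitionPoint a b n) :=
  monotone_nat_of_le_succ fun i => by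
    have := partitionPoint_succ_sub (a := a) (b := b) n i
    have h : 0 ≤ (b - a) * (1 / ((n : ℝ) + 1)) := mul_nonneg (by linarith) (by positivity)
    linarith

lemma Icc_partitionPoint_subset (hab : a ≤ b) {n i : ℕ} (hi : i < n + 1) :
    Icc (partitionPoint a b n i) (partitionPoint a b n (i + 1)) ⊆ Icc a b := by
  have h := monotone_partitionPoint hab n
  refine Icc_subset_Icc ?_ ?_
  · simpa only [partitionPoint_zero] using h (Nat.zero_le i)
  · simpa only [partitionPoint_last] using h hi

lemma exists_mem_Icc_partitionPoint (n : ℕ) {t : ℝ} (ht : t ∈ Icc a b) :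
    ∃ i < n + 1, t ∈ Icc (partitionPoint a b n i) (partitionPoint a b n (i + 1)) := by
  have : ∀ m, t ≤ partitionPoint a b n (m + 1) →
      ∃ i < m + 1, t ∈ Icc (partitionPoint a b n i) (partitionPoint a b n (i + 1)) := by
    intro m
    induction m with
    | zero => exact fun h => ⟨0, one_pos, by rw [partitionPoint_zero]; exact ht.1, h⟩
    | succ m ih =>
      intro h
      rcases le_total t (partitionPoint a b n (m + 1)) with h' | h'
      · obtain ⟨i, hi, hti⟩ := ih h'
        exact ⟨i, by omega, hti⟩
      · exact ⟨m + 1, by omega, h', h⟩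
  exact this n (by rw [partitionPoint_last]; exact ht.2)

lemma abs_sub_le_of_mem_Icc_partitionPoint {n i : ℕ} {s t : ℝ}
    (hs : s ∈ Icc (partitionPoint a b n i) (partitionPoint a b n (i + 1)))
    (ht : t ∈ Icc (partitionPoint a b n i) (partitionPoint a b n (i + 1))) :
    |s - t| ≤ (b - a) * (1 / (n + 1)) := by
  have := partitionPoint_succ_sub (a := a) (b := b) n i
  exact abs_le.2 ⟨by linarith [hs.1, ht.2], by linarith [hs.2, ht.1]⟩

lemma sum_eVariationOn_partitionPoint (f : ℝ → X) (hab : a ≤ b) (n : ℕ) :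
    ∑ i ∈ Finset.range (n + 1),
      eVariationOn f (Icc (partitionPoint a b n i) (partitionPoint a b n (i + 1))) =
        eVariationOn f (Icc a b) := by
  rw [eVariationOn.sum' f (monotone_partitionPoint hab n), partitionPoint_zero,
    partitionPoint_last]

end partitionPoint

variable [MeasurableSpace X] [BorelSpace X] {a b C : ℝ} {f : ℝ → X}

lemma hausdorffMeasure_image_le_eVariationOn (hab : a ≤ b) (hC : 0 ≤ C)
    (hf : ∀ s ∈ Icc a b, ∀ t ∈ Icc a b, dist (f s) (f t) ≤ C * |s - t|) :
    μH[1] (f '' Icc a b) ≤ eVariationOn f (Icc a b) := by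
  set J : ∀ n : ℕ, Fin (n + 1) → Set ℝ := fun n i =>
    Icc (partitionPoint a b n i) (partitionPoint a b n (i + 1))
  have hr : Tendsto (fun n : ℕ => ENNReal.ofReal (C * ((b - a) * (1 / ((n : ℝ) + 1))))) atTop
      (𝓝 0) := by
    have h := ((tendsto_one_div_add_atTop_nhds_zero_nat (𝕜 := ℝ)).const_mul (b - a)).const_mul C
    simpa using ENNReal.tendsto_ofReal h
  refine (Measure.hausdorffMeasure_le_liminf_sum 1 (f '' Icc a b) _ hr (fun n i => f '' J n i)
    (Eventually.of_forall fun n i => ?_) (Eventually.of_forall fun n => ?_)).trans ?_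
  · refine Metric.ediam_le ?_
    rintro _ ⟨s, hs, rfl⟩ _ ⟨t, ht, rfl⟩
    rw [edist_dist]
    refine ENNReal.ofReal_le_ofReal ((hf s (Icc_partitionPoint_subset hab i.2 hs) t
      (Icc_partitionPoint_subset hab i.2 ht)).trans ?_)
    exact mul_le_mul_of_nonneg_left (abs_sub_le_of_mem_Icc_partitionPoint hs ht) hC
  · rintro _ ⟨t, ht, rfl⟩
    obtain ⟨i, hi, hti⟩ := exists_mem_Icc_partitionPoint n ht
    exact mem_iUnion.2 ⟨⟨i, hi⟩, mem_image_of_mem f hti⟩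
  · refine (liminf_le_liminf (v := fun _ => eVariationOn f (Icc a b))
      (Eventually.of_forall fun n => ?_)).trans_eq (liminf_const _)
    rw [← sum_eVariationOn_partitionPoint f hab n, ← Fin.sum_univ_eq_sum_range
      (fun i => eVariationOn f (Icc (partitionPoint a b n i) (partitionPoint a b n (i + 1))))]
    refine Finset.sum_le_sum fun i _ => ?_
    rw [ENNReal.rpow_one]
    refine Metric.ediam_le ?_
    rintro _ ⟨s, hs, rfl⟩ _ ⟨t, ht, rfl⟩
    exact eVariationOn.edist_le f hs ht

/-- The multiplicity of a Lipschitz path has a measurable majorant whose integral is at most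
the length of the path. -/
lemma exists_measurable_ge_pathMult (hab : a ≤ b) (hC : 0 ≤ C)
    (hf : ∀ s ∈ Icc a b, ∀ t ∈ Icc a b, dist (f s) (f t) ≤ C * |s - t|) :
    ∃ M : X → ℝ≥0∞, Measurable M ∧ (∀ x, pathMult f (Icc a b) x ≤ M x) ∧
      ∫⁻ x, M x ∂μH[1] ≤ eVariationOn f (Icc a b) := by
  set K : ℕ → ℕ → Set X := fun n i =>
    f '' Icc (partitionPoint a b n i) (partitionPoint a b n (i + 1))
  set m : ℕ → X → ℝ≥0∞ := fun n x =>
    ∑ i ∈ Finset.range (n + 1), (K n i).indicator (fun _ => 1) x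
  have hK : ∀ n, ∀ i ∈ Finset.range (n + 1), MeasurableSet (K n i) := fun n i hi =>
    (isCompact_Icc.image_of_continuousOn ((continuousOn_of_dist_le_mul hf).mono
      (Icc_partitionPoint_subset hab (Finset.mem_range.1 hi)))).measurableSet
  have hm : ∀ n, Measurable (m n) := fun n =>
    Finset.measurable_fun_sum _ fun i hi => measurable_const.indicator (hK n i hi)
  refine ⟨fun x => liminf (fun n => m n x) atTop, Measurable.liminf hm, fun x => ?_, ?_⟩
  · rw [pathMult, ENNReal.tsum_eq_iSup_sum]
    refine iSup_le fun F => le_liminf_of_le (h := ?_)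
    have hsep : ∀ᶠ n : ℕ in atTop, ∀ s ∈ F, ∀ t ∈ F, s ≠ t →
        (b - a) * (1 / ((n : ℝ) + 1)) < |(s : ℝ) - t| := by
      rw [Filter.eventually_all_finset]
      intro s _
      rw [Filter.eventually_all_finset]
      intro t _
      by_cases hst : s = t
      · exact Eventually.of_forall fun n h => absurd hst h
      · have h := (tendsto_one_div_add_atTop_nhds_zero_nat (𝕜 := ℝ)).const_mul (b - a)
        rw [mul_zero] at h
        filter_upwards [h.eventually_lt_const
          (abs_pos.2 (sub_ne_zero.2 fun e => hst (Subtype.ext e)))] with n hn _ using hn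
    filter_upwards [hsep] with n hn
    choose k hk hkt using fun t : (f ⁻¹' {x} ∩ Icc a b : Set ℝ) =>
      exists_mem_Icc_partitionPoint n t.2.2
    have hinj : InjOn k F := fun s hs t ht hst => by
      by_contra hne
      exact (hn s hs t ht hne).not_ge
        (abs_sub_le_of_mem_Icc_partitionPoint (hkt s) (hst ▸ hkt t))
    calc ∑ t ∈ F, (1 : ℝ≥0∞) = ∑ t ∈ F, (K n (k t)).indicator (fun _ => 1) x :=
          Finset.sum_congr rfl fun t _ => by
            rw [indicator_of_mem (mem_image_of_mem f (hkt t) |> fun h => by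
              rwa [show f t = x from t.2.1] at h)]
      _ = ∑ i ∈ F.image k, (K n i).indicator (fun _ => 1) x :=
        (Finset.sum_image (f := fun i => (K n i).indicator (fun _ => (1 : ℝ≥0∞)) x) hinj).symm
      _ ≤ m n x := Finset.sum_le_sum_of_subset fun i hi => by
        obtain ⟨t, -, rfl⟩ := Finset.mem_image.1 hi
        exact Finset.mem_range.2 (hk t)
  · refine (lintegral_liminf_le hm).trans ?_
    refine (liminf_le_liminf (v := fun _ => eVariationOn f (Icc a b))
      (Eventually.of_forall fun n => ?_)).trans_eq (liminf_const _)
    rw [lintegral_finsetSum' _ fun i hi =>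
        (measurable_const.indicator (hK n i hi)).aemeasurable,
      ← sum_eVariationOn_partitionPoint f hab n]
    refine Finset.sum_le_sum fun i hi => ?_
    rw [lintegral_indicator_const (hK n i hi), one_mul]
    have hsub := Icc_partitionPoint_subset hab (Finset.mem_range.1 hi)
    exact hausdorffMeasure_image_le_eVariationOn (monotone_partitionPoint hab n (Nat.le_succ i)) hC
      fun s hs t ht => hf s (hsub hs) t (hsub ht)

lemma eVariationOn_Icc_le_of_dist_le {X : Type*} [PseudoMetricSpace X] {f : ℝ → X} {a b C : ℝ}
    (hC : 0 ≤ C)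
    (hf : ∀ s ∈ Icc a b, ∀ t ∈ Icc a b, dist (f s) (f t) ≤ C * |s - t|) :
    eVariationOn f (Icc a b) ≤ ENNReal.ofReal (C * (b - a)) := by
  refine iSup_le fun ⟨n, u, hu, hmem⟩ => ?_
  calc ∑ i ∈ Finset.range n, edist (f (u (i + 1))) (f (u i))
      ≤ ∑ i ∈ Finset.range n, ENNReal.ofReal (C * (u (i + 1) - u i)) :=
        Finset.sum_le_sum fun i _ => by
          rw [edist_dist]
          refine ENNReal.ofReal_le_ofReal ((hf _ (hmem _) _ (hmem _)).trans_eq ?_)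
          rw [abs_of_nonneg (sub_nonneg.2 (hu (Nat.le_succ i)))]
    _ = ENNReal.ofReal (C * (u n - u 0)) := by
        rw [← ENNReal.ofReal_sum_of_nonneg fun i _ =>
            mul_nonneg hC (sub_nonneg.2 (hu (Nat.le_succ i))),
          ← Finset.mul_sum, Finset.sum_range_sub]
    _ ≤ _ := ENNReal.ofReal_le_ofReal (mul_le_mul_of_nonneg_left
        (by linarith [(hmem n).2, (hmem 0).1]) hC)

/-- A Lipschitz path whose length is as large as the Lipschitz constant allows has constant
speed. -/
lemma eVariationOn_Icc_eq_of_total {X : Type*} [PseudoMetricSpace X] {f : ℝ → X} {C : ℝ}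
    (hC : 0 ≤ C)
    (hf : ∀ s ∈ Icc (0 : ℝ) 1, ∀ t ∈ Icc (0 : ℝ) 1, dist (f s) (f t) ≤ C * |s - t|)
    (htot : ENNReal.ofReal C ≤ eVariationOn f (Icc 0 1)) {s t : ℝ} (hs : 0 ≤ s) (hst : s ≤ t)
    (ht : t ≤ 1) : eVariationOn f (Icc s t) = ENNReal.ofReal (C * (t - s)) := by
  have hle : ∀ a b, 0 ≤ a → b ≤ 1 →
      eVariationOn f (Icc a b) ≤ ENNReal.ofReal (C * (b - a)) := fun a b ha hb =>
    eVariationOn_Icc_le_of_dist_le hC fun u hu v hv =>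
      hf u (Icc_subset_Icc ha hb hu) v (Icc_subset_Icc ha hb hv)
  have hadd : ∀ a b c : ℝ, a ≤ b → b ≤ c →
      eVariationOn f (Icc a c) = eVariationOn f (Icc a b) + eVariationOn f (Icc b c) :=
    fun a b c hab hbc => by
      simpa using (eVariationOn.Icc_add_Icc f hab hbc (mem_univ b)).symm
  refine le_antisymm (hle s t hs ht) ?_
  have h0 : 0 ≤ C * s := mul_nonneg hC hs
  have h1 : 0 ≤ C * (t - s) := mul_nonneg hC (by linarith)
  have h2 : 0 ≤ C * (1 - t) := mul_nonneg hC (by linarith)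
  have key : ENNReal.ofReal (C * s + C * (1 - t)) + ENNReal.ofReal (C * (t - s)) ≤
      ENNReal.ofReal (C * s + C * (1 - t)) + eVariationOn f (Icc s t) := by
    calc _ = ENNReal.ofReal C := by
          rw [← ENNReal.ofReal_add (add_nonneg h0 h2) h1]; ring_nf
      _ ≤ eVariationOn f (Icc 0 s) + (eVariationOn f (Icc s t) + eVariationOn f (Icc t 1)) := by
          rwa [← hadd s t 1 hst ht, ← hadd 0 s 1 hs (hst.trans ht)]
      _ ≤ ENNReal.ofReal (C * (s - 0)) +
          (eVariationOn f (Icc s t) + ENNReal.ofReal (C * (1 - t))) := by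
          gcongr
          · exact hle 0 s le_rfl (hst.trans ht)
          · exact hle t 1 (hs.trans hst) le_rfl
      _ = _ := by rw [sub_zero, ENNReal.ofReal_add h0 h2]; ring
  exact (ENNReal.add_le_add_iff_left ofReal_ne_top).1 key

end Area

lemma one_le_pathMult {X : Type*} {f : ℝ → X} {I : Set ℝ} {t : ℝ} (ht : t ∈ I) :
    1 ≤ pathMult f I (f t) :=
  ENNReal.le_tsum (f := fun _ : (f ⁻¹' {f t} ∩ I : Set ℝ) => (1 : ℝ≥0∞)) ⟨t, rfl, ht⟩

lemma two_le_pathMult {X : Type*} {f : ℝ → X} {I : Set ℝ} {x : X} {s t : ℝ} (hs : s ∈ I)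
    (ht : t ∈ I) (hst : s ≠ t) (hsx : f s = x) (htx : f t = x) : 2 ≤ pathMult f I x := by
  rw [pathMult, ENNReal.tsum_set_one]
  have : (2 : ℕ∞) ≤ (f ⁻¹' {x} ∩ I).encard := by
    rw [← encard_pair hst]
    exact encard_le_encard (by rintro _ (rfl | rfl) <;> simp_all)
  exact_mod_cast ENat.toENNReal_le.2 this

theorem stmt18 {X : Type*} [MetricSpace X] [MeasurableSpace X] [BorelSpace X]
    [CompactSpace X] [ConnectedSpace X] [Nonempty X]
    (hfin : μH[1] (univ : Set X) < ⊤) :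
    ∃ γ : ℝ → X,
      (∃ L : NNReal, LipschitzOnWith L γ (Icc 0 1)) ∧
      γ 0 = γ 1 ∧
      γ '' Icc 0 1 = univ ∧
      (∀ s t : ℝ, 0 ≤ s → s ≤ t → t ≤ 1 →
        eVariationOn γ (Icc s t) = 2 * μH[1] (univ : Set X) * ENNReal.ofReal (t - s)) ∧
      (∀ᵐ x ∂(μH[1] : Measure X), pathMult γ (Icc 0 1) x = 2) ∧
      eVariationOn γ (Icc 0 1) = 2 * μH[1] (univ : Set X) := by
  obtain ⟨γ, c, A, hc, hγ, hclosed, hsurj, hA, hcA, htwice⟩ :=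
    exists_closed_path_visiting_twice hfin
  obtain ⟨M, hM, hMγ, hMint⟩ := exists_measurable_ge_pathMult zero_le_one hc hγ
  have hVc : eVariationOn γ (Icc 0 1) ≤ ENNReal.ofReal c := by
    simpa using eVariationOn_Icc_le_of_dist_le hc hγ
  have hMone : ∀ x, 1 ≤ M x := fun x => by
    obtain ⟨t, ht, rfl⟩ := hsurj.symm ▸ mem_univ x
    exact (one_le_pathMult ht).trans (hMγ _)
  have hmtwo : ∀ᵐ x ∂(μH[1] : Measure X), x ∈ A → 2 ≤ pathMult γ (Icc 0 1) x := by
    filter_upwards [htwice] with x hx hxA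
    obtain ⟨t, ht, s, hs, hts, htx, hsx⟩ := hx hxA
    exact two_le_pathMult ht hs hts htx hsx
  have hAtop : 2 * μH[1] A ≠ ⊤ :=
    ENNReal.mul_ne_top (by simp) ((measure_mono (subset_univ A)).trans_lt hfin).ne
  have hAc : μH[1] Aᶜ = 0 := by
    have h : 2 * μH[1] A + μH[1] Aᶜ ≤ 2 * μH[1] A + 0 := by
      calc 2 * μH[1] A + μH[1] Aᶜ = ∫⁻ _ in A, 2 ∂μH[1] + ∫⁻ _ in Aᶜ, 1 ∂μH[1] := by simp
        _ ≤ ∫⁻ x in A, M x ∂μH[1] + ∫⁻ x in Aᶜ, M x ∂μH[1] := by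
          refine add_le_add (lintegral_mono_ae ((ae_restrict_iff' hA).2 ?_))
            (lintegral_mono fun x => hMone x)
          filter_upwards [hmtwo] with x hx hxA using (hx hxA).trans (hMγ x)
        _ = ∫⁻ x, M x ∂μH[1] := lintegral_add_compl M hA
        _ ≤ 2 * μH[1] A + 0 := by
          rw [add_zero]
          exact hMint.trans (hVc.trans hcA)
    exact nonpos_iff_eq_zero.1 ((ENNReal.add_le_add_iff_left hAtop).1 h)
  have hmtwo' : ∀ᵐ x ∂(μH[1] : Measure X), 2 ≤ pathMult γ (Icc 0 1) x := by
    filter_upwards [hmtwo, measure_eq_zero_iff_ae_notMem.1 hAc] with x hx hxA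
    exact hx (not_not.1 hxA)
  have hAuniv : μH[1] A = μH[1] (univ : Set X) := by
    rw [← measure_add_measure_compl hA, hAc, add_zero]
  have hlower : 2 * μH[1] (univ : Set X) ≤ ∫⁻ x, M x ∂μH[1] := by
    rw [← lintegral_const]
    refine lintegral_mono_ae ?_
    filter_upwards [hmtwo'] with x hx using hx.trans (hMγ x)
  have hcV : ENNReal.ofReal c ≤ eVariationOn γ (Icc 0 1) :=
    hcA.trans (hAuniv ▸ hlower.trans hMint)
  have hcH : ENNReal.ofReal c = 2 * μH[1] (univ : Set X) :=
    le_antisymm (hAuniv ▸ hcA) (hlower.trans (hMint.trans hVc))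
  have hM2 : (fun _ => 2) =ᵐ[μH[1]] M := by
    refine ae_eq_of_ae_le_of_lintegral_le ?_ ?_ hM.aemeasurable ?_
    · filter_upwards [hmtwo'] with x hx using hx.trans (hMγ x)
    · simpa using ENNReal.mul_ne_top ENNReal.ofNat_ne_top hfin.ne
    · rw [lintegral_const, ← hcH]
      exact hMint.trans hVc
  refine ⟨γ, ⟨c.toNNReal, ?_⟩, hclosed, hsurj, fun s t hs hst ht => ?_, ?_,
    (le_antisymm hVc hcV).trans hcH⟩
  · exact LipschitzOnWith.of_dist_le_mul fun s hs t ht => by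
      rw [Real.coe_toNNReal c hc, Real.dist_eq]
      exact hγ s hs t ht
  · rw [eVariationOn_Icc_eq_of_total hc hγ hcV hs hst ht, ENNReal.ofReal_mul hc, hcH]
  · filter_upwards [hmtwo', hM2] with x hx hx2
    exact le_antisymm ((hMγ x).trans hx2.ge) hx
end
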